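/- Let n ≥ 2 be odd. Every continuous, translation invariant valuation μ on ℂⁿ satisfying μ(gK) = (det g) μ(K) for all g ∈ U(n) and all convex bodies K is identically zero. -/

import Mathlib

open MeasureTheory
open scoped ENNReal

noncomputable section

/-- `ℂⁿ`, regarded as a real inner product space via `Re⟨z,w⟫`. -/
abbrev Cn (n : ℕ) := EuclideanSpace ℂ (Fin n)

/-- `μ` is a valuation: it is finitely additive on convex bodies of `ℂⁿ`. -/
def IsValuation {n : ℕ} (μ : ConvexBody (Cn n) → ℂ) : Prop :=
  ∀ K L U I : ConvexBody (Cn n),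
    (U : Set (Cn n)) = (K : Set (Cn n)) ∪ (L : Set (Cn n)) →
    (I : Set (Cn n)) = (K : Set (Cn n)) ∩ (L : Set (Cn n)) →
    μ U + μ I = μ K + μ L

/-- `μ` is translation invariant. -/
def TranslationInvariant {n : ℕ} (μ : ConvexBody (Cn n) → ℂ) : Prop :=
  ∀ (x : Cn n) (K L : ConvexBody (Cn n)),
    (L : Set (Cn n)) = (fun y => x + y) '' (K : Set (Cn n)) → μ L = μ K

/-- `μ` has weight `l` : `μ (g K) = (det g)^l • μ K` for all `g ∈ U(n)`. -/
def HasWeight {n : ℕ} (l : ℤ) (μ : ConvexBody (Cn n) → ℂ) : Prop :=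
  ∀ g ∈ Matrix.unitaryGroup (Fin n) ℂ, ∀ K L : ConvexBody (Cn n),
    (L : Set (Cn n)) = (Matrix.toEuclideanLin g) '' (K : Set (Cn n)) →
    μ L = (Matrix.det g) ^ l * μ K

namespace Sublin

section

variable {V : Type*} [NormedAddCommGroup V] [InnerProductSpace ℝ V]

/-- Sublinear functions, that is, support functions of convex bodies. -/
structure IsSub (h : V → ℝ) : Prop where
  add_le : ∀ x y, h (x + y) ≤ h x + h y
  smul : ∀ (t : ℝ) x, 0 ≤ t → h (t • x) = t * h x

/-- The linear form given by inner product with `v`. -/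
def lin (v : V) : V → ℝ := fun x => inner ℝ v x

@[simp] lemma lin_apply (v x : V) : lin v x = inner ℝ v x := rfl

lemma lin_add (v w : V) : lin (v + w) = lin v + lin w := by
  ext x; simp [inner_add_left]

lemma lin_neg (v : V) : lin (-v) = -lin v := by
  ext x; simp

lemma lin_smul (t : ℝ) (v : V) : lin (t • v) = t • lin v := by
  ext x; simp [inner_smul_left]

@[simp] lemma lin_zero : lin (0 : V) = 0 := by
  ext x; simp

namespace IsSub

variable {h k : V → ℝ}

lemma map_zero (hh : IsSub h) : h 0 = 0 := by
  simpa using hh.smul 0 0 le_rfl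

lemma lin (v : V) : IsSub (lin v) :=
  ⟨fun x y => by simp [inner_add_right], fun t x _ => by simp [inner_smul_right]⟩

lemma zero : IsSub (0 : V → ℝ) := ⟨by simp, by simp⟩

lemma add (hh : IsSub h) (hk : IsSub k) : IsSub (h + k) :=
  ⟨fun x y => by have := hh.add_le x y; have := hk.add_le x y; simp only [Pi.add_apply]; linarith,
    fun t x ht => by simp only [Pi.add_apply, hh.smul t x ht, hk.smul t x ht]; ring⟩

lemma const_smul (hh : IsSub h) {c : ℝ} (hc : 0 ≤ c) : IsSub (c • h) :=
  ⟨fun x y => by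
      have := mul_le_mul_of_nonneg_left (hh.add_le x y) hc
      simp only [Pi.smul_apply, smul_eq_mul]; linarith,
    fun t x ht => by simp only [Pi.smul_apply, smul_eq_mul, hh.smul t x ht]; ring⟩

lemma sup (hh : IsSub h) (hk : IsSub k) : IsSub (h ⊔ k) :=
  ⟨fun x y => by
      simp only [Pi.sup_apply]
      exact sup_le ((hh.add_le x y).trans (add_le_add le_sup_left le_sup_left))
        ((hk.add_le x y).trans (add_le_add le_sup_right le_sup_right)),
    fun t x ht => by
      simp only [Pi.sup_apply, hh.smul t x ht, hk.smul t x ht]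
      exact (mul_max_of_nonneg _ _ ht).symm⟩

lemma norm : IsSub (fun x : V => ‖x‖) :=
  ⟨norm_add_le, fun t x ht => by rw [norm_smul, Real.norm_of_nonneg ht]⟩

lemma comp (hh : IsSub h) {W : Type*} [NormedAddCommGroup W] [InnerProductSpace ℝ W]
    (f : W →ₗ[ℝ] V) : IsSub (h ∘ f) :=
  ⟨fun x y => by simpa using hh.add_le (f x) (f y), fun t x ht => by simp [hh.smul t _ ht]⟩

lemma add_lin (hh : IsSub h) (v : V) : IsSub (h + Sublin.lin v) := hh.add (lin v)

lemma abs_lin (v : V) : IsSub |Sublin.lin v| := by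
  rw [abs, ← lin_neg]; exact (lin v).sup (lin _)

lemma pos_lin (v : V) : IsSub (Sublin.lin v ⊔ 0) := (lin v).sup zero

lemma neg_le (hh : IsSub h) (x : V) : -h (-x) ≤ h x := by
  have := hh.add_le x (-x); rw [add_neg_cancel, hh.map_zero] at this; linarith

lemma sub_le (hh : IsSub h) (x y : V) : h x - h y ≤ h (x - y) := by
  have := hh.add_le (x - y) y; rw [sub_add_cancel] at this; linarith

/-- Pointwise limits of sublinear functions are sublinear. -/
lemma of_tendsto {ι : Type*} {l : Filter ι} [l.NeBot] {f : ι → V → ℝ} (hf : ∀ i, IsSub (f i))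
    (hl : ∀ x, Filter.Tendsto (fun i => f i x) l (nhds (h x))) : IsSub h :=
  ⟨fun x y => le_of_tendsto_of_tendsto (hl _) ((hl x).add (hl y))
      (Filter.Eventually.of_forall fun i => (hf i).add_le x y),
    fun t x ht => tendsto_nhds_unique (hl _) (by
      simp_rw [(hf _).smul t x ht]; exact (hl x).const_mul t)⟩

variable [FiniteDimensional ℝ V]

lemma exists_le_norm (hh : IsSub h) : ∃ L, 0 ≤ L ∧ ∀ x, |h x| ≤ L * ‖x‖ := by
  set b := stdOrthonormalBasis ℝ V
  have key : ∃ L, 0 ≤ L ∧ ∀ x, h x ≤ L * ‖x‖ := by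
    refine ⟨∑ i, (|h (b i)| + |h (-b i)|), Finset.sum_nonneg fun i _ => by positivity, fun x => ?_⟩
    have h1 : ∀ (s : Finset (Fin (Module.finrank ℝ V))) (f : Fin (Module.finrank ℝ V) → V),
        h (∑ i ∈ s, f i) ≤ ∑ i ∈ s, h (f i) := fun s f =>
      Finset.le_sum_of_subadditive h hh.map_zero.le hh.add_le s f
    conv_lhs => rw [← b.sum_repr' x]
    refine (h1 _ _).trans ?_
    rw [Finset.sum_mul]
    refine Finset.sum_le_sum fun i _ => ?_
    have hb : |inner ℝ (b i) x| ≤ ‖x‖ := by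
      simpa using abs_real_inner_le_norm (b i) x
    rcases le_total 0 (inner ℝ (b i) x) with h0 | h0
    · rw [hh.smul _ _ h0]
      rw [abs_of_nonneg h0] at hb
      nlinarith [le_abs_self (h (b i)), abs_nonneg (h (b i)), abs_nonneg (h (-b i))]
    · rw [← neg_smul_neg, hh.smul _ _ (by linarith)]
      rw [abs_of_nonpos h0] at hb
      nlinarith [le_abs_self (h (-b i)), abs_nonneg (h (b i)), abs_nonneg (h (-b i))]
  obtain ⟨L, hL, H⟩ := key
  refine ⟨L, hL, fun x => abs_le.2 ⟨?_, H x⟩⟩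
  have := H (-x); rw [norm_neg] at this; linarith [hh.neg_le x]

lemma lipschitz (hh : IsSub h) : ∃ L, 0 ≤ L ∧ ∀ x y, |h x - h y| ≤ L * ‖x - y‖ := by
  obtain ⟨L, hL, H⟩ := hh.exists_le_norm
  refine ⟨L, hL, fun x y => abs_le.2 ⟨?_, ?_⟩⟩
  · have := hh.sub_le y x; have := (abs_le.1 (H (y - x))).2; rw [norm_sub_rev] at this; linarith
  · have := hh.sub_le x y; have := (abs_le.1 (H (x - y))).2; linarith

lemma continuous (hh : IsSub h) : Continuous h := by
  obtain ⟨L, hL, H⟩ := hh.lipschitz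
  exact (LipschitzWith.of_dist_le_mul (K := ⟨L, hL⟩) fun x y => by
    rw [Real.dist_eq, dist_eq_norm]; exact H x y).continuous

/-- A sublinear function is attained at each point by a linear form below it. -/
lemma exists_support (hh : IsSub h) (x₀ : V) :
    ∃ y : V, (∀ x, inner ℝ y x ≤ h x) ∧ inner ℝ y x₀ = h x₀ := by
  have key : ∀ f : V →ₗ.[ℝ] ℝ, (∀ x : f.domain, f x ≤ h x) →
      ∃ y : V, (∀ x, inner ℝ y x ≤ h x) ∧ ∀ x : f.domain, inner ℝ y (x : V) = f x := by
    intro f hf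
    obtain ⟨g, hg1, hg2⟩ := exists_extension_of_le_sublinear f h
      (fun c hc x => hh.smul c x hc.le) hh.add_le hf
    refine ⟨(InnerProductSpace.toDual ℝ V).symm g.toContinuousLinearMap, fun x => ?_, fun x => ?_⟩
    · simpa using hg2 x
    · simpa using hg1 x
  by_cases h0 : x₀ = 0
  · obtain ⟨y, hy, -⟩ := key ⊥ (by
      rintro ⟨x, hx⟩
      have : x = 0 := (Submodule.mem_bot ℝ).1 hx
      subst this
      simp [hh.map_zero]
      exact (LinearPMap.map_zero _).le)
    exact ⟨y, hy, by simp [h0, hh.map_zero]⟩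
  · obtain ⟨y, hy, hy2⟩ := key (LinearPMap.mkSpanSingleton x₀ (h x₀) h0) (by
      rintro ⟨x, hx⟩
      obtain ⟨c, rfl⟩ := Submodule.mem_span_singleton.1 hx
      refine (LinearPMap.mkSpanSingleton'_apply x₀ (h x₀) _ c hx).le.trans ?_
      simp only [smul_eq_mul, RingHom.id_apply]
      rcases le_total 0 c with hc | hc
      · rw [hh.smul _ _ hc]
      · have e : c • x₀ = (-c) • (-x₀) := by simp
        rw [e, hh.smul _ _ (by linarith)]
        nlinarith [hh.neg_le x₀])
    refine ⟨y, hy, ?_⟩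
    have := hy2 ⟨x₀, Submodule.mem_span_singleton_self x₀⟩
    simp only at this
    rw [this]
    exact LinearPMap.mkSpanSingleton'_apply_self _ _ _ _

end IsSub

/-- A functional on sublinear functions with the properties of a continuous translation
invariant valuation on convex bodies. -/
structure IsVal (ν : (V → ℝ) → ℂ) : Prop where
  val : ∀ h k, IsSub h → IsSub k → IsSub (h ⊓ k) → ν (h ⊔ k) + ν (h ⊓ k) = ν h + ν k
  trans : ∀ h, IsSub h → ∀ y, ν (h + lin y) = ν h
  cont : ∀ h, IsSub h → ∀ ε > 0, ∃ δ > 0, ∀ k, IsSub k → (∀ x, |k x - h x| ≤ δ * ‖x‖) →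
    ‖ν k - ν h‖ < ε

end

section

variable {V : Type*} [NormedAddCommGroup V] [InnerProductSpace ℝ V] [FiniteDimensional ℝ V]
variable {h k : V → ℝ}

/-- The convex body with support function `h`. -/
def IsSub.body (hh : IsSub h) : ConvexBody V where
  carrier := {y | ∀ x, inner ℝ y x ≤ h x}
  convex' := by
    intro y hy z hz a b ha hb hab x
    rw [inner_add_left, inner_smul_left, inner_smul_left]
    have := mul_le_mul_of_nonneg_left (hy x) ha
    have := mul_le_mul_of_nonneg_left (hz x) hb
    have e : h x = a * h x + b * h x := by rw [← add_mul, hab, one_mul]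
    simp only [conj_trivial]; linarith
  isCompact' := by
    obtain ⟨L, hL, H⟩ := hh.exists_le_norm
    refine (isCompact_closedBall (0 : V) L).of_isClosed_subset ?_ ?_
    · simp only [Set.ofPred_forall]
      exact isClosed_iInter fun x => isClosed_le (by fun_prop) continuous_const
    · intro y hy
      rw [mem_closedBall_zero_iff]
      have h1 := hy y
      rw [real_inner_self_eq_norm_sq] at h1
      have h2 := (le_abs_self _).trans (H y)
      by_contra hc
      push Not at hc
      nlinarith [norm_nonneg y]
  nonempty' := let ⟨y, hy, _⟩ := hh.exists_support 0; ⟨y, hy⟩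

lemma IsSub.mem_body (hh : IsSub h) {y : V} :
    y ∈ (hh.body : Set V) ↔ ∀ x, inner ℝ y x ≤ h x := Iff.rfl

/-- The support function of a convex body. -/
def supp (K : ConvexBody V) (x : V) : ℝ := sSup ((fun y => inner ℝ y x) '' (K : Set V))

omit [FiniteDimensional ℝ V] in
lemma le_supp (K : ConvexBody V) {y : V} (hy : y ∈ (K : Set V)) (x : V) :
    inner ℝ y x ≤ supp K x :=
  le_csSup (K.isCompact.image (by fun_prop)).bddAbove ⟨y, hy, rfl⟩

omit [FiniteDimensional ℝ V] in
lemma supp_le (K : ConvexBody V) {x : V} {c : ℝ} (H : ∀ y ∈ (K : Set V), inner ℝ y x ≤ c) :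
    supp K x ≤ c :=
  csSup_le (K.nonempty.image _) (by rintro _ ⟨y, hy, rfl⟩; exact H y hy)

omit [FiniteDimensional ℝ V] in
lemma isSub_supp (K : ConvexBody V) : IsSub (supp K) := by
  refine ⟨fun x y => supp_le K fun z hz => ?_, fun t x ht => le_antisymm ?_ ?_⟩
  · rw [inner_add_right]; exact add_le_add (le_supp K hz x) (le_supp K hz y)
  · refine supp_le K fun z hz => ?_
    rw [inner_smul_right]; exact mul_le_mul_of_nonneg_left (le_supp K hz x) ht
  · obtain ⟨z, hz, hz2⟩ := (K.isCompact.image (f := fun y => inner ℝ y x) (by fun_prop)).sSup_mem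
      (K.nonempty.image _)
    change inner ℝ z x = supp K x at hz2
    rw [← hz2, ← inner_smul_right]
    exact le_supp K hz _

lemma body_supp (K : ConvexBody V) : (isSub_supp K).body = K := by
  refine ConvexBody.ext (Set.Subset.antisymm (fun y hy => ?_) fun y hy x => le_supp K hy x)
  by_contra hc
  obtain ⟨f, u, hf, hu⟩ := geometric_hahn_banach_closed_point K.convex K.isClosed hc
  set z := (InnerProductSpace.toDual ℝ V).symm f
  have hz : ∀ x, inner ℝ x z = f x := fun x => by
    rw [real_inner_comm]; simp [z]
  have h1 := hy z
  have h2 : supp K z ≤ u := supp_le K fun w hw => by rw [hz]; exact (hf w hw).le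
  rw [hz] at h1
  linarith

lemma body_sup (hh : IsSub h) (hk : IsSub k) (hm : IsSub (h ⊓ k)) :
    ((hh.sup hk).body : Set V) = (hh.body : Set V) ∪ hk.body := by
  refine Set.Subset.antisymm (fun y hy => ?_) ?_
  · by_contra hc
    simp only [Set.mem_union, IsSub.mem_body, not_or, not_forall, not_le] at hc
    obtain ⟨⟨u, hu⟩, ⟨w, hw⟩⟩ := hc
    rw [IsSub.mem_body] at hy
    have hu' : inner ℝ y u ≤ k u := by
      rcases le_max_iff.1 (hy u) with h | h
      · linarith
      · exact h
    have hw' : inner ℝ y w ≤ h w := by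
      rcases le_max_iff.1 (hy w) with h | h
      · exact h
      · linarith
    have hch := hh.continuous
    have hck := hk.continuous
    have hconn : IsPreconnected (segment ℝ u w) := (convex_segment u w).isPreconnected
    obtain ⟨p, hp, hp1, hp2⟩ := isPreconnected_closed_iff.1 hconn
      {x | inner ℝ y x ≤ k x} {x | inner ℝ y x ≤ h x}
      (isClosed_le (by fun_prop) hck) (isClosed_le (by fun_prop) hch)
      (fun x _ => (le_max_iff.1 (hy x)).symm) ⟨u, left_mem_segment ℝ u w, hu'⟩
      ⟨w, right_mem_segment ℝ u w, hw'⟩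
    obtain ⟨a, b, ha, hb, hab, rfl⟩ := hp
    have h1 := hm.add_le (a • u) (b • w)
    rw [hm.smul _ _ ha, hm.smul _ _ hb] at h1
    have h2 : (h ⊓ k) u < inner ℝ y u := (min_le_left _ _).trans_lt hu
    have h3 : (h ⊓ k) w < inner ℝ y w := (min_le_right _ _).trans_lt hw
    have h4 : inner ℝ y (a • u + b • w) ≤ (h ⊓ k) (a • u + b • w) := le_min hp2 hp1
    rw [inner_add_right, inner_smul_right, inner_smul_right] at h4
    rcases ha.eq_or_lt with rfl | ha
    · have : b = 1 := by linarith
      subst this; linarith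
    · nlinarith
  · rintro y (hy | hy) x
    · exact (hy x).trans (le_max_left _ _)
    · exact (hy x).trans (le_max_right _ _)

lemma body_inf (hh : IsSub h) (hk : IsSub k) (hm : IsSub (h ⊓ k)) :
    (hm.body : Set V) = (hh.body : Set V) ∩ hk.body := by
  ext y
  simp only [Set.mem_inter_iff, IsSub.mem_body, Pi.inf_apply, le_inf_iff, forall_and]

lemma body_add_lin (hh : IsSub h) (y : V) :
    ((hh.add_lin y).body : Set V) = (fun z => y + z) '' (hh.body : Set V) := by
  ext z
  simp only [Set.image_add_left, Set.mem_preimage, IsSub.mem_body, Pi.add_apply, lin_apply,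
    inner_add_left, inner_neg_left]
  refine forall_congr' fun x => ?_
  constructor <;> intro <;> linarith

lemma body_comp (hh : IsSub h) (s : V →ₗ[ℝ] V) (hs : ∀ x, s (s x) = x)
    (hs' : ∀ x y, inner ℝ (s x) y = inner ℝ x (s y)) :
    ((hh.comp s).body : Set V) = s '' (hh.body : Set V) := by
  ext z
  constructor
  · intro hz
    refine ⟨s z, fun x => ?_, hs z⟩
    have := hz (s x)
    rw [← hs'] at this
    simpa [hs] using this
  · rintro ⟨y, hy, rfl⟩ x
    rw [hs']
    exact hy (s x)

lemma exists_near (hh : IsSub h) {δ : ℝ} (hδ : 0 ≤ δ)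
    (hk : ∀ x, k x ≤ h x + δ * ‖x‖) {y : V}
    (hy : ∀ x, inner ℝ y x ≤ k x) : ∃ z ∈ (hh.body : Set V), dist y z ≤ δ := by
  obtain ⟨z, hz, hzy⟩ := hh.body.isCompact.exists_infDist_eq_dist hh.body.nonempty y
  have hz' := (norm_eq_iInf_iff_real_inner_le_zero hh.body.convex (u := y) hz).1 (by
    rw [← dist_eq_norm, ← hzy, Metric.infDist_eq_iInf]
    simp_rw [dist_eq_norm])
  refine ⟨z, hz, ?_⟩
  rw [dist_eq_norm]
  have h1 : h (y - z) ≤ inner ℝ z (y - z) := by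
    obtain ⟨w, hw, hw2⟩ := hh.exists_support (y - z)
    have := hz' w hw
    rw [inner_sub_right, real_inner_comm, real_inner_comm z] at this
    linarith
  have h2 := (hy (y - z)).trans (hk _)
  have h3 : inner ℝ y (y - z) - inner ℝ z (y - z) = ‖y - z‖ ^ 2 := by
    rw [← inner_sub_left, real_inner_self_eq_norm_sq]
  by_contra hc
  push Not at hc
  nlinarith

end

section

variable {V : Type*} [NormedAddCommGroup V] [InnerProductSpace ℝ V]

/-- The complex reflection `-1` on the complex line of the unit vector `u`, where the complex
structure is `J`. -/
def crefl (J : V →ₗ[ℝ] V) (u : V) : V →ₗ[ℝ] V :=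
  LinearMap.id - (2 : ℝ) • (innerₛₗ ℝ u).smulRight u - (2 : ℝ) • (innerₛₗ ℝ (J u)).smulRight (J u)

lemma crefl_apply (J : V →ₗ[ℝ] V) (u x : V) :
    crefl J u x = x - (2 * inner ℝ u x) • u - (2 * inner ℝ (J u) x) • J u := by
  simp [crefl, smul_smul]

lemma crefl_symm (J : V →ₗ[ℝ] V) (u x y : V) :
    inner ℝ (crefl J u x) y = inner ℝ x (crefl J u y) := by
  simp only [crefl_apply, inner_sub_left, inner_sub_right, inner_smul_left, inner_smul_right,
    conj_trivial, real_inner_comm u x, real_inner_comm (J u) x]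
  ring

end

section

variable {V : Type*} [NormedAddCommGroup V] [InnerProductSpace ℝ V]
variable {ν : (V → ℝ) → ℂ} {h k : V → ℝ}

/-- The positive part of a linear form: the support function of the segment `[0, w]`. -/
def seg (w : V) : V → ℝ := lin w ⊔ 0

@[simp] lemma seg_apply (w x : V) : seg w x = max (inner ℝ w x) 0 := rfl

lemma isSub_seg (w : V) : IsSub (seg w) := IsSub.pos_lin w

lemma seg_neg (w : V) : seg (-w) = seg w + lin (-w) := by
  ext x
  simp only [seg_apply, inner_neg_left, Pi.add_apply, lin_apply]
  rcases le_total (inner ℝ w x) 0 with h | h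
  · rw [max_eq_left (by linarith), max_eq_right h]; ring
  · rw [max_eq_right (by linarith), max_eq_left h]; ring

@[simp] lemma seg_zero : seg (0 : V) = 0 := by ext x; simp

/-- The difference operator in the direction of the segment `[0, w]`. -/
def D (w : V) (ν : (V → ℝ) → ℂ) (h : V → ℝ) : ℂ := ν (h + seg w) - ν h

lemma D_zero (h : V → ℝ) : D 0 ν h = 0 := by simp [D]

lemma D_comm (v w : V) (h : V → ℝ) : D v (D w ν) h = D w (D v ν) h := by
  simp only [D, add_right_comm h]; ring

lemma sup_add_right {V : Type*} (f g k : V → ℝ) : (f ⊔ g) + k = (f + k) ⊔ (g + k) := by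
  ext x; exact (max_add_add_right _ _ _).symm

lemma inf_add_right {V : Type*} (f g k : V → ℝ) : (f ⊓ g) + k = (f + k) ⊓ (g + k) := by
  ext x; exact (min_add_add_right _ _ _).symm

namespace IsVal

lemma trans_sub (hν : IsVal ν) (hh : IsSub h) (y : V) : ν (h - lin y) = ν h := by
  rw [sub_eq_add_neg, ← lin_neg]; exact hν.trans h hh _

lemma val_of (hν : IsVal ν) {f g M m : V → ℝ} (hf : IsSub f) (hg : IsSub g)
    (hm : IsSub m) (e1 : ∀ x, max (f x) (g x) = M x) (e2 : ∀ x, min (f x) (g x) = m x) :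
    ν M + ν m = ν f + ν g := by
  have e1' : f ⊔ g = M := funext e1
  have e2' : f ⊓ g = m := funext e2
  have := hν.val f g hf hg (by rwa [e2'])
  rwa [e1', e2'] at this

lemma D (hν : IsVal ν) (w : V) : IsVal (D w ν) where
  val f g hf hg hm := by
    simp only [Sublin.D, sup_add_right, inf_add_right]
    have h1 := hν.val _ _ (hf.add (isSub_seg w)) (hg.add (isSub_seg w))
      (by rw [← inf_add_right]; exact hm.add (isSub_seg w))
    have h2 := hν.val f g hf hg hm
    linear_combination h1 - h2
  trans f hf y := by
    rw [Sublin.D, Sublin.D, add_right_comm, hν.trans f hf, hν.trans _ (hf.add (isSub_seg w))]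
  cont f hf ε hε := by
    obtain ⟨δ, hδ, H⟩ := hν.cont f hf (ε / 2) (by positivity)
    obtain ⟨δ', hδ', H'⟩ := hν.cont _ (hf.add (isSub_seg w)) (ε / 2) (by positivity)
    refine ⟨min δ δ', by positivity, fun k hk hkf => ?_⟩
    have h1 := H k hk fun x => (hkf x).trans (by gcongr; exact min_le_left _ _)
    have h2 := H' _ (hk.add (isSub_seg w)) fun x => by
      simpa using (hkf x).trans (by gcongr; exact min_le_right _ _)
    simp only [Sublin.D]
    have e : ν (k + seg w) - ν k - (ν (f + seg w) - ν f)
      = (ν (k + seg w) - ν (f + seg w)) - (ν k - ν f) := by ring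
    rw [e]
    exact (norm_sub_le _ _).trans_lt (by linarith)

lemma D_neg (hν : IsVal ν) (hh : IsSub h) (w : V) : Sublin.D (-w) ν h = Sublin.D w ν h := by
  simp only [Sublin.D, seg_neg, ← add_assoc, hν.trans _ (hh.add (isSub_seg w))]

/-- The four-term relation behind the locality of `D`. -/
lemma exchange (hν : IsVal ν) (hh : IsSub h) (hk : IsSub k) {w : V} {C : ℝ} (hC : 0 ≤ C)
    (hhk : ∀ x, |h x - k x| ≤ C * |inner ℝ w x|) {T s T' : ℝ} (hs : C ≤ s)
    (hT : C ≤ T - T' + s) (hT' : C ≤ T' - s) :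
    ν ((h + (T + s) • lin w) ⊔ k) + ν ((k + (T' - s) • lin w) ⊔ h) =
      ν (h + T • seg w) + ν (k + T' • seg w) := by
  have hTnn : 0 ≤ T := by linarith
  have hTnn' : 0 ≤ T' := by linarith
  have hB : IsSub (k + T' • seg w - lin (s • w)) := by
    rw [sub_eq_add_neg, ← lin_neg]
    exact (hk.add ((isSub_seg w).const_smul hTnn')).add_lin _
  have hM : IsSub ((h + (T + s) • lin w) ⊔ k) := by
    rw [← lin_smul]; exact (hh.add_lin _).sup hk
  have hm : IsSub ((k + (T' - s) • lin w) ⊔ h) := by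
    rw [← lin_smul]; exact (hk.add_lin _).sup hh
  have hA := hh.add ((isSub_seg w).const_smul hTnn)
  rw [← hν.trans_sub hM (s • w), ← hν.trans_sub (hk.add ((isSub_seg w).const_smul hTnn')) (s • w)]
  refine hν.val_of hA hB hm (fun x => ?_) fun x => ?_
  all_goals
    have h1 := abs_le.1 (hhk x)
    simp only [Pi.add_apply, Pi.sub_apply, Pi.smul_apply, smul_eq_mul, Pi.sup_apply, seg_apply,
      lin_apply, inner_smul_left, conj_trivial]
    rcases le_total 0 (inner ℝ w x) with h0 | h0
    · rw [abs_of_nonneg h0] at h1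
      rw [max_eq_left h0]
      first
        | (rw [max_eq_left (by nlinarith), max_eq_left (by nlinarith)]; ring)
        | (rw [min_eq_right (by nlinarith), max_eq_left (by nlinarith)]; ring)
    · rw [abs_of_nonpos h0] at h1
      rw [max_eq_right h0]
      first
        | (rw [max_eq_right (by nlinarith), max_eq_right (by nlinarith)]; ring)
        | (rw [min_eq_left (by nlinarith), max_eq_right (by nlinarith)]; ring)

lemma seg_add (hν : IsVal ν) (hh : IsSub h) (w : V) {T s : ℝ} (hT : 0 ≤ T) (hs : 0 ≤ s) :
    ν (h + (T + s) • seg w) + ν h = ν (h + T • seg w) + ν (h + s • seg w) := by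
  have := hν.exchange hh hh (w := w) (C := 0) le_rfl (by simp) (T := T) (s := s) (T' := s) hs
    (by linarith) (by linarith)
  rw [← this, sub_self, zero_smul, add_zero, sup_idem]
  congr 2
  ext x
  simp only [Pi.add_apply, Pi.smul_apply, smul_eq_mul, seg_apply, Pi.sup_apply, lin_apply]
  rw [mul_max_of_nonneg _ _ (by linarith), mul_zero, ← max_add_add_left, add_zero]

lemma D_eq_seg (hν : IsVal ν) (hh : IsSub h) (w : V) {T : ℝ} (hT : 0 ≤ T) {s : ℝ} (hs : 0 ≤ s) :
    ν (h + (T + s) • seg w) - ν (h + T • seg w) = ν (h + s • seg w) - ν h := by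
  linear_combination hν.seg_add hh w hT hs

/-- `D w ν h` only depends on the restriction of `h` to the orthogonal complement of `w`. -/
theorem D_congr [FiniteDimensional ℝ V] (hν : IsVal ν) (hh : IsSub h) (hk : IsSub k) {w : V}
    (hhk : ∀ x, inner ℝ w x = 0 → h x = k x) : Sublin.D w ν h = Sublin.D w ν k := by
  by_cases hw : w = 0
  · subst hw; rw [show h = k from funext fun x => hhk x (by simp)]
  obtain ⟨L, hL, HL⟩ := hh.lipschitz
  obtain ⟨M, hM, HM⟩ := hk.lipschitz
  have hw' : 0 < ‖w‖ := norm_pos_iff.2 hw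
  set C := (L + M) / ‖w‖
  have hC : 0 ≤ C := by positivity
  have key : ∀ x, |h x - k x| ≤ C * |inner ℝ w x| := by
    intro x
    set p := x - (inner ℝ w x / ‖w‖ ^ 2) • w with hp
    have hp0 : inner ℝ w p = 0 := by
      rw [hp, inner_sub_right, inner_smul_right, real_inner_self_eq_norm_sq]; field_simp; ring
    have h1 := HL x p
    have h2 := HM x p
    have h3 : ‖x - p‖ = |inner ℝ w x| / ‖w‖ := by
      rw [hp, sub_sub_cancel, norm_smul, Real.norm_eq_abs, abs_div, abs_of_pos (pow_pos hw' 2)]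
      field_simp
    have h4 := hhk p hp0
    calc |h x - k x| = |(h x - h p) - (k x - k p)| := by rw [h4]; congr 1; ring
      _ ≤ |h x - h p| + |k x - k p| := abs_sub _ _
      _ ≤ L * ‖x - p‖ + M * ‖x - p‖ := add_le_add h1 h2
      _ = C * |inner ℝ w x| := by rw [h3]; simp only [C]; field_simp
  have e1 := hν.exchange hh hk hC key (T := 2 * C + 1) (s := C) (T' := 2 * C) le_rfl (by linarith)
    (by linarith)
  have e2 := hν.exchange hh hk hC key (T := 2 * C) (s := C + 1) (T' := 2 * C + 1) (by linarith)
    (by linarith) (by linarith)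
  rw [show 2 * C + 1 + C = 2 * C + (C + 1) by ring] at e1
  rw [show 2 * C + 1 - (C + 1) = 2 * C - C by ring] at e2
  have e3 := hν.D_eq_seg hh w (T := 2 * C) (by positivity) zero_le_one
  have e4 := hν.D_eq_seg hk w (T := 2 * C) (by positivity) zero_le_one
  simp only [one_smul] at e3 e4
  simp only [Sublin.D]
  linear_combination e2 - e1 - e3 + e4

lemma D_smul_nonneg [FiniteDimensional ℝ V] (hν : IsVal ν) (hh : IsSub h) (w : V) {t : ℝ}
    (ht : 0 ≤ t) : Sublin.D (t • w) ν h = t * Sublin.D w ν h := by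
  have hseg : ∀ t : ℝ, 0 ≤ t → seg (t • w) = t • seg w := fun t ht => by
    ext x
    simp [inner_smul_left, mul_max_of_nonneg _ _ ht]
  set ψ : ℝ → ℂ := fun t => ν (h + t • seg w) - ν h
  have hadd : ∀ s t, 0 ≤ s → 0 ≤ t → ψ (s + t) = ψ s + ψ t := fun s t hs ht => by
    simp only [ψ]; linear_combination hν.seg_add hh w hs ht
  have h0 : ψ 0 = 0 := by simp [ψ]
  have hcont : ∀ ε > 0, ∃ δ > 0, ∀ t, 0 ≤ t → t < δ → ‖ψ t‖ < ε := fun ε hε => by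
    obtain ⟨δ, hδ, H⟩ := hν.cont h hh ε hε
    refine ⟨δ / (‖w‖ + 1), by positivity, fun t ht htδ => H _
      (hh.add ((isSub_seg w).const_smul ht)) fun x => ?_⟩
    simp only [Pi.add_apply, Pi.smul_apply, smul_eq_mul, seg_apply, add_sub_cancel_left]
    rw [abs_of_nonneg (mul_nonneg ht (le_max_right _ _))]
    rw [lt_div_iff₀ (by positivity)] at htδ
    have : max (inner ℝ w x) 0 ≤ ‖w‖ * ‖x‖ := max_le (real_inner_le_norm _ _) (by positivity)
    nlinarith [norm_nonneg x, norm_nonneg w, mul_nonneg ht (norm_nonneg x)]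
  let G : ℝ →+ ℂ :=
    { toFun := fun t => ψ (max t 0) - ψ (max (-t) 0)
      map_zero' := by simp
      map_add' := fun s t => by
        have key : ψ (max (s + t) 0) + (ψ (max (-s) 0) + ψ (max (-t) 0)) =
            ψ (max (-(s + t)) 0) + (ψ (max s 0) + ψ (max t 0)) := by
          rw [← hadd _ _ (by positivity) (by positivity), ← hadd _ _ (by positivity)
            (by positivity), ← hadd _ _ (by positivity) (by positivity), ← hadd _ _ (by positivity)
            (by positivity)]
          congr 1
          have := max_zero_sub_max_neg_zero_eq_self (s + t)
          have := max_zero_sub_max_neg_zero_eq_self s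
          have := max_zero_sub_max_neg_zero_eq_self t
          linarith
        linear_combination key }
  have hG : Continuous G := by
    refine continuous_of_continuousAt_zero G (Metric.continuousAt_iff.2 fun ε hε => ?_)
    obtain ⟨δ, hδ, H⟩ := hcont ε hε
    refine ⟨δ, hδ, fun {t} htd => ?_⟩
    rw [dist_zero_right, Real.norm_eq_abs, abs_lt] at htd
    rw [map_zero, dist_zero_right]
    change ‖ψ (max t 0) - ψ (max (-t) 0)‖ < ε
    rcases le_total 0 t with h1 | h1
    · rw [max_eq_left h1, max_eq_right (by linarith : -t ≤ 0), h0, sub_zero]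
      exact H t h1 htd.2
    · rw [max_eq_right h1, max_eq_left (by linarith : 0 ≤ -t), h0, zero_sub, norm_neg]
      exact H _ (by linarith) (by linarith)
  have hlin := map_real_smul G hG t 1
  have hGt : G t = ψ t := by
    change ψ (max t 0) - ψ (max (-t) 0) = ψ t
    rw [max_eq_left ht, max_eq_right (by linarith : -t ≤ 0), h0, sub_zero]
  have hG1 : G 1 = ψ 1 := by
    change ψ (max 1 0) - ψ (max (-1) 0) = ψ 1
    rw [max_eq_left zero_le_one, max_eq_right (by norm_num : (-1 : ℝ) ≤ 0), h0, sub_zero]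
  rw [smul_eq_mul, mul_one, hGt, hG1] at hlin
  simp only [Sublin.D, hseg t ht]
  simpa [ψ] using hlin

lemma D_smul [FiniteDimensional ℝ V] (hν : IsVal ν) (hh : IsSub h) (w : V) (t : ℝ) :
    Sublin.D (t • w) ν h = |t| * Sublin.D w ν h := by
  rcases le_total 0 t with ht | ht
  · rw [hν.D_smul_nonneg hh w ht, abs_of_nonneg ht]
  · rw [← neg_smul_neg, hν.D_smul_nonneg hh (-w) (by linarith), hν.D_neg hh, abs_of_nonpos ht]

/-- Shearing does not change iterated differences. -/
lemma D_shear [FiniteDimensional ℝ V] (hν : IsVal ν) (hh : IsSub h) (v w : V) (t : ℝ) :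
    Sublin.D v (Sublin.D (w + t • v) ν) h = Sublin.D v (Sublin.D w ν) h := by
  have h1 : Sublin.D v ν (h + seg (w + t • v)) = Sublin.D v ν (h + seg w) :=
    hν.D_congr (hh.add (isSub_seg _)) (hh.add (isSub_seg _)) fun x hx => by
      simp [inner_add_left, inner_smul_left, hx]
  rw [D_comm, D_comm v w]
  simp only [Sublin.D] at h1 ⊢
  linear_combination h1

end IsVal

end

section

variable {V : Type*} [NormedAddCommGroup V] [InnerProductSpace ℝ V]
variable {ν : (V → ℝ) → ℂ} {h k : V → ℝ}

/-- Iterated difference operators. -/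
def Ds (l : List V) (ν : (V → ℝ) → ℂ) : (V → ℝ) → ℂ := l.foldr D ν

@[simp] lemma Ds_nil (ν : (V → ℝ) → ℂ) : Ds [] ν = ν := rfl

@[simp] lemma Ds_cons (w : V) (l : List V) (ν : (V → ℝ) → ℂ) : Ds (w :: l) ν = D w (Ds l ν) := rfl

lemma Ds_append (l m : List V) (ν : (V → ℝ) → ℂ) : Ds (l ++ m) ν = Ds l (Ds m ν) := by
  simp [Ds]

lemma Ds_perm {l m : List V} (hlm : l.Perm m) (ν : (V → ℝ) → ℂ) : Ds l ν = Ds m ν := by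
  induction hlm with
  | nil => rfl
  | cons x _ ih => simp [ih]
  | swap x y l => funext h; exact D_comm _ _ _
  | trans _ _ h1 h2 => exact h1.trans h2

lemma exists_cons_perm {α : Type*} {a : α} {l : List α} (ha : a ∈ l) :
    ∃ m : List α, l.Perm (a :: m) := by
  classical exact ⟨l.erase a, List.perm_cons_erase ha⟩

lemma D_congr_fun {f g : (V → ℝ) → ℂ} (hfg : ∀ h, IsSub h → f h = g h) (w : V) (hh : IsSub h) :
    D w f h = D w g h := by
  simp only [D, hfg h hh, hfg _ (hh.add (isSub_seg w))]

lemma D_smul_fun {f g : (V → ℝ) → ℂ} {c : ℂ} (hfg : ∀ h, IsSub h → f h = c * g h) (w : V)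
    (hh : IsSub h) : D w f h = c * D w g h := by
  simp only [D, hfg h hh, hfg _ (hh.add (isSub_seg w))]; ring

lemma Ds_congr_fun {f g : (V → ℝ) → ℂ} (hfg : ∀ h, IsSub h → f h = g h) (l : List V) :
    ∀ h, IsSub h → Ds l f h = Ds l g h := by
  induction l with
  | nil => exact hfg
  | cons w l ih => exact fun h hh => D_congr_fun ih w hh

lemma Ds_smul_fun {f g : (V → ℝ) → ℂ} {c : ℂ} (hfg : ∀ h, IsSub h → f h = c * g h) (l : List V) :
    ∀ h, IsSub h → Ds l f h = c * Ds l g h := by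
  induction l with
  | nil => exact hfg
  | cons w l ih => exact fun h hh => D_smul_fun ih w hh

lemma Ds_zero_fun {f : (V → ℝ) → ℂ} (hf : ∀ h, IsSub h → f h = 0) (l : List V) (hh : IsSub h) :
    Ds l f h = 0 := by
  have := Ds_smul_fun (f := f) (g := f) (c := 0) (fun h hh => by simp [hf h hh]) l h hh
  simpa using this

/-- Differences of a functional that is invariant up to a sign under an isometry. -/
lemma D_comp {f : (V → ℝ) → ℂ} {s : V →ₗ[ℝ] V} (hs : ∀ x y, inner ℝ (s x) (s y) = inner ℝ x y)
    {g : (V → ℝ) → ℂ} {c : ℂ} (hf : ∀ h, IsSub h → f (h ∘ s) = c * g h) (w : V) (hh : IsSub h) :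
    D w f (h ∘ s) = c * D (s w) g h := by
  have e : h ∘ s + seg w = (h + seg (s w)) ∘ s := by
    ext x; simp [hs]
  simp only [D, e, hf h hh, hf _ (hh.add (isSub_seg _))]; ring

lemma Ds_comp {s : V →ₗ[ℝ] V} (hs : ∀ x y, inner ℝ (s x) (s y) = inner ℝ x y) {c : ℂ}
    (hν : ∀ h, IsSub h → ν (h ∘ s) = c * ν h) (l : List V) :
    ∀ h, IsSub h → Ds l ν (h ∘ s) = c * Ds (l.map s) ν h := by
  induction l with
  | nil => exact hν
  | cons w l ih => exact fun h hh => D_comp hs ih w hh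

/-- The span of the members of a list. -/
def lspan (l : List V) : Submodule ℝ V := Submodule.span ℝ {x | x ∈ l}

lemma mem_lspan {l : List V} {x : V} (hx : x ∈ l) : x ∈ lspan l := Submodule.subset_span hx

@[simp] lemma lspan_nil : lspan ([] : List V) = ⊥ := by simp [lspan]

lemma lspan_cons (a : V) (l : List V) : lspan (a :: l) =
    Submodule.span ℝ (insert a {x | x ∈ l}) := by
  simp only [lspan, List.mem_cons]; rfl

lemma mem_lspan_cons {a x : V} {l : List V} :
    x ∈ lspan (a :: l) ↔ ∃ (t : ℝ), ∃ z ∈ lspan l, x = t • a + z := by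
  rw [lspan_cons, Submodule.mem_span_insert]; rfl

lemma lspan_le {l : List V} {W : Submodule ℝ V} : lspan l ≤ W ↔ ∀ x ∈ l, x ∈ W :=
  Submodule.span_le

namespace IsVal

lemma Ds (hν : IsVal ν) : ∀ l : List V, IsVal (Ds l ν)
  | [] => hν
  | w :: l => (hν.Ds l).D w

variable [FiniteDimensional ℝ V]

lemma Ds_shear (hν : IsVal ν) (v : V) {l m : List V}
    (hlm : List.Forall₂ (fun w w' => ∃ t : ℝ, w' = w + t • v) l m) :
    ∀ h, IsSub h → Sublin.Ds (v :: m) ν h = Sublin.Ds (v :: l) ν h := by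
  induction hlm with
  | nil => intros; rfl
  | @cons w w' l m hw _ ih =>
    obtain ⟨t, rfl⟩ := hw
    intro h hh
    rw [Ds_perm (List.Perm.swap _ _ _), Ds_cons, D_congr_fun ih _ hh]
    rw [Ds_cons, D_comm, (hν.Ds l).D_shear hh]
    rfl

lemma D_add_mem (hν : IsVal ν) {l : List V} {y : V} (hy : y ∈ lspan l) (w : V) (hh : IsSub h) :
    Sublin.Ds ((w + y) :: l) ν h = Sublin.Ds (w :: l) ν h := by
  have key : ∀ (t : ℝ) (w : V), Sublin.Ds ((w + t • y) :: l) ν h = Sublin.Ds (w :: l) ν h := by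
    induction hy using Submodule.span_induction with
    | mem v hv =>
      intro t w
      obtain ⟨m, hm⟩ := exists_cons_perm hv
      rw [Ds_perm ((hm.cons _).trans (List.Perm.swap _ _ _)),
        Ds_perm ((hm.cons _).trans (List.Perm.swap _ _ _))]
      exact (hν.Ds m).D_shear hh v w t
    | zero => simp
    | add x y _ _ hx hy => intro t w; rw [smul_add, ← add_assoc, hy, hx]
    | smul a x _ hx => intro t w; rw [smul_smul, hx]
  simpa using key 1 w

/-- Subtract multiples of a suitable member of `l` to bring all others into `lspan m`. -/
lemma exists_reduce {a : V} {l m : List V} (hl : ∀ x ∈ l, x ∈ lspan (a :: m)) :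
    (∀ x ∈ l, x ∈ lspan m) ∨ ∃ (t : ℝ) (y : V) (r : List V), t ≠ 0 ∧ y ∈ lspan m ∧
      (∀ x ∈ r, x ∈ lspan m) ∧ r.length + 1 = l.length ∧ ∀ ν, IsVal ν → ∀ h, IsSub h →
        Sublin.Ds l ν h = Sublin.Ds ((t • a + y) :: r) ν h := by
  by_cases hc : ∀ x ∈ l, x ∈ lspan m
  · exact Or.inl hc
  right
  push Not at hc
  obtain ⟨x, hx, hxm⟩ := hc
  obtain ⟨r, hr⟩ := exists_cons_perm hx
  obtain ⟨t, y, hy, rfl⟩ := mem_lspan_cons.1 (hl x hx)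
  have ht : t ≠ 0 := by rintro rfl; exact hxm (by simpa using hy)
  have hr' : ∀ z ∈ r, ∃ z' ∈ lspan m, ∃ c : ℝ, z' = z + c • (t • a + y) := by
    intro z hz
    obtain ⟨s, w, hw, rfl⟩ := mem_lspan_cons.1 (hl z (hr.symm.subset (List.mem_cons_of_mem _ hz)))
    refine ⟨w - (s / t) • y, Submodule.sub_mem _ hw (Submodule.smul_mem _ _ hy), -(s / t), ?_⟩
    rw [smul_add, smul_smul]
    field_simp
    module
  choose! f hf1 hf2 using hr'
  refine ⟨t, y, r.map f, ht, hy, ?_, by simp [hr.length_eq], fun ν hν h hh => ?_⟩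
  · intro z hz
    obtain ⟨w, hw, rfl⟩ := List.mem_map.1 hz
    exact hf1 w hw
  · rw [Ds_perm hr]
    refine (hν.Ds_shear _ ?_ h hh).symm
    rw [List.forall₂_map_right_iff, List.forall₂_same]
    exact hf2

lemma Ds_eq_zero_of_length (m : List V) : ∀ l : List V, (∀ x ∈ l, x ∈ lspan m) →
    m.length < l.length → ∀ ν, IsVal ν → ∀ h, IsSub h → Sublin.Ds l ν h = 0 := by
  induction m with
  | nil =>
    intro l hl hlen ν hν h hh
    cases l with
    | nil => simp at hlen
    | cons x l =>
      have : x = 0 := by simpa using hl x (by simp)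
      rw [this]; exact D_zero h
  | cons a m ih =>
    intro l hl hlen ν hν h hh
    rw [List.length_cons] at hlen
    rcases exists_reduce hl with hc | ⟨t, y, r, -, hy, hr, hlr, H⟩
    · exact ih l hc (by lia) ν hν h hh
    · rw [H ν hν h hh]
      exact Ds_zero_fun (l := [_]) (fun h hh => ih r hr (by lia) ν hν h hh) hh

/-- Lists of the same length with the same span give proportional iterated differences. -/
lemma exists_Ds_eq (m : List V) : ∀ l : List V, (∀ x ∈ l, x ∈ lspan m) →
    l.length = m.length → ∃ c : ℝ, 0 ≤ c ∧ ∀ ν, IsVal ν → ∀ h, IsSub h →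
      Sublin.Ds l ν h = c * Sublin.Ds m ν h := by
  induction m with
  | nil =>
    intro l _ hlen
    rw [List.length_eq_zero_iff.1 hlen]
    exact ⟨1, zero_le_one, by simp⟩
  | cons a m ih =>
    intro l hl hlen
    rw [List.length_cons] at hlen
    rcases exists_reduce hl with hc | ⟨t, y, r, -, hy, hr, hlr, H⟩
    · exact ⟨0, le_rfl, fun ν hν h hh => by
        rw [Ds_eq_zero_of_length m l hc (by lia) ν hν h hh, Complex.ofReal_zero, zero_mul]⟩
    · obtain ⟨c, hc0, hc⟩ := ih r hr (by lia)
      refine ⟨c * |t|, by positivity, fun ν hν h hh => ?_⟩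
      rw [H ν hν h hh, Ds_cons, D_smul_fun (hc ν hν) _ hh, ← Ds_cons, hν.D_add_mem hy _ hh, Ds_cons,
        (hν.Ds m).D_smul hh]
      simp [mul_assoc]

lemma Ds_eq_zero_of_le (hν : IsVal ν) {l m : List V} (hlm : lspan l ≤ lspan m)
    (hlen : l.length = m.length) (hh : IsSub h) (hm : Sublin.Ds m ν h = 0) :
    Sublin.Ds l ν h = 0 := by
  obtain ⟨c, -, hc⟩ := exists_Ds_eq m l (fun x hx => hlm (mem_lspan hx)) hlen
  rw [hc ν hν h hh, hm, mul_zero]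

/-- A list of a basis of a subspace. -/
lemma exists_lspan_eq (W : Submodule ℝ V) :
    ∃ l : List V, lspan l = W ∧ l.length = Module.finrank ℝ W := by
  set b := Module.finBasis ℝ W
  refine ⟨List.ofFn fun i => (b i : V), ?_, by simp⟩
  have : {x | x ∈ List.ofFn fun i => (b i : V)} = W.subtype '' Set.range b := by
    ext x
    simp only [List.mem_ofFn, Set.mem_ofPred_eq, Set.mem_image, Set.mem_range, exists_exists_eq_and]
    rfl
  rw [lspan, this, Submodule.span_image, b.span_eq, Submodule.map_top, Submodule.range_subtype]

omit [FiniteDimensional ℝ V] in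
lemma finrank_lspan_le (l : List V) : Module.finrank ℝ (lspan l) ≤ l.length := by
  classical
  have : {x | x ∈ l} = (l.toFinset : Set V) := by ext; simp
  rw [lspan, this]
  exact (finrank_span_finset_le_card _).trans (List.toFinset_card_le l)

lemma Ds_eq_zero_of_finrank (hν : IsVal ν) {l : List V} {W : Submodule ℝ V}
    (hl : lspan l ≤ W) (hW : Module.finrank ℝ W < l.length) (hh : IsSub h) :
    Sublin.Ds l ν h = 0 := by
  obtain ⟨m, rfl, hm⟩ := exists_lspan_eq W
  exact Ds_eq_zero_of_length m l (fun x hx => hl (mem_lspan hx)) (hm ▸ hW) ν hν h hh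

/-- `Ds l ν h` only depends on the restriction of `h` to the orthogonal complement of `l`. -/
theorem Ds_congr (hν : IsVal ν) (l : List V) : ∀ {h k : V → ℝ}, IsSub h → IsSub k →
    (∀ x, (∀ w ∈ l, inner ℝ w x = 0) → h x = k x) → Sublin.Ds l ν h = Sublin.Ds l ν k := by
  induction l with
  | nil =>
    intro h k hh hk hhk
    rw [show h = k from funext fun x => hhk x (by simp)]
  | cons w l ih =>
    intro h k hh hk hhk
    set P : V →ₗ[ℝ] V := ((lspan l)ᗮ.starProjection : V →L[ℝ] V).toLinearMap
    have hPmem : ∀ x, P x ∈ (lspan l)ᗮ := fun x => Submodule.starProjection_apply_mem _ x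
    have hPid : ∀ x ∈ (lspan l)ᗮ, P x = x := fun x hx =>
      Submodule.starProjection_eq_self_iff.2 hx
    have hperp : ∀ x, (∀ w ∈ l, inner ℝ w x = 0) ↔ x ∈ (lspan l)ᗮ := fun x => by
      constructor
      · intro H
        rw [Submodule.mem_orthogonal]
        intro u hu
        induction hu using Submodule.span_induction with
        | mem v hv => exact H v hv
        | zero => simp
        | add x y _ _ hx hy => rw [inner_add_left, hx, hy, add_zero]
        | smul a x _ hx => rw [inner_smul_left, hx, mul_zero]
      · exact fun H w hw => (Submodule.mem_orthogonal _ _).1 H w (mem_lspan hw)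
    have step1 : ∀ {f : V → ℝ}, IsSub f →
        Sublin.Ds (w :: l) ν f = Sublin.Ds (w :: l) ν (f ∘ P) := by
      intro f hf
      simp only [Ds_cons, Sublin.D]
      rw [ih hf (hf.comp P) fun x hx => by simp [hPid x ((hperp x).1 hx)],
        ih (hf.add (isSub_seg w)) ((hf.comp P).add (isSub_seg w)) fun x hx => by
          simp [hPid x ((hperp x).1 hx)]]
    have hw : ∃ y ∈ lspan l, P w = w + y := by
      refine ⟨-((lspan l).starProjection w), neg_mem (Submodule.starProjection_apply_mem _ _), ?_⟩
      change ((lspan l)ᗮ.starProjection : V →L[ℝ] V) w = _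
      rw [← sub_eq_add_neg, eq_sub_iff_add_eq, add_comm]
      exact Submodule.starProjection_add_starProjection_orthogonal w
    obtain ⟨y, hy, hPw⟩ := hw
    rw [step1 hh, step1 hk, ← hν.D_add_mem hy w (hh.comp P), ← hν.D_add_mem hy w (hk.comp P), ← hPw]
    refine (hν.Ds l).D_congr (hh.comp P) (hk.comp P) fun x hx => ?_
    refine hhk (P x) fun u hu => ?_
    have hl : ∀ v ∈ lspan l, inner ℝ v (P x) = 0 := (Submodule.mem_orthogonal _ _).1 (hPmem x)
    rcases List.mem_cons.1 hu with rfl | hu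
    · have e1 : inner ℝ (P u) (P x) = inner ℝ (P u) x := by
        have : x - P x ∈ (lspan l)ᗮᗮ := Submodule.sub_starProjection_mem_orthogonal x
        have := (Submodule.mem_orthogonal _ _).1 this (P u) (hPmem u)
        rw [inner_sub_right] at this; linarith
      have e2 := hl y hy
      rw [hPw, inner_add_left, e2, add_zero, ← hPw] at e1
      rw [e1, hx]
    · exact hl u (mem_lspan hu)

end IsVal

end

section

variable {V : Type*} [NormedAddCommGroup V] [InnerProductSpace ℝ V]
variable {ν : (V → ℝ) → ℂ} {h k : V → ℝ}

/-- Functionals that change sign under the reflection in the origin. -/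
def IsOdd (ν : (V → ℝ) → ℂ) : Prop := ∀ h, IsSub h → ν (fun x => h (-x)) = -ν h

/-- The support function of a triangle with vertices `0`, `x`, `x + y`. -/
def tri (x y : V) : V → ℝ := 0 ⊔ lin x ⊔ lin (x + y)

/-- The support function of a tetrahedron with vertices `0`, `x`, `x + y`, `x + y + z`. -/
def tet (x y z : V) : V → ℝ := 0 ⊔ lin x ⊔ lin (x + y) ⊔ lin (x + y + z)

lemma isSub_tri (x y : V) : IsSub (tri x y) := (IsSub.zero.sup (.lin _)).sup (.lin _)

lemma isSub_tet (x y z : V) : IsSub (tet x y z) := (isSub_tri x y).sup (.lin _)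

lemma tri_add_lin (x y v : V) : tri x y + lin v = lin v ⊔ lin (x + v) ⊔ lin (x + y + v) := by
  simp only [tri, sup_add_right, zero_add, lin_add]

lemma tet_add_lin (x y z v : V) :
    tet x y z + lin v = lin v ⊔ lin (x + v) ⊔ lin (x + y + v) ⊔ lin (x + y + z + v) := by
  simp only [tet, sup_add_right, zero_add, lin_add]

lemma tri_add_seg (x y v : V) : tri x y + seg v =
    0 ⊔ lin x ⊔ lin (x + y) ⊔ (lin v ⊔ lin (x + v) ⊔ lin (x + y + v)) := by
  rw [← tri_add_lin, seg, add_comm, sup_add_right, zero_add, add_comm, sup_comm]; rfl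

lemma min_le_of_add_eq {a b c d : V} (e : a + b = c + d) (x : V) :
    min (lin a x) (lin b x) ≤ max (lin c x) (lin d x) := by
  have h1 : lin a x + lin b x = lin c x + lin d x := by
    rw [← Pi.add_apply, ← lin_add, e, lin_add, Pi.add_apply]
  rcases le_total (lin a x) (lin b x) with h | h <;>
    rcases le_total (lin c x) (lin d x) with h' | h'
  all_goals simp only [min_eq_left, min_eq_right, max_eq_left, max_eq_right, h, h']; linarith

lemma comp_neg_id (h : V → ℝ) : h ∘ (-LinearMap.id : V →ₗ[ℝ] V) = fun x => h (-x) :=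
  funext fun x => by simp

lemma isSub_neg (hh : IsSub h) : IsSub fun x => h (-x) := by
  rw [← comp_neg_id]; exact hh.comp _

namespace IsOdd

lemma of_smul_add (ho : IsOdd ν) (hν : IsVal ν) (hh : IsSub h) (y : V)
    (hs : ∀ x, h (-x) + inner ℝ y x = h x) : ν h = 0 := by
  have h1 := ho h hh
  have h2 := hν.trans (fun x => h (-x)) (isSub_neg hh) y
  rw [show (fun x => h (-x)) + lin y = h from funext hs, h1] at h2
  linear_combination h2 / 2

protected lemma D (ho : IsOdd ν) (hν : IsVal ν) (w : V) : IsOdd (D w ν) := by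
  intro h hh
  have e := D_comp (s := -LinearMap.id) (f := ν) (g := ν) (c := -1) (by simp)
    (fun h hh => by rw [comp_neg_id, ho h hh, neg_one_mul]) w hh
  rw [comp_neg_id] at e
  rw [e]
  simp only [LinearMap.neg_apply, LinearMap.id_apply, hν.D_neg hh, neg_one_mul]

protected lemma Ds (ho : IsOdd ν) (hν : IsVal ν) : ∀ l : List V, IsOdd (Ds l ν)
  | [] => ho
  | w :: l => IsOdd.D (ho.Ds hν l) (hν.Ds l) w

end IsOdd

namespace IsVal

lemma val_sup (hν : IsVal ν) {f g m : V → ℝ} (hm : IsSub m) (hf : IsSub (m ⊔ f))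
    (hg : IsSub (m ⊔ g)) (hfg : f ⊓ g ≤ m) : ν (m ⊔ f ⊔ g) + ν m = ν (m ⊔ f) + ν (m ⊔ g) := by
  have e : (m ⊔ f) ⊓ (m ⊔ g) = m := by rw [← sup_inf_left]; exact sup_eq_left.2 hfg
  have := hν.val _ _ hf hg (by rwa [e])
  rw [e] at this
  rw [← this, ← sup_sup_distrib_left, sup_assoc]

lemma map_sup_lin (hν : IsVal ν) (ho : IsOdd ν) (a b : V) : ν (lin a ⊔ lin b) = 0 := by
  refine ho.of_smul_add hν ((IsSub.lin a).sup (.lin b)) (a + b) fun x => ?_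
  simp only [Pi.sup_apply, lin_apply, inner_neg_right, inner_add_left]
  rcases le_total (inner ℝ a x) (inner ℝ b x) with h | h
  · rw [max_eq_left (by linarith), max_eq_right h]; ring
  · rw [max_eq_right (by linarith), max_eq_left h]; ring

lemma map_seg (hν : IsVal ν) (ho : IsOdd ν) (a : V) : ν (seg a) = 0 := by
  have := hν.map_sup_lin ho a 0
  simpa [seg] using this

lemma map_tri (hν : IsVal ν) {a b c x y : V} (hx : x = b - a) (hy : y = c - b) :
    ν (lin a ⊔ lin b ⊔ lin c) = ν (tri x y) := by
  subst hx hy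
  rw [← hν.trans _ (isSub_tri _ _) a, tri_add_lin]; simp

lemma map_tet (hν : IsVal ν) {a b c d x y z : V} (hx : x = b - a) (hy : y = c - b)
    (hz : z = d - c) : ν (lin a ⊔ lin b ⊔ lin c ⊔ lin d) = ν (tet x y z) := by
  subst hx hy hz
  rw [← hν.trans _ (isSub_tet _ _ _) a, tet_add_lin]; simp

lemma tri_swap (hν : IsVal ν) (ho : IsOdd ν) (x y : V) : ν (tri x y) = -ν (tri y x) := by
  have hm : IsSub (0 ⊔ lin (x + y)) := IsSub.zero.sup (.lin _)
  have h1 := hν.val_sup hm (hm.sup (.lin x)) (hm.sup (.lin y)) fun z => by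
    have := min_le_of_add_eq (show x + y = 0 + (x + y) by simp) z
    simpa using this
  have h2 : ν (0 ⊔ lin (x + y)) = 0 := by simpa using hν.map_sup_lin ho 0 (x + y)
  have h3 : ν (0 ⊔ lin (x + y) ⊔ lin x ⊔ lin y) = 0 := by
    refine ho.of_smul_add hν ((hm.sup (.lin x)).sup (.lin y)) (x + y) fun z => ?_
    simp only [Pi.sup_apply, lin_apply, inner_neg_right, inner_add_left, Pi.zero_apply]
    rw [← max_add_add_right, ← max_add_add_right, ← max_add_add_right]
    rw [show -inner ℝ x z + (inner ℝ x z + inner ℝ y z) = inner ℝ y z by ring,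
      show -inner ℝ y z + (inner ℝ x z + inner ℝ y z) = inner ℝ x z by ring,
      show -(inner ℝ x z + inner ℝ y z) + (inner ℝ x z + inner ℝ y z) = 0 by ring, zero_add,
      max_comm (inner ℝ x z + inner ℝ y z) 0, max_right_comm]
  have h4 : tri x y = 0 ⊔ lin (x + y) ⊔ lin x := by rw [tri, sup_right_comm]
  have h5 : tri y x = 0 ⊔ lin (x + y) ⊔ lin y := by rw [tri, sup_right_comm, add_comm]
  rw [h4, h5]
  linear_combination -h1 + h2 + h3

/-- The staircase triangulation of a triangular prism. -/
lemma prism_stairs (hν : IsVal ν) (x y v : V) : ν (tri x y + seg v) =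
    ν (tet x y v) + ν (tet x v y) + ν (tet v x y) - ν (tri x (y + v)) - ν (tri (x + v) y) := by
  have hm1 : IsSub (lin 0 ⊔ lin x ⊔ lin (x + y + v)) := ((IsSub.lin _).sup (.lin _)).sup (.lin _)
  have hm2 : IsSub (lin 0 ⊔ lin (x + v) ⊔ lin (x + y + v)) :=
    ((IsSub.lin _).sup (.lin _)).sup (.lin _)
  have h1 := hν.val_sup hm1 (hm1.sup (.lin (x + y))) (hm1.sup (.lin (x + v))) fun z => by
    refine (min_le_of_add_eq (show x + y + (x + v) = x + (x + y + v) by abel) z).trans ?_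
    simp only [Pi.sup_apply]; exact max_le_max_right _ le_sup_right
  have h2 := hν.val_sup hm2 (f := lin x ⊔ lin (x + y)) (g := lin v)
    (hm2.sup ((IsSub.lin _).sup (.lin _))) (hm2.sup (.lin _)) fun z => by
    have a1 := min_le_of_add_eq (show x + v = 0 + (x + v) by abel) z
    have a2 := min_le_of_add_eq (show x + y + v = 0 + (x + y + v) by abel) z
    simp only [Pi.inf_apply, Pi.sup_apply] at a1 a2 ⊢
    rw [inf_sup_right]
    refine max_le (a1.trans le_sup_left) (a2.trans (max_le_max_right _ le_sup_left))
  have e1 : tri x y + seg v =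
      lin 0 ⊔ lin (x + v) ⊔ lin (x + y + v) ⊔ (lin x ⊔ lin (x + y)) ⊔ lin v := by
    rw [tri_add_seg, lin_zero]; ac_rfl
  have e2 : lin 0 ⊔ lin (x + v) ⊔ lin (x + y + v) ⊔ (lin x ⊔ lin (x + y)) =
      lin 0 ⊔ lin x ⊔ lin (x + y) ⊔ lin (x + y + v) ⊔ lin (x + v) := by ac_rfl
  have e3 : lin 0 ⊔ lin x ⊔ lin (x + y + v) ⊔ lin (x + y) =
      lin 0 ⊔ lin x ⊔ lin (x + y) ⊔ lin (x + y + v) := by ac_rfl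
  have e4 : lin 0 ⊔ lin x ⊔ lin (x + y + v) ⊔ lin (x + v) =
      lin 0 ⊔ lin x ⊔ lin (x + v) ⊔ lin (x + y + v) := by ac_rfl
  have e5 : lin 0 ⊔ lin (x + v) ⊔ lin (x + y + v) ⊔ lin v =
      lin 0 ⊔ lin v ⊔ lin (x + v) ⊔ lin (x + y + v) := by ac_rfl
  rw [e1]
  rw [e2, e5] at h2
  rw [e3, e4] at h1
  rw [hν.map_tri (x := x) (y := y + v) (by simp) (by abel),
    hν.map_tet (x := x) (y := y) (z := v) (by simp) (by abel) (by abel),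
    hν.map_tet (x := x) (y := v) (z := y) (by simp) (by abel) (by abel)] at h1
  rw [hν.map_tri (x := x + v) (y := y) (by simp) (by abel),
    hν.map_tet (x := v) (y := x) (z := y) (by simp) (by abel) (by abel)] at h2
  rw [e2]
  linear_combination h1 + h2

/-- The cyclic triangulation of a triangular prism. -/
lemma prism_cyclic (hν : IsVal ν) (x y z : V) : ν (tri x y + seg (x + y + z)) =
    ν (tet x y z) + ν (tet y z x) + ν (tet z x y) - ν (tri y z) - ν (tri z x) := by
  set v := x + y + z with hv
  have hm1 : IsSub (lin x ⊔ lin (x + y) ⊔ lin v) := ((IsSub.lin _).sup (.lin _)).sup (.lin _)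
  have hm2 : IsSub (lin (x + y) ⊔ lin v ⊔ lin (x + v)) :=
    ((IsSub.lin _).sup (.lin _)).sup (.lin _)
  have h1 := hν.val_sup hm1 (hm1.sup (.lin 0)) (hm1.sup (.lin (x + v))) fun w => by
    refine (min_le_of_add_eq (show 0 + (x + v) = x + v by abel) w).trans ?_
    simp only [Pi.sup_apply]; exact max_le_max_right _ le_sup_left
  have h2 := hν.val_sup hm2 (f := lin 0 ⊔ lin x) (g := lin (x + y + v))
    (hm2.sup ((IsSub.lin _).sup (.lin _))) (hm2.sup (.lin _)) fun w => by
    have a1 := min_le_of_add_eq (show 0 + (x + y + v) = (x + y) + v by abel) w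
    have a2 := min_le_of_add_eq (show x + (x + y + v) = (x + y) + (x + v) by abel) w
    simp only [Pi.inf_apply, Pi.sup_apply] at a1 a2 ⊢
    rw [inf_sup_right]
    refine max_le (a1.trans le_sup_left) (a2.trans (max_le_max_right _ le_sup_left))
  have e1 : tri x y + seg v =
      lin (x + y) ⊔ lin v ⊔ lin (x + v) ⊔ (lin 0 ⊔ lin x) ⊔ lin (x + y + v) := by
    rw [tri_add_seg, lin_zero]; ac_rfl
  have e2 : lin (x + y) ⊔ lin v ⊔ lin (x + v) ⊔ (lin 0 ⊔ lin x) =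
      lin 0 ⊔ lin x ⊔ lin (x + y) ⊔ lin v ⊔ lin (x + v) := by ac_rfl
  have e3 : lin x ⊔ lin (x + y) ⊔ lin v ⊔ lin 0 =
      lin 0 ⊔ lin x ⊔ lin (x + y) ⊔ lin v := by ac_rfl
  rw [e1]
  rw [e2] at h2
  rw [e3] at h1
  rw [hν.map_tri (x := y) (y := z) (by abel) (by rw [hv]; abel),
    hν.map_tet (x := x) (y := y) (z := z) (by simp) (by abel) (by rw [hv]; abel),
    hν.map_tet (x := y) (y := z) (z := x) (by abel) (by rw [hv]; abel) (by abel)] at h1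
  rw [hν.map_tri (x := z) (y := x) (by rw [hv]; abel) (by abel),
    hν.map_tet (x := z) (y := x) (z := y) (by rw [hv]; abel) (by abel) (by abel)] at h2
  rw [e2]
  linear_combination h1 + h2

/-- The four-term relation for differences of an odd functional at triangles. -/
theorem four_term (hν : IsVal ν) (ho : IsOdd ν) (a b c : V) :
    Sublin.D a ν (tri b c) + Sublin.D c ν (tri a b) - Sublin.D b ν (tri a c) =
      Sublin.D (a + b + c) ν (tri a b) := by
  have h1 := hν.prism_stairs b c a
  have h2 := hν.prism_stairs a b c
  have h3 := hν.prism_stairs a c b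
  have h4 := hν.prism_cyclic a b c
  have h5 := hν.tri_swap ho (a + c) b
  have h6 := hν.tri_swap ho a c
  rw [add_comm c a, add_comm b a] at h1
  rw [add_comm c b] at h3
  simp only [Sublin.D]
  linear_combination h1 + h2 - h3 - h4 - h5 + h6

/-- Cutting a triangle through a vertex and a point of the opposite edge. -/
lemma tri_cut (hν : IsVal ν) (ho : IsOdd ν) (x y : V) {t : ℝ} (h0 : 0 ≤ t) (h1 : t ≤ 1) :
    ν (tri x y) = ν (tri x (t • (x + y) - x)) + ν (tri (t • (x + y) - x) ((1 - t) • (x + y))) := by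
  set m := t • (x + y) with hm
  have hM : IsSub (lin x ⊔ lin m) := (IsSub.lin _).sup (.lin _)
  have h2 := hν.val_sup hM (hM.sup (.lin 0)) (hM.sup (.lin (x + y))) fun w => by
    have : lin m w = t * lin (x + y) w := by simp only [hm, lin_smul]; rfl
    simp only [lin_zero, Pi.inf_apply, Pi.zero_apply, Pi.sup_apply, this]
    refine le_trans ?_ le_sup_right
    rcases le_total 0 (lin (x + y) w) with h | h
    · rw [min_eq_left h]; positivity
    · rw [min_eq_right h]; nlinarith
  have e1 : lin x ⊔ lin m ⊔ lin 0 = lin 0 ⊔ lin x ⊔ lin m := by ac_rfl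
  have e2 : lin x ⊔ lin m ⊔ lin 0 ⊔ lin (x + y) = tri x y := by
    refine le_antisymm ?_ ?_
    · intro w
      have : lin m w = t * lin (x + y) w := by simp only [hm, lin_smul]; rfl
      simp only [tri, lin_zero, Pi.zero_apply, Pi.sup_apply, this]
      refine max_le (max_le (max_le (le_max_of_le_left (le_max_right _ _)) ?_)
        (le_max_of_le_left (le_max_left _ _))) (le_max_right _ _)
      rcases le_total 0 (lin (x + y) w) with h | h
      · exact le_max_of_le_right (by nlinarith)
      · exact le_max_of_le_left (le_max_of_le_left (by nlinarith))
    · rw [tri, lin_zero]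
      exact sup_le (sup_le (le_sup_of_le_left le_sup_right)
        (le_sup_of_le_left (le_sup_of_le_left le_sup_left))) le_sup_right
  rw [e2, hν.map_sup_lin ho, e1, hν.map_tri (x := x) (y := m - x) (by simp) rfl,
    hν.map_tri (x := m - x) (y := (1 - t) • (x + y)) rfl (by rw [hm]; module)] at h2
  linear_combination h2

lemma tri_rotate (hν : IsVal ν) (x y : V) : ν (tri x y) = ν (tri y (-(x + y))) := by
  rw [← hν.map_tri (a := x) (b := x + y) (c := 0) (x := y) (y := -(x + y)) (by abel) (by simp)]
  congr 1
  rw [tri, lin_zero]; ac_rfl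

variable [FiniteDimensional ℝ V]

/-- If differences in the directions of the plane of a triangle vanish, then at this triangle
differences only depend on the direction modulo the plane. -/
theorem D_tri_add (hν : IsVal ν) (ho : IsOdd ν) {a b : V} {W : Submodule ℝ V}
    (haW : a ∈ W) (hbW : b ∈ W)
    (H : ∀ u ∈ Submodule.span ℝ {a, b}, ∀ x ∈ Submodule.span ℝ {a, b}, ∀ c ∈ W,
      Sublin.D u ν (tri x c) = 0) {c y : V} (hc : c ∈ W) (hy : y ∈ Submodule.span ℝ {a, b}) :
    Sublin.D (c + y) ν (tri a b) = Sublin.D c ν (tri a b) := by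
  have step : ∀ x ∈ Submodule.span ℝ {a, b}, ∀ y ∈ Submodule.span ℝ {a, b}, ∀ c ∈ W, ∀ t : ℝ,
      Sublin.D (c + t • (x + y)) ν (tri x y) = Sublin.D c ν (tri x y) := by
    intro x hx y hy c hc t
    rcases eq_or_ne t 0 with rfl | ht
    · simp
    have h1 := hν.four_term ho x y (t⁻¹ • c)
    have hc' := W.smul_mem t⁻¹ hc
    rw [H x hx y hy _ hc', H y hy x hx _ hc', hν.D_smul (isSub_tri _ _)] at h1
    have e : c + t • (x + y) = t • (x + y + t⁻¹ • c) := by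
      rw [smul_add t (x + y), smul_inv_smul₀ ht]; abel
    rw [e, hν.D_smul (isSub_tri _ _), ← h1]
    have : ((|t| : ℝ) : ℂ) * ((|t⁻¹| : ℝ) : ℂ) = 1 := by
      rw [← Complex.ofReal_mul, ← abs_mul, mul_inv_cancel₀ ht]; simp
    linear_combination Sublin.D c ν (tri x y) * this
  have ha : a ∈ Submodule.span ℝ {a, b} := Submodule.subset_span (by simp)
  have hb : b ∈ Submodule.span ℝ {a, b} := Submodule.subset_span (by simp)
  have hW : Submodule.span ℝ {a, b} ≤ W := by
    rw [Submodule.span_le]; rintro x (rfl | rfl) <;> assumption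
  have hab := add_mem ha hb
  have sb : ∀ c ∈ W, ∀ t : ℝ, Sublin.D (c + t • a) ν (tri a b) = Sublin.D c ν (tri a b) := by
    intro c hc t
    have := step b hb (-(a + b)) (neg_mem hab) c hc (-t)
    rw [← (hν.D _).tri_rotate, ← (hν.D _).tri_rotate] at this
    rw [← this]; congr 1; module
  have sa : ∀ c ∈ W, ∀ t : ℝ, Sublin.D (c + t • b) ν (tri a b) = Sublin.D c ν (tri a b) := by
    intro c hc t
    have := step (-(a + b)) (neg_mem hab) a ha c hc (-t)
    have e : ∀ u, Sublin.D u ν (tri (-(a + b)) a) = Sublin.D u ν (tri a b) := fun u => by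
      rw [(hν.D _).tri_rotate]; congr 2; abel
    rw [e, e] at this
    rw [← this]; congr 1; module
  obtain ⟨s, t, rfl⟩ := Submodule.mem_span_pair.1 hy
  rw [← add_assoc, sa _ (W.add_mem hc (W.smul_mem _ haW)), sb _ hc]

end IsVal

end

section

variable {V : Type*} [NormedAddCommGroup V] [InnerProductSpace ℝ V]
variable {ν : (V → ℝ) → ℂ} {h k f g : V → ℝ}

lemma IsSub.eq_norm_mul (hh : IsSub h) {x : V} (hx : x ≠ 0) : h x = ‖x‖ * h (‖x‖⁻¹ • x) := by
  rw [hh.smul _ _ (by positivity), mul_inv_cancel_left₀ (norm_ne_zero_iff.2 hx)]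

/-- Averages of sublinear functions are uniformly close to convex combinations. -/
lemma exists_near_integral [FiniteDimensional ℝ V] {X : Type*} [TopologicalSpace X]
    [MeasurableSpace X] [OpensMeasurableSpace X] [SecondCountableTopology X] {μ : Measure X}
    [IsProbabilityMeasure μ] {F : X → V → ℝ} {C : Set (V → ℝ)} (hC : Convex ℝ C)
    (hCs : ∀ f ∈ C, IsSub f) (hFC : ∀ u, F u ∈ C)
    (hF : Continuous fun p : X × Metric.sphere (0 : V) 1 => F p.1 p.2) {b : X → ℝ}
    (hb : Integrable b μ) (hb0 : ∀ u, 0 ≤ b u)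
    (hFb : ∀ u, ∀ x, |F u x| ≤ b u * ‖x‖) {δ : ℝ} (hδ : 0 < δ) :
    ∃ g ∈ C, ∀ x, |∫ u, F u x ∂μ - g x| ≤ δ * ‖x‖ := by
  let Φ : C(X, C(Metric.sphere (0 : V) 1, ℝ)) := ContinuousMap.curry ⟨_, hF⟩
  have hΦ : ∀ u x, Φ u x = F u x := fun u x => rfl
  let A : Set C(Metric.sphere (0 : V) 1, ℝ) := {φ | ∃ g ∈ C, ∀ x, φ x = g x}
  have hA : Convex ℝ A := by
    rintro φ ⟨g, hg, hφ⟩ ψ ⟨k, hk, hψ⟩ s t hs ht hst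
    exact ⟨_, hC hg hk hs ht hst, fun x => by simp [hφ, hψ]⟩
  have hi : Integrable Φ μ := by
    refine Integrable.mono' hb Φ.continuous.aestronglyMeasurable (.of_forall fun u => ?_)
    refine (ContinuousMap.norm_le _ (hb0 u)).2 fun x => ?_
    have h2 : ‖(x : V)‖ = 1 := by simp
    simpa [h2, hΦ] using hFb u x
  have hm : ∫ u, Φ u ∂μ ∈ closure A :=
    hA.closure.integral_mem isClosed_closure
      (.of_forall fun u => subset_closure ⟨_, hFC u, hΦ u⟩) hi
  obtain ⟨φ, ⟨g, hg, hφ⟩, hd⟩ := Metric.mem_closure_iff.1 hm δ hδ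
  have he : ∀ x, (∫ u, Φ u ∂μ) x = ∫ u, F u x ∂μ := fun x =>
    ((ContinuousMap.evalCLM ℝ x).integral_comp_comm hi).symm
  refine ⟨g, hg, fun x => ?_⟩
  by_cases hx : x = 0
  · subst hx
    have : ∀ u, F u 0 = 0 := fun u => (hCs _ (hFC u)).map_zero
    simp [this, (hCs g hg).map_zero]
  have hn : 0 < ‖x‖ := norm_pos_iff.2 hx
  let y : Metric.sphere (0 : V) 1 := ⟨‖x‖⁻¹ • x, by simp [norm_smul, hn.ne']⟩
  have h1 : |∫ u, F u y ∂μ - g y| ≤ δ := by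
    have := ContinuousMap.dist_apply_le_dist (f := ∫ u, Φ u ∂μ) (g := φ) y
    rw [he, hφ, Real.dist_eq] at this
    linarith
  have h2 : ∀ u, F u x = ‖x‖ * F u y := fun u => (hCs _ (hFC u)).eq_norm_mul hx
  simp_rw [h2, (hCs g hg).eq_norm_mul hx, integral_const_mul, ← mul_sub, abs_mul, abs_norm]
  rw [mul_comm]
  gcongr

/-- Functionals that do not change under the addition of segments. -/
structure IsFlat (ν : (V → ℝ) → ℂ) : Prop extends IsVal ν where
  D_eq : ∀ v h, IsSub h → D v ν h = 0

/-- Sublinear functions whose nonnegative multiples can be added without changing `ν`. -/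
structure Null (ν : (V → ℝ) → ℂ) (f : V → ℝ) : Prop where
  sub : IsSub f
  eq : ∀ t : ℝ, 0 ≤ t → ∀ h, IsSub h → ν (h + t • f) = ν h

namespace Null

lemma add (hf : Null ν f) (hg : Null ν g) : Null ν (f + g) :=
  ⟨hf.sub.add hg.sub, fun t ht h hh => by
    rw [smul_add, ← add_assoc, hg.eq t ht _ (hh.add (hf.sub.const_smul ht)), hf.eq t ht h hh]⟩

lemma smul (hf : Null ν f) {c : ℝ} (hc : 0 ≤ c) : Null ν (c • f) :=
  ⟨hf.sub.const_smul hc, fun t ht h hh => by rw [smul_smul, hf.eq _ (by positivity) h hh]⟩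

lemma zero : Null ν 0 := ⟨.zero, by simp⟩

lemma sum {ι : Type*} (s : Finset ι) {f : ι → V → ℝ} (hf : ∀ i ∈ s, Null ν (f i)) :
    Null ν (∑ i ∈ s, f i) :=
  Finset.sum_induction f (Null ν) (fun _ _ => add) zero hf

lemma lin (hν : IsVal ν) (v : V) : Null ν (lin v) :=
  ⟨.lin v, fun t _ h hh => by rw [← lin_smul, hν.trans h hh]⟩

lemma convex : Convex ℝ {f | Null ν f} :=
  fun _ hf _ hg _ _ hs ht _ => Null.add (Null.smul hf hs) (Null.smul hg ht)

/-- A sublinear function is null if, up to null summands, it is arbitrarily small. -/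
lemma of_approx (hν : IsVal ν) (hf : IsSub f) (H : ∀ δ > 0, ∃ g₁ g₂ R : V → ℝ, Null ν g₁ ∧
    Null ν g₂ ∧ IsSub R ∧ (∀ x, |R x| ≤ δ * ‖x‖) ∧ f + g₁ = g₂ + R) : Null ν f := by
  refine ⟨hf, fun t ht h hh => ?_⟩
  by_contra hne
  obtain ⟨δ, hδ, hc⟩ := hν.cont h hh _ (norm_pos_iff.2 (sub_ne_zero.2 hne))
  obtain ⟨g₁, g₂, R, h1, h2, hR, hs, e⟩ := H (δ / (t + 1)) (by positivity)
  have e1 : ν (h + t • f) = ν (h + t • R) := by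
    rw [← h1.eq t ht _ (hh.add (hf.const_smul ht)), add_assoc, ← smul_add, e, smul_add,
      add_comm (t • g₂),
      ← add_assoc, h2.eq t ht _ (hh.add (hR.const_smul ht))]
  refine (hc _ (hh.add (hR.const_smul ht)) fun x => ?_).ne (by rw [e1])
  have := hs x
  simp only [Pi.add_apply, Pi.smul_apply, smul_eq_mul, add_sub_cancel_left, abs_mul,
    abs_of_nonneg ht]
  calc t * |R x| ≤ t * (δ / (t + 1) * ‖x‖) := by gcongr
    _ = t / (t + 1) * (δ * ‖x‖) := by ring
    _ ≤ 1 * (δ * ‖x‖) := by gcongr; rw [div_le_one (by positivity)]; linarith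
    _ = _ := one_mul _

/-- Uniform limits of null functions are null. -/
lemma of_near (hν : IsVal ν) (hf : IsSub f)
    (H : ∀ δ > 0, ∃ g, Null ν g ∧ ∀ x, |f x - g x| ≤ δ * ‖x‖) : Null ν f := by
  refine ⟨hf, fun t ht h hh => ?_⟩
  by_contra hne
  obtain ⟨δ, hδ, hc⟩ := hν.cont _ (hh.add (hf.const_smul ht)) _
    (norm_pos_iff.2 (sub_ne_zero.2 hne))
  obtain ⟨g, hg, hs⟩ := H (δ / (t + 1)) (by positivity)
  refine (hc _ (hh.add (hg.sub.const_smul ht)) fun x => ?_).ne (by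
    rw [hg.eq t ht h hh, norm_sub_rev])
  have := hs x
  simp only [Pi.add_apply, Pi.smul_apply, smul_eq_mul, add_sub_add_left_eq_sub, ← mul_sub, abs_mul,
    abs_of_nonneg ht]
  rw [abs_sub_comm]
  calc t * |f x - g x| ≤ t * (δ / (t + 1) * ‖x‖) := by gcongr
    _ = t / (t + 1) * (δ * ‖x‖) := by ring
    _ ≤ 1 * (δ * ‖x‖) := by gcongr; rw [div_le_one (by positivity)]; linarith
    _ = _ := one_mul _

end Null

lemma abs_lin_eq_seg (v : V) : |lin v| = seg ((2 : ℝ) • v) + lin (-v) := by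
  ext x
  simp only [Pi.abs_apply, lin_apply, Pi.add_apply, seg_apply, inner_smul_left, inner_neg_left]
  simp only [conj_trivial]
  rcases le_total 0 (inner ℝ v x) with h | h
  · rw [abs_of_nonneg h, max_eq_left (by linarith)]; ring
  · rw [abs_of_nonpos h, max_eq_right (by linarith)]; ring

namespace IsFlat

lemma null_seg (hν : IsFlat ν) (v : V) : Null ν (seg v) :=
  ⟨isSub_seg v, fun t ht h hh => by
    have e : t • seg v = seg (t • v) := by
      ext x
      simp [inner_smul_left, mul_max_of_nonneg _ _ ht]
    rw [e]
    exact sub_eq_zero.1 (hν.D_eq (t • v) h hh)⟩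

lemma null_abs_lin (hν : IsFlat ν) (v : V) : Null ν |lin v| := by
  rw [abs_lin_eq_seg]
  exact (hν.null_seg _).add (.lin hν.toIsVal _)

end IsFlat

end

section

variable {V : Type*} [NormedAddCommGroup V] [InnerProductSpace ℝ V]
variable {ν : (V → ℝ) → ℂ} {h k f g : V → ℝ}

/-- The second antiderivative of `g` on the positive half-line, extended by zero. -/
def dbl (g : ℝ → ℝ) (s : ℝ) : ℝ := ∫ y in (0)..(max s 0), (max s 0 - y) * g y

lemma dbl_sub_sum {g : ℝ → ℝ} (hg : Continuous g) (n : ℕ) (c : ℕ → ℝ) {G : ℕ → ℝ → ℝ}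
    (hG : ∀ i, Continuous (G i)) (s : ℝ) :
    dbl (fun y => g y - ∑ i ∈ Finset.range n, c i * G i y) s =
      dbl g s - ∑ i ∈ Finset.range n, c i * dbl (G i) s := by
  simp only [dbl]
  simp_rw [mul_sub, Finset.mul_sum]
  rw [intervalIntegral.integral_sub, intervalIntegral.integral_finsetSum]
  · congr 1
    refine Finset.sum_congr rfl fun i _ => ?_
    rw [← intervalIntegral.integral_const_mul]
    refine intervalIntegral.integral_congr fun y _ => ?_
    ring
  · intro i _
    exact Continuous.intervalIntegrable (by have := hG i; fun_prop) _ _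
  · exact Continuous.intervalIntegrable (by fun_prop) _ _
  · exact Continuous.intervalIntegrable (by fun_prop) _ _

lemma abs_max_zero_le {s : ℝ} (hs : |s| ≤ 1) : 0 ≤ max s 0 ∧ max s 0 ≤ 1 :=
  ⟨le_max_right _ _, max_le (abs_le.1 hs).2 zero_le_one⟩

section

variable {r : ℝ → ℝ} {δ : ℝ}

lemma mem_of_uIoc {p q y : ℝ} (hp : 0 ≤ p) (hp' : p ≤ 1) (hq : 0 ≤ q) (hq' : q ≤ 1)
    (hy : y ∈ Set.uIoc p q) : y ∈ Set.Icc (0 : ℝ) 1 ∧ |q - y| ≤ |q - p| := by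
  rcases Set.mem_uIoc.1 hy with h | h
  · exact ⟨⟨by linarith, by linarith⟩, by
      rw [abs_of_nonneg (by linarith), abs_of_nonneg (by linarith)]; linarith⟩
  · exact ⟨⟨by linarith, by linarith⟩, by
      rw [abs_of_nonpos (by linarith), abs_of_nonpos (by linarith)]; linarith⟩

lemma abs_integral_le (hδ : ∀ y ∈ Set.Icc (0 : ℝ) 1, |r y| ≤ δ) {p q : ℝ} (hp : 0 ≤ p)
    (hp' : p ≤ 1) (hq : 0 ≤ q) (hq' : q ≤ 1) : |∫ y in p..q, r y| ≤ δ * |q - p| := by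
  rw [← Real.norm_eq_abs]
  exact intervalIntegral.norm_integral_le_of_norm_le_const fun y hy =>
    hδ y (mem_of_uIoc hp hp' hq hq' hy).1

lemma abs_integral_mul_le (hδ : ∀ y ∈ Set.Icc (0 : ℝ) 1, |r y| ≤ δ) {p q : ℝ} (hp : 0 ≤ p)
    (hp' : p ≤ 1) (hq : 0 ≤ q) (hq' : q ≤ 1) :
    |∫ y in p..q, (q - y) * r y| ≤ δ * (q - p) ^ 2 := by
  rw [← Real.norm_eq_abs]
  refine (intervalIntegral.norm_integral_le_of_norm_le_const (C := |q - p| * δ)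
    fun y hy => ?_).trans ?_
  · have := mem_of_uIoc hp hp' hq hq' hy
    rw [Real.norm_eq_abs, abs_mul]
    exact mul_le_mul this.2 (hδ y this.1) (abs_nonneg _) (abs_nonneg _)
  · rw [← sq_abs (q - p)]; apply le_of_eq; ring

lemma abs_dbl_le (hδ : ∀ y ∈ Set.Icc (0 : ℝ) 1, |r y| ≤ δ) {s : ℝ} (hs : |s| ≤ 1) :
    |dbl r s| ≤ δ := by
  obtain ⟨h1, h2⟩ := abs_max_zero_le hs
  have h0 : 0 ≤ δ := (abs_nonneg _).trans (hδ 0 (by simp))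
  refine (abs_integral_mul_le hδ le_rfl zero_le_one h1 h2).trans ?_
  have : (max s 0 - 0) ^ 2 ≤ 1 := by nlinarith
  nlinarith

lemma abs_dbl_sub_le (hr : Continuous r) (hδ : ∀ y ∈ Set.Icc (0 : ℝ) 1, |r y| ≤ δ) {s t : ℝ}
    (hs : |s| ≤ 1) (ht : |t| ≤ 1) :
    |dbl r t - dbl r s - (∫ y in (0)..(max s 0), r y) * (t - s)| ≤ δ * (t - s) ^ 2 := by
  obtain ⟨h1, h2⟩ := abs_max_zero_le hs
  obtain ⟨h3, h4⟩ := abs_max_zero_le ht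
  have h0 : 0 ≤ δ := (abs_nonneg _).trans (hδ 0 (by simp))
  have key : dbl r t - dbl r s - (∫ y in (0)..(max s 0), r y) * (max t 0 - max s 0) =
      ∫ y in (max s 0)..(max t 0), (max t 0 - y) * r y := by
    have i1 : ∀ p a b : ℝ, IntervalIntegrable (fun y => (p - y) * r y) volume a b :=
      fun p a b => Continuous.intervalIntegrable (by fun_prop) _ _
    have i2 : ∀ a b : ℝ, IntervalIntegrable r volume a b := fun a b => hr.intervalIntegrable _ _
    have e1 := intervalIntegral.integral_interval_sub_left (i1 (max t 0) 0 (max t 0))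
      (i1 (max t 0) 0 (max s 0))
    rw [← e1, mul_comm, ← intervalIntegral.integral_const_mul]
    simp only [dbl]
    have e2 : ∫ y in (0)..(max s 0), (max t 0 - y) * r y =
        (∫ y in (0)..(max s 0), (max s 0 - y) * r y) +
          ∫ y in (0)..(max s 0), (max t 0 - max s 0) * r y := by
      rw [← intervalIntegral.integral_add (i1 _ _ _) ((i2 _ _).const_mul _)]
      refine intervalIntegral.integral_congr fun y _ => ?_
      ring
    rw [e2]; ring
  have hk := abs_integral_mul_le hδ h1 h2 h3 h4
  rw [← key] at hk
  have hd := abs_integral_le hδ le_rfl zero_le_one h1 h2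
  set d := ∫ y in (0)..(max s 0), r y
  rcases le_total s 0 with hs0 | hs0
  · rw [max_eq_right hs0] at hd hk
    have hd0 : d = 0 := by simpa using hd
    rw [hd0] at hk ⊢
    refine le_trans (by simpa using hk) ?_
    gcongr δ * ?_
    rcases le_total t 0 with ht0 | ht0
    · rw [max_eq_right ht0]; nlinarith
    · rw [max_eq_left ht0]; nlinarith
  · rw [max_eq_left hs0] at hd hk
    rcases le_total t 0 with ht0 | ht0
    · rw [max_eq_right ht0] at hk
      rw [sub_zero, abs_of_nonneg hs0] at hd
      have e : dbl r t - dbl r s - d * (t - s) = (dbl r t - dbl r s - d * (0 - s)) - d * t := by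
        ring
      rw [e]
      refine (abs_sub _ _).trans ?_
      have : |d * t| ≤ δ * s * (-t) := by
        rw [abs_mul, abs_of_nonpos ht0]; gcongr; linarith
      nlinarith [mul_nonneg h0 (mul_nonneg hs0 (neg_nonneg.2 ht0)), mul_nonneg h0 (sq_nonneg t)]
    · rwa [max_eq_left ht0] at hk

end

/-- The zonal function with axis `ω` and profile `r`. -/
def zon (ω : V) (r : ℝ → ℝ) (x : V) : ℝ := ‖x‖ * r (inner ℝ ω x / ‖x‖)

lemma abs_inner_div_le {ω : V} (hω : ‖ω‖ = 1) (x : V) : |inner ℝ ω x / ‖x‖| ≤ 1 := by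
  rw [abs_div, abs_norm]
  refine div_le_one_of_le₀ ?_ (norm_nonneg _)
  simpa [hω] using abs_real_inner_le_norm ω x

lemma zon_smul (ω : V) (r : ℝ → ℝ) {t : ℝ} (ht : 0 ≤ t) (x : V) :
    zon ω r (t • x) = t * zon ω r x := by
  rcases ht.eq_or_lt with rfl | ht
  · simp [zon]
  · rw [zon, norm_smul, inner_smul_right, Real.norm_of_nonneg ht.le,
      mul_div_mul_left _ _ ht.ne', mul_assoc, zon]

/-- A positively homogeneous nonnegative function with supporting forms is sublinear. -/
lemma IsSub.of_support (h0 : ∀ x, 0 ≤ f x) (hs : ∀ (t : ℝ) x, 0 ≤ t → f (t • x) = t * f x)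
    (H : ∀ x, ‖x‖ = 1 → ∃ w : V, inner ℝ w x = f x ∧ ∀ y, ‖y‖ = 1 → inner ℝ w y ≤ f y) :
    IsSub f := by
  refine ⟨fun x y => ?_, hs⟩
  have hh : ∀ x, x ≠ 0 → f x = ‖x‖ * f (‖x‖⁻¹ • x) := fun x hx => by
    rw [hs _ _ (by positivity), mul_inv_cancel_left₀ (norm_ne_zero_iff.2 hx)]
  by_cases hxy : x + y = 0
  · have := hs 0 0 le_rfl
    rw [zero_smul, zero_mul] at this
    rw [hxy, this]; exact add_nonneg (h0 _) (h0 _)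
  have hn : ∀ x : V, x ≠ 0 → ‖‖x‖⁻¹ • x‖ = 1 := fun x hx => by
    rw [norm_smul, norm_inv, norm_norm, inv_mul_cancel₀ (norm_ne_zero_iff.2 hx)]
  obtain ⟨w, hw, hwy⟩ := H _ (hn _ hxy)
  have hle : ∀ z, inner ℝ w z ≤ f z := fun z => by
    by_cases hz : z = 0
    · subst hz; simpa using h0 0
    rw [hh z hz]
    have := mul_le_mul_of_nonneg_left (hwy _ (hn z hz)) (norm_nonneg z)
    rwa [inner_smul_right, mul_inv_cancel_left₀ (norm_ne_zero_iff.2 hz)] at this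
  rw [hh _ hxy, ← hw, inner_smul_right, mul_inv_cancel_left₀ (norm_ne_zero_iff.2 hxy),
    inner_add_right]
  exact add_le_add (hle x) (hle y)

lemma isSub_zon {ω : V} (hω : ‖ω‖ = 1) {r r' : ℝ → ℝ} {M A B c : ℝ} (hM : 0 ≤ M)
    (hr : ∀ s t, |s| ≤ 1 → |t| ≤ 1 → |r t - r s - r' s * (t - s)| ≤ M * (t - s) ^ 2)
    (hA : ∀ s, |s| ≤ 1 → |r s| ≤ A) (hB : ∀ s, |s| ≤ 1 → |r' s| ≤ B)
    (hc : 2 * M + A + B ≤ c) : IsSub (zon ω fun s => c + r s) := by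
  have hs1 : ∀ y : V, ‖y‖ = 1 → |inner ℝ ω y| ≤ 1 := fun y hy => by
    simpa [hω, hy] using abs_real_inner_le_norm ω y
  have hB0 : 0 ≤ B := (abs_nonneg _).trans (hB 0 (by simp))
  refine .of_support (fun x => ?_) (fun t x ht => zon_smul _ _ ht x) fun x hx => ?_
  · have := abs_le.1 (hA _ (abs_inner_div_le hω x))
    exact mul_nonneg (norm_nonneg _) (by linarith)
  · set s := inner ℝ ω x with hs
    refine ⟨(c + r s - s * r' s) • x + r' s • ω, ?_, fun y hy => ?_⟩
    · simp only [inner_add_left, inner_smul_left, conj_trivial, real_inner_self_eq_norm_sq, hx,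
        zon, ← hs]
      simp
      ring
    · set t := inner ℝ ω y with ht
      set τ := inner ℝ x y with hτ
      simp only [inner_add_left, inner_smul_left, conj_trivial, hy, zon, ← ht, ← hτ, div_one,
        one_mul]
      have h1 : (t - s) ^ 2 ≤ 2 * (1 - τ) := by
        have e1 : t - s = inner ℝ ω (y - x) := by rw [inner_sub_right]
        have e2 : ‖y - x‖ ^ 2 = 2 * (1 - τ) := by
          rw [norm_sub_sq_real, hx, hy, real_inner_comm]; ring
        have := abs_real_inner_le_norm ω (y - x)
        rw [hω, one_mul, ← e1] at this
        rw [← e2, ← sq_abs]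
        gcongr
      have h2 := abs_le.1 (hr s t (hs1 x hx) (hs1 y hy))
      have h3 := abs_le.1 (hA s (hs1 x hx))
      have h4 : |s * r' s| ≤ B := by
        rw [abs_mul]
        have := mul_le_mul (hs1 x hx) (hB s (hs1 x hx)) (abs_nonneg _) zero_le_one
        linarith
      have h5 := abs_le.1 h4
      have h6 : 0 ≤ 1 - τ := by
        have := real_inner_le_norm x y; rw [hx, hy] at this; linarith
      nlinarith [mul_nonneg h6 (show 0 ≤ c + r s - s * r' s - 2 * M by linarith)]

lemma isSub_zon_dbl {ω : V} (hω : ‖ω‖ = 1) {g : ℝ → ℝ} (hg : Continuous g) {δ c : ℝ}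
    (hδ : ∀ y ∈ Set.Icc (0 : ℝ) 1, |g y| ≤ δ) (hc : 4 * δ ≤ c) :
    IsSub (zon ω fun s => c + dbl g s) := by
  have h0 : 0 ≤ δ := (abs_nonneg _).trans (hδ 0 (by simp))
  refine isSub_zon hω (r' := fun s => ∫ y in (0)..(max s 0), g y) (A := δ) (B := δ) h0
    (fun s t hs ht => abs_dbl_sub_le hg hδ hs ht) (fun s hs => abs_dbl_le hδ hs)
    (fun s hs => ?_) (by linarith)
  obtain ⟨h1, h2⟩ := abs_max_zero_le hs
  have := abs_integral_le hδ le_rfl zero_le_one h1 h2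
  rw [sub_zero, abs_of_nonneg h1] at this
  nlinarith

end

section

open ProbabilityTheory

variable {V : Type*} [NormedAddCommGroup V] [InnerProductSpace ℝ V]
variable {ν : (V → ℝ) → ℂ} {h k f g : V → ℝ}

/-- The first absolute moment of the standard Gaussian distribution. -/
def absMoment : ℝ := ∫ t, |t| ∂gaussianReal 0 1

lemma integrable_abs_gaussian : Integrable (fun t : ℝ => |t|) (gaussianReal 0 1) :=
  (IsGaussian.integrable_id (μ := gaussianReal 0 1)).abs

lemma absMoment_pos : 0 < absMoment := by
  have : NullSingletonClass (gaussianReal 0 1) := nullSingletonClass_gaussianReal one_ne_zero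
  rw [absMoment, integral_pos_iff_support_of_nonneg (fun t => abs_nonneg t) integrable_abs_gaussian]
  have : Function.support (fun t : ℝ => |t|) = {0}ᶜ := by ext; simp
  rw [this, measure_compl (by simp) (by simp)]
  simp

/-- The second derivative of the profile of an averaged triangle. -/
def ker (a y : ℝ) : ℝ := 2 * a ^ 2 * gaussianPDFReal 0 1 (a * y)

lemma continuous_pdf : Continuous (gaussianPDFReal 0 1) := by
  rw [gaussianPDFReal_def]; fun_prop

lemma continuous_ker (a : ℝ) : Continuous (ker a) := by
  have := continuous_pdf; unfold ker; fun_prop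

lemma integral_max_gaussian {a : ℝ} (ha : 0 < a) (s : ℝ) :
    ∫ t, max |t| (a * s) ∂gaussianReal 0 1 = absMoment + dbl (ker a) s := by
  have e1 : ∀ t : ℝ, max |t| (a * s) = |t| + max (a * s - |t|) 0 := fun t => by
    rw [← max_add_add_left, add_zero, add_sub_cancel, max_comm]
  have hi : Integrable (fun t : ℝ => max (a * s - |t|) 0) (gaussianReal 0 1) := by
    refine ((integrable_const |a * s|).add integrable_abs_gaussian).mono'
      (by fun_prop) (.of_forall fun t => ?_)
    rw [Real.norm_eq_abs, abs_of_nonneg (le_max_right _ _)]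
    simp only [Pi.add_apply]
    have := le_abs_self (a * s)
    exact max_le (by linarith [abs_nonneg t]) (by positivity)
  simp_rw [e1]
  rw [integral_add integrable_abs_gaussian hi, absMoment]
  congr 1
  rw [integral_gaussianReal_eq_integral_smul one_ne_zero]
  have e2 : ∀ t : ℝ, gaussianPDFReal 0 1 t • max (a * s - |t|) 0 =
      (fun t => gaussianPDFReal 0 1 t * max (a * s - t) 0) |t| := fun t => by
    simp [gaussianPDFReal]
  rw [integral_congr_ae (.of_forall e2),
    integral_comp_abs (f := fun t => gaussianPDFReal 0 1 t * max (a * s - t) 0)]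
  rcases le_total s 0 with hs | hs
  · rw [dbl, max_eq_right hs, intervalIntegral.integral_same]
    rw [setIntegral_eq_zero_of_forall_eq_zero, mul_zero]
    intro t ht
    rw [max_eq_right, mul_zero]
    have : 0 < t := ht
    nlinarith
  · rw [dbl, max_eq_left hs]
    have hsub : Set.Ioc 0 (a * s) ⊆ Set.Ioi 0 := fun t ht => ht.1
    rw [setIntegral_eq_of_subset_of_forall_sdiff_eq_zero measurableSet_Ioi hsub,
      ← intervalIntegral.integral_of_le (by positivity)]
    · have e3 := intervalIntegral.smul_integral_comp_mul_left
        (fun t => gaussianPDFReal 0 1 t * max (a * s - t) 0) (a := 0) (b := s) a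
      rw [mul_zero] at e3
      rw [← e3, smul_eq_mul, ← mul_assoc, ← intervalIntegral.integral_const_mul]
      refine intervalIntegral.integral_congr fun y hy => ?_
      rw [Set.uIcc_of_le hs] at hy
      simp only [ker]
      rw [max_eq_left (by nlinarith [hy.2])]
      ring
    · rintro t ⟨h1, h2⟩
      have h1 : 0 < t := h1
      rw [max_eq_right, mul_zero]
      by_contra hc
      exact h2 ⟨h1, by linarith⟩

variable [FiniteDimensional ℝ V] [MeasurableSpace V] [BorelSpace V]

lemma integral_inner_stdGaussian {F : ℝ → ℝ} (hF : Continuous F) (x : V) :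
    ∫ u, F (inner ℝ u x) ∂stdGaussian V = ∫ t, F (‖x‖ * t) ∂gaussianReal 0 1 := by
  have h1 : (stdGaussian V).map (innerSL ℝ x) = gaussianReal 0 (‖x‖₊ ^ 2) := by
    rw [IsGaussian.map_eq_gaussianReal, integral_strongDual_stdGaussian,
      variance_dual_stdGaussian]
    congr 1
    rw [innerSL_apply_norm, ← coe_nnnorm, ← NNReal.coe_pow, Real.toNNReal_coe]
  have h2 : (gaussianReal 0 1).map (‖x‖ * ·) = gaussianReal 0 (‖x‖₊ ^ 2) := by
    rw [gaussianReal_map_const_mul]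
    congr 1
    · simp
    · ext; simp
  have e1 := integral_map (μ := stdGaussian V) (φ := innerSL ℝ x) (f := F)
    (by fun_prop) hF.aestronglyMeasurable
  have e2 := integral_map (μ := gaussianReal 0 1) (φ := (‖x‖ * ·)) (f := F)
    (by fun_prop) hF.aestronglyMeasurable
  rw [← e2, h2, ← h1, e1]
  simp [real_inner_comm]

/-- The Gaussian average of triangles symmetric about an axis is zonal. -/
lemma integral_tri_stdGaussian {ω : V} {a : ℝ} (ha : 0 < a) (x : V) :
    ∫ u, (|lin u| ⊔ lin (a • ω)) x ∂stdGaussian V =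
      zon ω (fun s => absMoment + dbl (ker a) s) x := by
  by_cases hx : x = 0
  · subst hx; simp [zon]
  have hn : 0 < ‖x‖ := norm_pos_iff.2 hx
  simp only [Pi.sup_apply, Pi.abs_apply, lin_apply, inner_smul_left, conj_trivial]
  rw [integral_inner_stdGaussian (F := fun t => max |t| (a * inner ℝ ω x)) (by fun_prop)]
  rw [zon, ← integral_max_gaussian ha, ← integral_const_mul]
  congr 1; ext t
  rw [mul_max_of_nonneg _ _ hn.le, abs_mul, abs_norm]
  congr 1
  field_simp

lemma integral_abs_stdGaussian (x : V) :
    ∫ u, |lin u| x ∂stdGaussian V = absMoment * ‖x‖ := by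
  simp only [Pi.abs_apply, lin_apply]
  rw [integral_inner_stdGaussian (F := fun t => |t|) (by fun_prop), mul_comm, absMoment,
    ← integral_const_mul]
  simp [abs_mul]

end

section

open ProbabilityTheory

variable {V : Type*} [NormedAddCommGroup V] [InnerProductSpace ℝ V]
variable {ν : (V → ℝ) → ℂ} {h k f g : V → ℝ}

/-- The sum of a function and a multiple of its reflection in the origin. -/
def sym (τ : ℝ) : (V → ℝ) →ₗ[ℝ] (V → ℝ) where
  toFun f := fun x => f x + τ * f (-x)
  map_add' f g := by ext x; simp only [Pi.add_apply]; ring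
  map_smul' c f := by ext x; simp only [Pi.smul_apply, smul_eq_mul, RingHom.id_apply]; ring

omit [InnerProductSpace ℝ V] in
lemma sym_apply (τ : ℝ) (f : V → ℝ) (x : V) : sym τ f x = f x + τ * f (-x) := rfl

lemma IsSub.sym (hf : IsSub f) {τ : ℝ} (hτ : 0 ≤ τ) : IsSub (sym τ f) :=
  hf.add ((isSub_neg hf).const_smul hτ)

omit [InnerProductSpace ℝ V] in
lemma sym_norm (τ : ℝ) : sym τ (fun x : V => ‖x‖) = (1 + τ) • fun x : V => ‖x‖ := by
  ext x; simp only [sym_apply, norm_neg, Pi.smul_apply, smul_eq_mul]; ring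

omit [InnerProductSpace ℝ V] in
lemma abs_sym_le {τ : ℝ} (hτ : 0 ≤ τ) {c : ℝ} (hf : ∀ x, |f x| ≤ c * ‖x‖) (x : V) :
    |sym τ f x| ≤ (1 + τ) * c * ‖x‖ := by
  rw [sym_apply]
  refine (abs_add_le _ _).trans ?_
  rw [abs_mul, abs_of_nonneg hτ]
  have h1 := hf x
  have h2 := hf (-x)
  rw [norm_neg] at h2
  nlinarith

lemma IsSub.of_near (H : ∀ δ > 0, ∃ g, IsSub g ∧ ∀ x, |f x - g x| ≤ δ * ‖x‖) : IsSub f := by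
  choose g hg hs using fun n : ℕ => H (1 / ((n : ℝ) + 1)) (by positivity)
  refine .of_tendsto (l := Filter.atTop) hg fun x => ?_
  rw [tendsto_iff_dist_tendsto_zero]
  refine squeeze_zero (fun _ => dist_nonneg) (fun n => ?_)
    (by simpa only [zero_mul] using
      (tendsto_one_div_add_atTop_nhds_zero_nat (𝕜 := ℝ)).mul_const ‖x‖)
  rw [dist_comm, Real.dist_eq]
  exact hs n x

/-- Gaussian approximation of continuous functions on the unit interval. -/
lemma exists_sum_ker_near {g : ℝ → ℝ} (hg : Continuous g) {δ : ℝ} (hδ : 0 < δ) :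
    ∃ (n : ℕ) (c : ℕ → ℝ), ∀ y ∈ Set.Icc (0 : ℝ) 1,
      |g y - ∑ i ∈ Finset.range n, c i * ker √(i + 1) y| ≤ δ := by
  have hc : ContinuousOn (fun y => g √(-2 * Real.log y) / y) (Set.Icc (Real.exp (-1 / 2)) 1) := by
    have h0 : ∀ y ∈ Set.Icc (Real.exp (-1 / 2)) 1, y ≠ 0 :=
      fun y hy => ((Real.exp_pos _).trans_le hy.1).ne'
    refine ContinuousOn.div (hg.comp_continuousOn ?_) continuousOn_id h0
    exact Real.continuous_sqrt.comp_continuousOn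
      (continuousOn_const.mul (Real.continuousOn_log.mono fun y hy => h0 y hy))
  obtain ⟨p, hp⟩ := exists_polynomial_near_of_continuousOn _ _ _ hc δ hδ
  refine ⟨p.natDegree + 1, fun i => p.coeff i * √(2 * Real.pi) / (2 * (i + 1)), fun y hy => ?_⟩
  set z := Real.exp (-y ^ 2 / 2) with hz
  have hz0 : 0 < z := Real.exp_pos _
  have hy1 : y ^ 2 ≤ 1 := by nlinarith [hy.1, hy.2]
  have hz1 : z ≤ 1 := Real.exp_le_one_iff.2 (by nlinarith [sq_nonneg y])
  have hzI : z ∈ Set.Icc (Real.exp (-1 / 2)) 1 :=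
    ⟨Real.exp_le_exp.2 (by linarith), hz1⟩
  have h1 := (hp z hzI).le
  have h2 : √(-2 * Real.log z) = y := by
    rw [hz, Real.log_exp, show -2 * (-y ^ 2 / 2) = y ^ 2 by ring, Real.sqrt_sq hy.1]
  rw [h2] at h1
  have h3 : ∑ i ∈ Finset.range (p.natDegree + 1),
      p.coeff i * √(2 * Real.pi) / (2 * (i + 1)) * ker √(i + 1) y = z * p.eval z := by
    rw [Polynomial.eval_eq_sum_range, Finset.mul_sum]
    refine Finset.sum_congr rfl fun i _ => ?_
    have hi : (0 : ℝ) ≤ i + 1 := by positivity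
    have e : Real.exp (-(√((i : ℝ) + 1) * y - 0) ^ 2 / (2 * (1 : NNReal))) = z ^ (i + 1) := by
      rw [hz, ← Real.exp_nat_mul, sub_zero, mul_pow, Real.sq_sqrt hi]
      push_cast
      congr 1; ring
    have hpi : √(2 * Real.pi) ≠ 0 := by positivity
    rw [ker, gaussianPDFReal, e, Real.sq_sqrt hi, NNReal.coe_one, mul_one]
    field_simp
    ring
  rw [h3]
  have h4 : g y - z * p.eval z = z * -(p.eval z - g y / z) := by field_simp; ring
  rw [h4, abs_mul, abs_neg, abs_of_pos hz0]
  nlinarith [abs_nonneg (p.eval z - g y / z)]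

variable [FiniteDimensional ℝ V]

namespace IsFlat

section

variable [MeasurableSpace V] [BorelSpace V]

lemma integrable_norm_stdGaussian : Integrable (fun u : V => ‖u‖) (stdGaussian V) :=
  (IsGaussian.integrable_id (μ := stdGaussian V)).norm

end

lemma null_norm (hν : IsFlat ν) : Null ν fun x => ‖x‖ := by
  let _ : MeasurableSpace V := borel V
  have _ : BorelSpace V := ⟨rfl⟩
  have h1 : Null ν fun x => absMoment * ‖x‖ := by
    refine .of_near hν.toIsVal (IsSub.norm.const_smul absMoment_pos.le) fun δ hδ => ?_
    simp_rw [← integral_abs_stdGaussian]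
    exact exists_near_integral (F := fun u => |lin u|) (b := fun u => ‖u‖) Null.convex
      (fun f hf => hf.sub) (fun u => hν.null_abs_lin u) (by
        simp only [Pi.abs_apply, lin_apply]; fun_prop)
      integrable_norm_stdGaussian (fun u => norm_nonneg u)
      (fun u x => by simpa using abs_real_inner_le_norm u x) hδ
  have h2 := h1.smul (inv_nonneg.2 absMoment_pos.le)
  convert h2 using 1
  ext x
  simp [absMoment_pos.ne']

variable {τ : ℝ}

lemma null_avg (hν : IsFlat ν) (hτ : 0 ≤ τ) (HT : ∀ u w, Null ν (sym τ (|lin u| ⊔ lin w)))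
    {ω : V} {a : ℝ} (ha : 0 < a) :
    Null ν (sym τ (zon ω fun s => absMoment + dbl (ker a) s)) := by
  let _ : MeasurableSpace V := borel V
  have _ : BorelSpace V := ⟨rfl⟩
  have hb : ∀ (u : V) x, |(|lin u| ⊔ lin (a • ω)) x| ≤ (‖u‖ + a * ‖ω‖) * ‖x‖ := fun u x => by
    have h1 := abs_real_inner_le_norm u x
    have h2 := abs_real_inner_le_norm (a • ω) x
    rw [norm_smul, Real.norm_of_nonneg ha.le] at h2
    simp only [Pi.sup_apply, Pi.abs_apply, lin_apply]
    refine abs_max_le_max_abs_abs.trans (max_le ?_ ?_)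
    · rw [abs_abs]; nlinarith [mul_nonneg (mul_nonneg ha.le (norm_nonneg ω)) (norm_nonneg x)]
    · nlinarith [mul_nonneg (norm_nonneg u) (norm_nonneg x)]
  have hI : ∀ x, Integrable (fun u : V => (|lin u| ⊔ lin (a • ω)) x) (stdGaussian V) := by
    intro x
    refine ((integrable_norm_stdGaussian.add (integrable_const (a * ‖ω‖))).mul_const ‖x‖).mono'
      (Continuous.aestronglyMeasurable ?_) (.of_forall fun u => by
        rw [Real.norm_eq_abs]; exact hb u x)
    simp only [Pi.sup_apply, Pi.abs_apply, lin_apply]; fun_prop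
  have key : ∀ δ > 0, ∃ g, Null ν g ∧
      ∀ x, |sym τ (zon ω fun s => absMoment + dbl (ker a) s) x - g x| ≤ δ * ‖x‖ := by
    intro δ hδ
    have e : ∀ x, sym τ (zon ω fun s => absMoment + dbl (ker a) s) x =
        ∫ u, sym τ (|lin u| ⊔ lin (a • ω)) x ∂stdGaussian V := by
      intro x
      simp only [sym_apply]
      rw [integral_add (hI x) ((hI _).const_mul _), integral_const_mul,
        integral_tri_stdGaussian ha, integral_tri_stdGaussian ha]
    simp_rw [e]
    refine exists_near_integral (F := fun u => sym τ (|lin u| ⊔ lin (a • ω)))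
      (b := fun u => (1 + τ) * (‖u‖ + a * ‖ω‖)) Null.convex
      (fun f hf => hf.sub) (fun u => HT _ _) ?_ ?_ (fun u => by positivity)
      (fun u x => abs_sym_le hτ (hb u) x) hδ
    · simp only [sym_apply, Pi.sup_apply, Pi.abs_apply, lin_apply]; fun_prop
    · exact (integrable_norm_stdGaussian.add (integrable_const _)).const_mul _
  refine .of_near hν.toIsVal (.of_near fun δ hδ => ?_) key
  obtain ⟨g, hg, H⟩ := key δ hδ
  exact ⟨g, hg.sub, H⟩

/-- If symmetrized triangles are null then so are symmetrized zonal functions. -/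
theorem null_zon (hν : IsFlat ν) (hτ : 0 ≤ τ) (HT : ∀ u w, Null ν (sym τ (|lin u| ⊔ lin w)))
    {ω : V} (hω : ‖ω‖ = 1) {r : ℝ → ℝ} (hr : Continuous r) {C : ℝ}
    (hs : IsSub (zon ω fun s => C + dbl r s)) : Null ν (sym τ (zon ω fun s => C + dbl r s)) := by
  refine .of_approx hν.toIsVal (hs.sym hτ) fun δ hδ => ?_
  obtain ⟨n, c, hc⟩ := exists_sum_ker_near hr (δ := δ / (5 * (1 + τ))) (by positivity)
  set δ' := δ / (5 * (1 + τ)) with hδ'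
  have hδ0 : 0 < δ' := by positivity
  set r₀ := fun y => r y - ∑ i ∈ Finset.range n, c i * ker √(i + 1) y with hr₀
  have hr₀c : Continuous r₀ := by
    have := fun i : ℕ => continuous_ker √(i + 1)
    rw [hr₀]; fun_prop
  set R := zon ω fun s => 4 * δ' + dbl r₀ s with hR
  have hRs : IsSub R := isSub_zon_dbl hω hr₀c hc le_rfl
  have hRb : ∀ x, |R x| ≤ 5 * δ' * ‖x‖ := by
    intro x
    rw [hR, zon, abs_mul, abs_norm, mul_comm]
    gcongr
    refine (abs_add_le _ _).trans ?_
    have := abs_dbl_le hc (abs_inner_div_le hω x)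
    rw [abs_of_pos (show 0 < 4 * δ' by positivity)]
    linarith
  set A : ℕ → V → ℝ := fun i => zon ω fun s => absMoment + dbl (ker √(i + 1)) s with hA
  have hAn : ∀ i, Null ν (sym τ (A i)) := fun i =>
    hν.null_avg hτ HT (by positivity)
  set e := (∑ i ∈ Finset.range n, c i) * absMoment + 4 * δ' - C with he
  have hN : Null ν (sym τ fun x => ‖x‖) := by
    rw [sym_norm]; exact hν.null_norm.smul (by positivity)
  refine ⟨sym τ (∑ i ∈ Finset.range n, (-c i)⁺ • A i + e⁺ • fun x => ‖x‖),
    sym τ (∑ i ∈ Finset.range n, (c i)⁺ • A i + (-e)⁺ • fun x => ‖x‖), sym τ R, ?_, ?_,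
    hRs.sym hτ, fun x => ?_, ?_⟩
  · rw [map_add, map_sum, map_smul]
    refine .add (.sum _ fun i _ => ?_) (hN.smul (posPart_nonneg _))
    rw [map_smul]
    exact (hAn i).smul (posPart_nonneg _)
  · rw [map_add, map_sum, map_smul]
    refine .add (.sum _ fun i _ => ?_) (hN.smul (posPart_nonneg _))
    rw [map_smul]
    exact (hAn i).smul (posPart_nonneg _)
  · refine (abs_sym_le hτ hRb x).trans (le_of_eq ?_)
    rw [hδ']; field_simp
  · rw [← map_add, ← map_add]
    congr 1
    ext x
    have h1 : ∀ t : ℝ, t⁺ = (-t)⁺ + t := fun t => by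
      have := posPart_sub_negPart t
      rw [posPart_neg]; linarith
    simp only [Pi.add_apply, Finset.sum_apply, Pi.smul_apply, smul_eq_mul]
    have h2 : ∑ i ∈ Finset.range n, (c i)⁺ * A i x =
        ∑ i ∈ Finset.range n, (-c i)⁺ * A i x + ∑ i ∈ Finset.range n, c i * A i x := by
      rw [← Finset.sum_add_distrib]
      refine Finset.sum_congr rfl fun i _ => ?_
      rw [h1 (c i)]; ring
    rw [h2, h1 e]
    have h3 : zon ω (fun s => C + dbl r s) x + e * ‖x‖ =
        ∑ i ∈ Finset.range n, c i * A i x + R x := by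
      simp only [hR, hA, zon, hr₀, he]
      rw [dbl_sub_sum hr n c fun i => continuous_ker _]
      simp_rw [mul_left_comm (c _), mul_add (c _), ← Finset.mul_sum, Finset.sum_add_distrib,
        ← Finset.sum_mul]
      ring
    linarith

end IsFlat

end

section

variable {V : Type*} [NormedAddCommGroup V] [InnerProductSpace ℝ V]
variable {ν : (V → ℝ) → ℂ} {h k f g : V → ℝ}

lemma dbl_cube {ρ b : ℝ} (hρ : 0 < ρ) (hb : 0 < b) (s : ℝ) :
    dbl (fun y => 24 * ρ ^ 2 * max (2 * ρ * y - b) 0) s = max (2 * ρ * s - b) 0 ^ 3 := by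
  have h1 : max (2 * ρ * max s 0 - b) 0 = max (2 * ρ * s - b) 0 := by
    rcases le_total s 0 with hs | hs
    · rw [max_eq_right hs, max_eq_right (by linarith),
        max_eq_right (by nlinarith [mul_nonneg hρ.le (neg_nonneg.2 hs)])]
    · rw [max_eq_left hs]
  rw [dbl, ← h1]
  set u := max s 0
  rw [integral_eq_of_hasDerivAt_off_countable
    (fun y => 6 * ρ * (u - y) * max (2 * ρ * y - b) 0 ^ 2 + max (2 * ρ * y - b) 0 ^ 3) _
    (Set.countable_singleton (b / (2 * ρ))) (by fun_prop) (fun y hy => ?_)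
    (Continuous.intervalIntegrable (by fun_prop) _ _)]
  · simp [max_eq_right (neg_nonpos.2 hb.le)]
  · have hy : y ≠ b / (2 * ρ) := hy.2
    rcases hy.lt_or_gt with hy | hy
    · have e : 2 * ρ * y - b < 0 := by
        rw [lt_div_iff₀ (by positivity)] at hy; linarith
      have : (fun y => 6 * ρ * (u - y) * max (2 * ρ * y - b) 0 ^ 2 + max (2 * ρ * y - b) 0 ^ 3)
          =ᶠ[nhds y] fun _ => 0 := by
        have : ∀ᶠ z in nhds y, 2 * ρ * z - b < 0 :=
          (Continuous.continuousAt (by fun_prop)).eventually_lt continuousAt_const e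
        filter_upwards [this] with z hz
        simp [max_eq_right hz.le]
      rw [max_eq_right e.le]
      simpa using (hasDerivAt_const y (0 : ℝ)).congr_of_eventuallyEq this
    · have e : 0 < 2 * ρ * y - b := by
        rw [div_lt_iff₀ (by positivity)] at hy; linarith
      have : (fun y => 6 * ρ * (u - y) * max (2 * ρ * y - b) 0 ^ 2 + max (2 * ρ * y - b) 0 ^ 3)
          =ᶠ[nhds y] fun y => 6 * ρ * (u - y) * (2 * ρ * y - b) ^ 2 + (2 * ρ * y - b) ^ 3 := by
        have : ∀ᶠ z in nhds y, 0 < 2 * ρ * z - b :=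
          continuousAt_const.eventually_lt (Continuous.continuousAt (by fun_prop)) e
        filter_upwards [this] with z hz
        simp only [max_eq_left hz.le]
      refine HasDerivAt.congr_of_eventuallyEq ?_ this
      rw [max_eq_left e.le]
      have d1 : HasDerivAt (fun y => 2 * ρ * y - b) (2 * ρ) y := by
        simpa using ((hasDerivAt_id y).const_mul (2 * ρ)).sub_const b
      have d2 : HasDerivAt (fun y => 6 * ρ * (u - y)) (6 * ρ * (-1)) y :=
        ((hasDerivAt_id y).const_sub u).const_mul (6 * ρ)
      refine ((d2.mul (d1.pow 2)).add (d1.pow 3)).congr_deriv ?_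
      simp only [Pi.pow_apply]
      norm_num; ring

/-- The homogeneous extension of the bump `((ε² - ‖x - η‖²)₊)³` on the unit sphere. -/
def bump (ε : ℝ) (η x : V) : ℝ :=
  ‖x‖ * max (2 * inner ℝ η x / ‖x‖ - (‖η‖ ^ 2 + 1 - ε ^ 2)) 0 ^ 3

variable {ε : ℝ} {η η' x y : V}

lemma bump_nonneg : 0 ≤ bump ε η x := by unfold bump; positivity

lemma bump_zero_right : bump ε η 0 = 0 := by simp [bump]

lemma bump_of_norm_eq_one (hx : ‖x‖ = 1) : bump ε η x = max (ε ^ 2 - ‖η - x‖ ^ 2) 0 ^ 3 := by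
  rw [bump, hx, norm_sub_sq_real, hx, one_mul, div_one]
  congr 2
  ring

lemma bump_smul {t : ℝ} (ht : 0 ≤ t) (x : V) : bump ε η (t • x) = t * bump ε η x := by
  rcases ht.eq_or_lt with rfl | ht
  · simp [bump_zero_right]
  · rw [bump, bump, inner_smul_right, norm_smul, Real.norm_of_nonneg ht.le, mul_left_comm 2,
      mul_div_mul_left _ _ ht.ne', mul_assoc]

lemma bump_eq_unit (hx : x ≠ 0) :
    bump ε η x = ‖x‖ * max (ε ^ 2 - ‖η - ‖x‖⁻¹ • x‖ ^ 2) 0 ^ 3 := by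
  have h1 : ‖x‖ ≠ 0 := norm_ne_zero_iff.2 hx
  rw [← bump_of_norm_eq_one (x := ‖x‖⁻¹ • x) (by simp [norm_smul, h1]), bump_smul (by positivity),
    mul_inv_cancel_left₀ h1]

lemma bump_le (hε : |ε| ≤ 1) : bump ε η x ≤ ‖x‖ := by
  by_cases hx : x = 0
  · simp [hx, bump_zero_right]
  rw [bump_eq_unit hx]
  refine mul_le_of_le_one_right (norm_nonneg _)
    (pow_le_one₀ (by positivity) (max_le ?_ zero_le_one))
  have := (sq_le_one_iff_abs_le_one ε).2 hε
  nlinarith [sq_nonneg ‖η - ‖x‖⁻¹ • x‖]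

lemma bump_ne_zero (hε : 0 ≤ ε) (h : bump ε η x ≠ 0) : x ≠ 0 ∧ ‖η - ‖x‖⁻¹ • x‖ < ε := by
  have hx : x ≠ 0 := by rintro rfl; exact h bump_zero_right
  refine ⟨hx, lt_of_pow_lt_pow_left₀ 2 hε ?_⟩
  by_contra hc
  rw [bump_eq_unit hx, max_eq_right (by linarith)] at h
  simp at h

/-- Points of different caps lie on prescribed sides of a suitable hyperplane. -/
lemma le_inner_of_bump {ε' : ℝ} (hε : 0 ≤ ε) (hε1 : ε ≤ 1 / 8) (hε' : 0 ≤ ε') (hε1' : ε' ≤ 1 / 8)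
    (hx : bump ε η x ≠ 0) (hy : bump ε' η' y ≠ 0) (hη : 0 ≤ inner ℝ η η') :
    ‖x‖ / 2 ≤ inner ℝ (η + η') x := by
  obtain ⟨hx0, hx⟩ := bump_ne_zero hε hx
  obtain ⟨hy0, hy⟩ := bump_ne_zero hε' hy
  have n1 : ∀ {z : V}, z ≠ 0 → ‖‖z‖⁻¹ • z‖ = 1 := fun hz => by
    simp [norm_smul, norm_ne_zero_iff.2 hz]
  have key : 1 / 2 ≤ inner ℝ (η + η') (‖x‖⁻¹ • x) := by
    set z := ‖x‖⁻¹ • x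
    have hz : ‖z‖ = 1 := n1 hx0
    have h1 : inner ℝ (η + η') z = 1 + inner ℝ (η - z) z + inner ℝ η η' - inner ℝ η' (η - z) := by
      rw [inner_add_left, inner_sub_left, inner_sub_right, real_inner_self_eq_norm_sq, hz,
        real_inner_comm η' η]
      ring
    have h2 := abs_real_inner_le_norm (η - z) z
    have h3 := abs_real_inner_le_norm η' (η - z)
    have h4 : ‖η'‖ ≤ 2 := by
      have := norm_add_le (η' - ‖y‖⁻¹ • y) (‖y‖⁻¹ • y)
      rw [sub_add_cancel, n1 hy0] at this
      linarith
    rw [hz] at h2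
    have h5 : ‖η'‖ * ‖η - z‖ ≤ 2 * (1 / 8) := by gcongr; linarith
    have := (abs_le.1 h2).1
    have := (abs_le.1 h3).2
    linarith
  rw [inner_smul_right, inv_mul_eq_div, le_div_iff₀ (norm_pos_iff.2 hx0)] at key
  linarith

/-- A multiple of the norm plus a multiple of a bump. -/
def cone (τ ε : ℝ) (η x : V) : ℝ := 384 * ‖x‖ + τ * bump ε η x

lemma cone_zero (τ : ℝ) (hε : |ε| ≤ 1) : cone τ ε (0 : V) = (384 : ℝ) • fun x => ‖x‖ := by
  ext x
  have := (sq_le_one_iff_abs_le_one ε).2 hε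
  simp [cone, bump, this]

lemma cone_eq_zon (hη : η ≠ 0) (hε : |ε| < 1) (τ : ℝ) :
    cone τ ε η = zon (‖η‖⁻¹ • η) fun s => 384 + dbl (fun y => τ * (24 * ‖η‖ ^ 2 *
      max (2 * ‖η‖ * y - (‖η‖ ^ 2 + 1 - ε ^ 2)) 0)) s := by
  ext x
  have h1 : 0 < ‖η‖ := norm_pos_iff.2 hη
  have := (sq_lt_one_iff_abs_lt_one ε).2 hε
  have h2 : ∀ s, dbl (fun y => τ * (24 * ‖η‖ ^ 2 *
      max (2 * ‖η‖ * y - (‖η‖ ^ 2 + 1 - ε ^ 2)) 0)) s =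
      τ * max (2 * ‖η‖ * s - (‖η‖ ^ 2 + 1 - ε ^ 2)) 0 ^ 3 := fun s => by
    rw [← dbl_cube h1 (by nlinarith), dbl, dbl, ← intervalIntegral.integral_const_mul]
    simp only [mul_left_comm τ]
  rw [cone, zon, h2, bump, inner_smul_left, conj_trivial]
  rw [show 2 * ‖η‖ * (‖η‖⁻¹ * inner ℝ η x / ‖x‖) = 2 * inner ℝ η x / ‖x‖ by field_simp]
  ring

lemma isSub_cone {τ : ℝ} (hε : |ε| < 1) (hτ : |τ| ≤ 1) : IsSub (cone τ ε η) := by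
  by_cases hη : η = 0
  · rw [hη, cone_zero τ hε.le]; exact IsSub.norm.const_smul (by norm_num)
  rw [cone_eq_zon hη hε]
  have h1 := (sq_lt_one_iff_abs_lt_one ε).2 hε
  refine isSub_zon_dbl (by simp [norm_smul, hη]) (by fun_prop) (δ := 96) (fun y hy => ?_)
    (by norm_num)
  have h0 := norm_nonneg η
  rw [abs_mul, abs_of_nonneg (show 0 ≤ 24 * ‖η‖ ^ 2 *
      max (2 * ‖η‖ * y - (‖η‖ ^ 2 + 1 - ε ^ 2)) 0 by positivity)]
  have h2 : 24 * ‖η‖ ^ 2 * max (2 * ‖η‖ * y - (‖η‖ ^ 2 + 1 - ε ^ 2)) 0 ≤ 96 := by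
    have h5 : 2 * ‖η‖ * y ≤ 2 * ‖η‖ * 1 := by gcongr; exact hy.2
    rcases le_total (2 * ‖η‖ * y - (‖η‖ ^ 2 + 1 - ε ^ 2)) 0 with h3 | h3
    · rw [max_eq_right h3]; norm_num
    · rw [max_eq_left h3]
      have h4 : ‖η‖ ≤ 2 := by nlinarith
      have h6 : 2 * ‖η‖ * y - (‖η‖ ^ 2 + 1 - ε ^ 2) ≤ 1 := by nlinarith [sq_nonneg (‖η‖ - 1)]
      calc _ ≤ 24 * (2 : ℝ) ^ 2 * 1 := by gcongr
        _ = 96 := by norm_num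
  nlinarith [abs_nonneg τ]

variable [FiniteDimensional ℝ V]

namespace IsFlat

lemma null_sym_cone (hν : IsFlat ν) {τ : ℝ} (hτ : 0 ≤ τ)
    (HT : ∀ u w, Null ν (sym τ (|lin u| ⊔ lin w))) (hε : |ε| < 1) :
    Null ν (sym τ (cone 1 ε η)) := by
  have hs := isSub_cone (η := η) hε abs_one.le
  by_cases hη : η = 0
  · rw [hη, cone_zero 1 hε.le, map_smul, sym_norm]
    exact (hν.null_norm.smul (by positivity)).smul (by norm_num)
  · rw [cone_eq_zon hη hε] at hs ⊢
    exact hν.null_zon hτ HT (by simp [norm_smul, hη]) (by fun_prop) hs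

omit [FiniteDimensional ℝ V] in
lemma null_sym_one (hν : IsFlat ν) (u w : V) : Null ν (sym 1 (|lin u| ⊔ lin w)) := by
  have e : sym 1 (|lin u| ⊔ lin w) =
      |lin u| + (1 / 2 : ℝ) • |lin (u + w)| + (1 / 2 : ℝ) • |lin (u - w)| := by
    ext x
    simp only [sym_apply, Pi.sup_apply, Pi.abs_apply, lin_apply, Pi.add_apply, Pi.smul_apply,
      smul_eq_mul, inner_add_left, inner_sub_left, inner_neg_right, abs_neg, one_mul]
    grind
  rw [e]
  exact ((hν.null_abs_lin _).add ((hν.null_abs_lin _).smul (by norm_num))).add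
    ((hν.null_abs_lin _).smul (by norm_num))

omit [FiniteDimensional ℝ V] in
/-- Additivity for perturbations on the two sides of a hyperplane. -/
lemma split (hν : IsFlat ν) (v : V) {s : ℝ} (hs : 0 ≤ s) (hh : IsSub h) (hf : IsSub (h + f))
    (hg : IsSub (h + g)) (hfg : IsSub (h + f + g)) (hf0 : ∀ x, lin v x ≤ 0 → f x = 0)
    (hg0 : ∀ x, 0 ≤ lin v x → g x = 0)
    (hfb : ∀ x, |f x| ≤ s * |lin v x|) (hgb : ∀ x, |g x| ≤ s * |lin v x|) :
    ν (h + f + g) + ν h = ν (h + f) + ν (h + g) := by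
  have hS := hν.null_abs_lin v
  have hSs : IsSub (s • |lin v|) := (IsSub.abs_lin v).const_smul hs
  have eA : ν (h + f + s • |lin v| + lin (s • v)) = ν (h + f) := by
    rw [hν.trans _ (hf.add hSs), hS.eq _ hs _ hf]
  have eB : ν (h + g + s • |lin v| + lin (-s • v)) = ν (h + g) := by
    rw [hν.trans _ (hg.add hSs), hS.eq _ hs _ hg]
  have e1 : ∀ x, max ((h + f + s • |lin v| + lin (s • v)) x)
      ((h + g + s • |lin v| + lin (-s • v)) x) = (h + f + g + (2 * s) • |lin v|) x := by
    intro x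
    have h1 := abs_le.1 (hfb x)
    have h2 := abs_le.1 (hgb x)
    simp only [Pi.add_apply, lin_smul, Pi.smul_apply, Pi.abs_apply, smul_eq_mul]
    rcases le_total (lin v x) 0 with hx | hx
    · rw [abs_of_nonpos hx] at *
      rw [hf0 x hx, max_eq_right (by linarith)]; ring
    · rw [abs_of_nonneg hx] at *
      rw [hg0 x hx, max_eq_left (by linarith)]; ring
  have e2 : ∀ x, min ((h + f + s • |lin v| + lin (s • v)) x)
      ((h + g + s • |lin v| + lin (-s • v)) x) = h x := by
    intro x
    have h1 := abs_le.1 (hfb x)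
    have h2 := abs_le.1 (hgb x)
    simp only [Pi.add_apply, lin_smul, Pi.smul_apply, Pi.abs_apply, smul_eq_mul]
    rcases le_total (lin v x) 0 with hx | hx
    · rw [abs_of_nonpos hx] at *
      rw [hf0 x hx, min_eq_left (by linarith)]; ring
    · rw [abs_of_nonneg hx] at *
      rw [hg0 x hx, min_eq_right (by linarith)]; ring
  have hA : IsSub (h + f + s • |lin v| + lin (s • v)) := (hf.add hSs).add_lin _
  have hB : IsSub (h + g + s • |lin v| + lin (-s • v)) := (hg.add hSs).add_lin _
  have := hν.val_of hA hB hh e1 e2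
  rwa [eA, eB, hS.eq _ (by positivity) _ hfg] at this

end IsFlat

end

section

variable {V : Type*} [NormedAddCommGroup V] [InnerProductSpace ℝ V] [FiniteDimensional ℝ V]
variable {ν : (V → ℝ) → ℂ} {h k f g : V → ℝ} {ε : ℝ}

namespace IsFlat

/-- A bump may be replaced by the negative of its reflection. -/
lemma flip (hν : IsFlat ν) (hε : |ε| < 1) (η : V) {c : ℝ} (hc : 0 ≤ c)
    (h1 : IsSub (h + c • bump ε η)) (h2 : IsSub (h + c • fun x => -bump ε η (-x))) :
    ν (h + c • bump ε η) = ν (h + c • fun x => -bump ε η (-x)) := by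
  have hN := hν.null_sym_cone (η := η) zero_le_one hν.null_sym_one hε
  rw [← hN.eq c hc _ h2, ← hν.null_norm.eq (c * 768) (by positivity) _ h1]
  congr 1
  ext x
  simp only [Pi.add_apply, Pi.smul_apply, smul_eq_mul, sym_apply, cone, norm_neg]
  ring

omit [FiniteDimensional ℝ V] in
lemma smul_cone (c τ : ℝ) (η : V) :
    c • cone τ ε η = (c * 384) • (fun x => ‖x‖) + (c * τ) • bump ε η := by
  ext x
  simp only [Pi.add_apply, Pi.smul_apply, smul_eq_mul, cone]
  ring

/-- Perturbations by bumps do not interact. -/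
lemma locality (hν : IsFlat ν) {ε' : ℝ} (hε : 0 ≤ ε) (he : ε ≤ 1 / 8) (hε' : 0 ≤ ε')
    (he' : ε' ≤ 1 / 8) (η η' : V) {c c' : ℝ} (hc : 0 ≤ c)
    (hc' : 0 ≤ c') (hh : IsSub h) :
    ν (h + c • cone 1 ε η + c' • cone 1 ε' η') + ν h =
      ν (h + c • cone 1 ε η) + ν (h + c' • cone 1 ε' η') := by
  have hε1 : |ε| < 1 := by rw [abs_of_nonneg hε]; linarith
  have hε1' : |ε'| < 1 := by rw [abs_of_nonneg hε']; linarith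
  have sN : ∀ {t : ℝ}, 0 ≤ t → IsSub (t • fun x : V => ‖x‖) := fun ht => IsSub.norm.const_smul ht
  have sC : ∀ {ε : ℝ}, |ε| < 1 → ∀ (η : V) {t : ℝ}, 0 ≤ t → IsSub (t • cone 1 ε η) :=
    fun hε1 η t ht =>
    (isSub_cone hε1 abs_one.le).const_smul ht
  have sD : ∀ (η : V) {t : ℝ}, 0 ≤ t → IsSub (t • fun x => cone (-1) ε' η (-x)) := fun η t ht =>
    (isSub_neg (isSub_cone hε1' (by simp))).const_smul ht
  set K := h + ((c + 2 * c') * 384) • fun x : V => ‖x‖ with hK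
  have sK : IsSub K := hh.add (sN (by positivity))
  have h0 : ν h = ν K := (hν.null_norm.eq _ (by positivity) _ hh).symm
  have h1 : ν (h + c • cone 1 ε η) = ν (K + c • bump ε η) := by
    rw [← hν.null_norm.eq (2 * c' * 384) (by positivity) _ (hh.add (sC hε1 η hc)), smul_cone]
    congr 1
    ext x; simp only [hK, Pi.add_apply, Pi.smul_apply, smul_eq_mul]; ring
  have h2 : ν (h + c' • cone 1 ε' η') = ν (K + c' • bump ε' η') := by
    rw [← hν.null_norm.eq ((c + c') * 384) (by positivity) _ (hh.add (sC hε1' η' hc')), smul_cone]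
    congr 1
    ext x; simp only [hK, Pi.add_apply, Pi.smul_apply, smul_eq_mul]; ring
  have h3 : ν (h + c • cone 1 ε η + c' • cone 1 ε' η') =
      ν (K + c • bump ε η + c' • bump ε' η') := by
    rw [← hν.null_norm.eq (c' * 384) (by positivity) _
      ((hh.add (sC hε1 η hc)).add (sC hε1' η' hc')),
      smul_cone, smul_cone]
    congr 1
    ext x; simp only [hK, Pi.add_apply, Pi.smul_apply, smul_eq_mul]; ring
  have s1 : IsSub (K + c • bump ε η) := by
    convert (hh.add (sC hε1 η hc)).add (sN (t := 2 * c' * 384) (by positivity)) using 1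
    ext x; simp only [hK, smul_cone, Pi.add_apply, Pi.smul_apply, smul_eq_mul]; ring
  have s2 : IsSub (K + c' • bump ε' η') := by
    convert (hh.add (sC hε1' η' hc')).add (sN (t := (c + c') * 384) (by positivity)) using 1
    ext x; simp only [hK, smul_cone, Pi.add_apply, Pi.smul_apply, smul_eq_mul]; ring
  have s3 : IsSub (K + c • bump ε η + c' • bump ε' η') := by
    convert ((hh.add (sC hε1 η hc)).add (sC hε1' η' hc')).add
      (sN (t := c' * 384) (by positivity)) using 1
    ext x; simp only [hK, smul_cone, Pi.add_apply, Pi.smul_apply, smul_eq_mul]; ring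
  have s4 : IsSub (K + c' • fun x => -bump ε' η' (-x)) := by
    convert (hh.add (sD η' hc')).add (sN (t := (c + c') * 384) (by positivity)) using 1
    ext x; simp only [hK, cone, Pi.add_apply, Pi.smul_apply, smul_eq_mul, norm_neg]; ring
  have s5 : IsSub (K + c • bump ε η + c' • fun x => -bump ε' η' (-x)) := by
    convert ((hh.add (sC hε1 η hc)).add (sD η' hc')).add
      (sN (t := c' * 384) (by positivity)) using 1
    ext x; simp only [hK, cone, Pi.add_apply, Pi.smul_apply, smul_eq_mul, norm_neg]; ring
  rw [h0, h1, h2, h3]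
  by_cases e1 : bump ε η = 0
  · rw [e1, smul_zero, add_zero, add_comm]
  by_cases e2 : bump ε' η' = 0
  · rw [e2, smul_zero, add_zero, add_zero]
  obtain ⟨z, hz⟩ := Function.ne_iff.1 e1
  obtain ⟨z', hz'⟩ := Function.ne_iff.1 e2
  have bd : ∀ {ε : ℝ}, |ε| < 1 → ∀ (η : V) x, |bump ε η x| ≤ ‖x‖ := fun hε1 η x => by
    rw [abs_of_nonneg bump_nonneg]; exact bump_le hε1.le
  have key : ∀ (v : V) (g : V → ℝ), (∀ x, bump ε η x ≠ 0 → ‖x‖ / 2 ≤ lin v x) →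
      (∀ x, g x ≠ 0 → lin v x ≤ -(‖x‖ / 2)) → (∀ x, |g x| ≤ ‖x‖) → IsSub (K + c' • g) →
      IsSub (K + c • bump ε η + c' • g) →
      ν (K + c • bump ε η + c' • g) + ν K = ν (K + c • bump ε η) + ν (K + c' • g) := by
    intro v g hv hg hb sg sg'
    refine hν.split v (s := 2 * (c + c')) (by positivity) sK s1 sg sg' (fun x hx => ?_)
      (fun x hx => ?_) (fun x => ?_) (fun x => ?_)
    · by_cases hf : bump ε η x = 0
      · simp [hf]
      · have := hv x hf
        have hn : ‖x‖ = 0 := by linarith [norm_nonneg x]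
        rw [norm_eq_zero] at hn
        rw [hn, bump_zero_right] at hf; exact absurd rfl hf
    · by_cases hf : g x = 0
      · simp [hf]
      · have := hg x hf
        have h3 := abs_nonneg (g x)
        have h4 := hb x
        have : |g x| = 0 := by linarith
        exact absurd (abs_eq_zero.1 this) hf
    · by_cases hf : bump ε η x = 0
      · simp only [Pi.smul_apply, hf, smul_zero, abs_zero]; positivity
      · have h3 := hv x hf
        have h4 := le_abs_self (lin v x)
        rw [Pi.smul_apply, smul_eq_mul, abs_mul, abs_of_nonneg hc]
        have := bd hε1 η x
        nlinarith [abs_nonneg (lin v x)]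
    · by_cases hf : g x = 0
      · simp only [Pi.smul_apply, hf, smul_zero, abs_zero]; positivity
      · have h3 := hg x hf
        have h4 := neg_le_abs (lin v x)
        rw [Pi.smul_apply, smul_eq_mul, abs_mul, abs_of_nonneg hc']
        have := hb x
        nlinarith [abs_nonneg (lin v x)]
  rcases le_total 0 (inner ℝ η η') with hs | hs
  · rw [hν.flip hε1' η' hc' s3 s5, hν.flip hε1' η' hc' s2 s4]
    refine key (η + η') _ (fun x hx => le_inner_of_bump hε he hε' he' hx hz' hs) (fun x hx => ?_)
      (fun x => ?_) s4 s5
    · have := le_inner_of_bump hε' he' hε he (neg_ne_zero.1 hx) hz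
        ((real_inner_comm η η').symm ▸ hs)
      rw [norm_neg, inner_neg_right, add_comm] at this
      rw [lin_apply]; linarith
    · simpa using bd hε1' η' (-x)
  · have hz'' : bump ε' (-η') (-z') ≠ 0 := by simpa [bump] using hz'
    refine key (η + -η') _ (fun x hx => le_inner_of_bump hε he hε' he' hx hz'' (by
      rw [inner_neg_right]; linarith)) (fun x hx => ?_) (bd hε1' η') s2 s3
    have hz2 : bump ε (-η) (-z) ≠ 0 := by simpa [bump] using hz
    have := le_inner_of_bump hε' he' hε he hx hz2
        (by rw [inner_neg_right, real_inner_comm]; linarith)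
    rw [inner_add_left, inner_neg_left] at this
    rw [lin_apply, inner_add_left, inner_neg_left]; linarith

end IsFlat

end

section

variable {V : Type*} [NormedAddCommGroup V] [InnerProductSpace ℝ V] [FiniteDimensional ℝ V]
variable {ν : (V → ℝ) → ℂ} {h k f g : V → ℝ} {ε : ℝ}

section Smoothing

/-- A radial bump function. -/
def radial (ε : ℝ) (y : V) : ℝ := max (ε ^ 2 - ‖y‖ ^ 2) 0 ^ 3

omit [FiniteDimensional ℝ V] [InnerProductSpace ℝ V] in
lemma continuous_radial : Continuous (radial ε : V → ℝ) := by unfold radial; fun_prop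

omit [FiniteDimensional ℝ V] [InnerProductSpace ℝ V] in
lemma radial_nonneg (y : V) : 0 ≤ radial ε y := by unfold radial; positivity

omit [FiniteDimensional ℝ V] [InnerProductSpace ℝ V] in
lemma radial_eq_zero (hε : 0 ≤ ε) {y : V} (hy : ε < ‖y‖) : radial ε y = 0 := by
  have : ε ^ 2 ≤ ‖y‖ ^ 2 := by gcongr
  rw [radial, max_eq_right (by linarith)]; simp

lemma hasCompactSupport_radial (hε : 0 ≤ ε) : HasCompactSupport (radial ε : V → ℝ) :=
  HasCompactSupport.intro (isCompact_closedBall 0 ε) fun y hy =>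
    radial_eq_zero hε (by simpa using hy)

variable [MeasurableSpace V] [BorelSpace V]

lemma integrable_mul_radial (hε : 0 ≤ ε) {u : V → ℝ} (hu : Continuous u) :
    Integrable fun y => u y * radial ε y :=
  (hu.mul continuous_radial).integrable_of_hasCompactSupport (hasCompactSupport_radial hε).mul_left

lemma integrable_radial (hε : 0 ≤ ε) : Integrable (radial ε : V → ℝ) :=
  continuous_radial.integrable_of_hasCompactSupport (hasCompactSupport_radial hε)

lemma integral_radial_pos (hε : 0 < ε) : 0 < ∫ y : V, radial ε y :=
  continuous_radial.integral_pos_of_hasCompactSupport_nonneg_nonzero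
    (hasCompactSupport_radial hε.le) radial_nonneg (x := 0) (by simp [radial, hε.ne'])

/-- The average of `h` over small balls around the given point. -/
def smooth (ε : ℝ) (h : V → ℝ) (x : V) : ℝ :=
  (∫ y : V, radial ε y)⁻¹ * ∫ y, h (x + ‖x‖ • y) * radial ε y

lemma integral_mul_bump (hh : IsSub h) (x : V) :
    ∫ η, h η * bump ε η x = ∫ y, h (x + ‖x‖ • y) * radial ε y := by
  by_cases hx : x = 0
  · simp [hx, bump_zero_right, hh.map_zero]
  have hn : ‖x‖ ≠ 0 := norm_ne_zero_iff.2 hx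
  rw [← integral_add_right_eq_self _ (‖x‖⁻¹ • x)]
  congr 1
  ext y
  rw [bump_eq_unit hx, add_sub_cancel_right, radial, ← mul_assoc, mul_comm (h _),
    ← hh.smul _ _ (norm_nonneg x), smul_add, smul_inv_smul₀ hn, add_comm]

omit [InnerProductSpace ℝ V] [FiniteDimensional ℝ V] [MeasurableSpace V] [BorelSpace V] in
lemma mul_radial_le_mul {a b : ℝ} (hε : 0 ≤ ε) {y : V} (H : ‖y‖ ≤ ε → a ≤ b) :
    a * radial ε y ≤ b * radial ε y := by
  rcases le_or_gt ‖y‖ ε with hy | hy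
  · exact mul_le_mul_of_nonneg_right (H hy) (radial_nonneg y)
  · simp [radial_eq_zero hε hy]

lemma smooth_near (hh : IsSub h) {L : ℝ} (hL : 0 ≤ L) (HL : ∀ x y, |h x - h y| ≤ L * ‖x - y‖)
    (hε : 0 < ε) (x : V) : |smooth ε h x - h x| ≤ L * ε * ‖x‖ := by
  have hκ := integral_radial_pos (V := V) hε
  have hc : Continuous fun y => h (x + ‖x‖ • y) := hh.continuous.comp (by fun_prop)
  have e : smooth ε h x - h x =
      (∫ y : V, radial ε y)⁻¹ * ∫ y, (h (x + ‖x‖ • y) - h x) * radial ε y := by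
    simp_rw [sub_mul]
    rw [integral_sub (integrable_mul_radial hε.le hc) ((integrable_radial hε.le).const_mul _),
      integral_const_mul, smooth]
    field_simp
  have hb : ∀ y : V, ‖y‖ ≤ ε → |h (x + ‖x‖ • y) - h x| ≤ L * ε * ‖x‖ := fun y hy => by
    refine (HL _ _).trans ?_
    rw [add_sub_cancel_left, norm_smul, norm_norm, mul_assoc, mul_comm ‖x‖]
    gcongr
  rw [e, abs_mul, abs_of_pos (inv_pos.2 hκ), inv_mul_le_iff₀ hκ, ← integral_mul_const]
  refine (abs_integral_le_integral_abs).trans (integral_mono_of_nonneg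
    (.of_forall fun _ => abs_nonneg _) ((integrable_radial hε.le).mul_const _)
    (.of_forall fun y => ?_))
  simp only [abs_mul, abs_of_nonneg (radial_nonneg y)]
  rw [mul_comm (radial ε y)]
  exact mul_radial_le_mul hε.le (hb y)

lemma isSub_smooth (hh : IsSub h) {L : ℝ} (hL : 0 ≤ L) (HL : ∀ x, |h x| ≤ L * ‖x‖)
    (hε : 0 < ε) : IsSub fun x => smooth ε h x + L * ε * ‖x‖ := by
  have hκ := integral_radial_pos (V := V) hε
  have hc : ∀ x : V, Continuous fun y => h (x + ‖x‖ • y) := fun x =>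
    hh.continuous.comp (by fun_prop)
  have hi : ∀ x : V, Integrable fun y => (h (x + ‖x‖ • y) + L * ε * ‖x‖) * radial ε y :=
    fun x => integrable_mul_radial hε.le ((hc x).add continuous_const)
  have e : ∀ x : V, smooth ε h x + L * ε * ‖x‖ = (∫ y : V, radial ε y)⁻¹ *
      ∫ y, (h (x + ‖x‖ • y) + L * ε * ‖x‖) * radial ε y := fun x => by
    simp_rw [add_mul]
    rw [integral_add (integrable_mul_radial hε.le (hc x)) ((integrable_radial hε.le).const_mul _),
      integral_const_mul, smooth]
    field_simp
  refine ⟨fun x x' => ?_, fun t x ht => ?_⟩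
  · simp only [e]
    rw [← mul_add, ← integral_add (hi _) (hi _)]
    refine mul_le_mul_of_nonneg_left (integral_mono (hi _) ((hi _).add (hi _)) fun y => ?_)
      (inv_pos.2 hκ).le
    simp only [← add_mul]
    refine mul_radial_le_mul hε.le fun hy => ?_
    have h1 := hh.add_le (x + ‖x‖ • y + (x' + ‖x'‖ • y)) ((‖x + x'‖ - ‖x‖ - ‖x'‖) • y)
    have h2 := hh.add_le (x + ‖x‖ • y) (x' + ‖x'‖ • y)
    have h3 := (abs_le.1 (HL ((‖x + x'‖ - ‖x‖ - ‖x'‖) • y))).2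
    have h4 : x + ‖x‖ • y + (x' + ‖x'‖ • y) + (‖x + x'‖ - ‖x‖ - ‖x'‖) • y =
        x + x' + ‖x + x'‖ • y := by module
    have h5 := norm_add_le x x'
    rw [norm_smul, Real.norm_of_nonpos (by linarith)] at h3
    rw [h4] at h1
    have h6 : L * (-(‖x + x'‖ - ‖x‖ - ‖x'‖) * ‖y‖) ≤ L * (-(‖x + x'‖ - ‖x‖ - ‖x'‖) * ε) := by
      gcongr; linarith
    linarith
  · have : ∀ y, h (t • x + ‖t • x‖ • y) = t * h (x + ‖x‖ • y) := fun y => by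
      rw [norm_smul, Real.norm_of_nonneg ht, mul_smul, ← smul_add, hh.smul _ _ ht]
    simp only [smooth, this, mul_assoc, integral_const_mul]
    rw [norm_smul, Real.norm_of_nonneg ht]
    ring

lemma exists_near_average (hh : IsSub h) (hh0 : ∀ x, 0 ≤ h x) (hε : 0 < ε) (hε' : ε ≤ 1 / 8) :
    ∃ c : ℝ, 0 ≤ c ∧ ∀ C : Set (V → ℝ), Convex ℝ C → (∀ f ∈ C, IsSub f) →
      (∀ t : ℝ, 0 ≤ t → ∀ η, t • cone 1 ε η ∈ C) → ∀ δ > 0, ∃ g ∈ C, ∀ x,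
        |smooth ε h x + c * ‖x‖ - g x| ≤ δ * ‖x‖ := by
  have hκ := integral_radial_pos (V := V) hε
  have hε1 : |ε| ≤ 1 := by rw [abs_of_pos hε]; linarith
  set κ := ∫ y : V, radial ε y
  set B := Metric.closedBall (0 : V) 2
  have hB0 : volume B ≠ 0 := (Metric.measure_closedBall_pos volume 0 two_pos).ne'
  have hB1 : volume B ≠ ⊤ := measure_closedBall_lt_top.ne
  set m := (volume B).toReal with hm
  have hm0 : 0 < m := ENNReal.toReal_pos hB0 hB1
  have hI : ∀ {u : V → ℝ}, Continuous u → IntegrableOn u B := fun hu =>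
    hu.continuousOn.integrableOn_compact (isCompact_closedBall 0 2)
  have hcondInt : ∀ u : V → ℝ, ∫ η, u η ∂(ProbabilityTheory.cond volume B) = m⁻¹ * ∫ η in B, u η :=
    fun u => by
      rw [ProbabilityTheory.cond, integral_smul_measure, ENNReal.toReal_inv, smul_eq_mul]
  have hP : IsProbabilityMeasure (ProbabilityTheory.cond volume B) :=
    ProbabilityTheory.cond_isProbabilityMeasure_of_finite hB0 hB1
  refine ⟨κ⁻¹ * (384 * ∫ η in B, h η), by
    have := setIntegral_nonneg (μ := volume) (s := B) measurableSet_closedBall fun x _ => hh0 x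
    positivity, fun C hC hCs hCc δ hδ => ?_⟩
  have hq : 0 ≤ m * κ⁻¹ := by positivity
  have hF : Continuous fun p : V × Metric.sphere (0 : V) 1 =>
      ((m * κ⁻¹ * h p.1) • cone 1 ε p.1) p.2 := by
    have := hh.continuous
    have e : (fun p : V × Metric.sphere (0 : V) 1 => ((m * κ⁻¹ * h p.1) • cone 1 ε p.1) p.2) =
        fun p => m * κ⁻¹ * h p.1 * (384 * 1 +
          1 * (1 * max (2 * inner ℝ p.1 (p.2 : V) / 1 - (‖p.1‖ ^ 2 + 1 - ε ^ 2)) 0 ^ 3)) := by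
      ext p
      have h1 : ‖(p.2 : V)‖ = 1 := by simp
      rw [Pi.smul_apply, cone, bump, h1, smul_eq_mul]
    rw [e]
    fun_prop
  have hi : Integrable (fun η => m * κ⁻¹ * h η * 385) (ProbabilityTheory.cond volume B) := by
    rw [ProbabilityTheory.cond]
    refine Integrable.smul_measure ?_ (ENNReal.inv_ne_top.2 hB0)
    exact ((hI hh.continuous).const_mul _).mul_const _
  have hbd : ∀ η x, |((m * κ⁻¹ * h η) • cone 1 ε η) x| ≤ m * κ⁻¹ * h η * 385 * ‖x‖ := by
    intro η x
    have h1 := bump_le (η := η) (x := x) hε1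
    have h2 : 0 ≤ bump ε η x := bump_nonneg
    have h3 := mul_nonneg hq (hh0 η)
    have h4 := norm_nonneg x
    rw [Pi.smul_apply, smul_eq_mul, cone, abs_of_nonneg (mul_nonneg h3 (by positivity)),
      mul_assoc (m * κ⁻¹ * h η)]
    exact mul_le_mul_of_nonneg_left (by linarith) h3
  obtain ⟨g, hg, H⟩ := exists_near_integral (μ := ProbabilityTheory.cond volume B) hC hCs
    (fun η => hCc _ (mul_nonneg hq (hh0 η)) η) hF hi
    (fun η => by have := hh0 η; positivity) hbd hδ
  refine ⟨g, hg, fun x => ?_⟩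
  convert H x using 3
  rw [hcondInt]
  have hs : ∫ η, h η * bump ε η x = ∫ η in B, h η * bump ε η x := by
    refine (setIntegral_eq_integral_of_forall_compl_eq_zero fun η hη => ?_).symm
    by_contra hne
    obtain ⟨hx, hd⟩ := bump_ne_zero hε.le (right_ne_zero_of_mul hne)
    have h1 : ‖‖x‖⁻¹ • x‖ = 1 := by simp [norm_smul, norm_ne_zero_iff.2 hx]
    have := norm_add_le (η - ‖x‖⁻¹ • x) (‖x‖⁻¹ • x)
    rw [sub_add_cancel, h1] at this
    simp only [B, Metric.mem_closedBall, dist_zero_right] at hη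
    linarith
  have hb : Continuous fun η => h η * bump ε η x := by
    unfold bump
    have := hh.continuous
    fun_prop
  have e : ∀ η, ((m * κ⁻¹ * h η) • cone 1 ε η) x =
      m * κ⁻¹ * (h η * (384 * ‖x‖) + h η * bump ε η x) := fun η => by
    simp only [Pi.smul_apply, smul_eq_mul, cone]; ring
  simp_rw [e]
  rw [integral_const_mul, integral_add ((hI hh.continuous).mul_const _) (hI hb),
    integral_mul_const, ← hs, integral_mul_bump hh, smooth,
    show ∫ y : V, radial ε y = κ from rfl]
  field_simp
  ring

end Smoothing

/-- Every sublinear function is obtained from norms and bumps by sums, limits, and cancellation of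
the norm. -/
theorem dense_induction {P : (V → ℝ) → Prop}
    (hc : ∀ ε, 0 < ε → ε ≤ 1 / 8 → ∀ t : ℝ, 0 ≤ t → ∀ η, P (t • cone 1 ε η))
    (hadd : ∀ f g, IsSub f → IsSub g → P f → P g → P (f + g))
    (hlim : ∀ f, IsSub f → (∀ δ > 0, ∃ g, IsSub g ∧ P g ∧ ∀ x, |f x - g x| ≤ δ * ‖x‖) → P f)
    (hnorm : ∀ f, IsSub f → ∀ c : ℝ, 0 ≤ c → P (f + c • fun x => ‖x‖) → P f)
    (hh : IsSub h) : P h := by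
  let _ : MeasurableSpace V := borel V
  have _ : BorelSpace V := ⟨rfl⟩
  have hN : ∀ t : ℝ, 0 ≤ t → P (t • fun x => ‖x‖) := fun t ht => by
    have := hc (1 / 8) (by norm_num) le_rfl (t * 384⁻¹) (by positivity) 0
    rwa [cone_zero 1 (by norm_num), smul_smul, inv_mul_cancel_right₀ (by norm_num)] at this
  have key : ∀ h, IsSub h → (∀ x, 0 ≤ h x) → P h := by
    intro h hh hh0
    obtain ⟨L, hL, HL⟩ := hh.lipschitz
    have HL' : ∀ x, |h x| ≤ L * ‖x‖ := fun x => by simpa [hh.map_zero] using HL x 0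
    refine hlim h hh fun δ hδ => ?_
    set ε := min (1 / 8) (δ / (2 * L + 1)) with hεd
    have hε : 0 < ε := lt_min (by norm_num) (by positivity)
    have hε' : ε ≤ 1 / 8 := min_le_left _ _
    have hεL : 2 * L * ε ≤ δ := by
      have h1 : ε ≤ δ / (2 * L + 1) := min_le_right _ _
      rw [le_div_iff₀ (by positivity)] at h1
      linarith
    have hs := isSub_smooth hh hL HL' hε
    refine ⟨_, hs, ?_, fun x => ?_⟩
    · obtain ⟨c, hc0, H⟩ := exists_near_average hh hh0 hε hε'
      have H' := H {f | IsSub f ∧ ∀ t : ℝ, 0 ≤ t → P (t • f)} (by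
        rintro f ⟨hf, hPf⟩ g ⟨hg, hPg⟩ a b ha hb -
        refine ⟨(hf.const_smul ha).add (hg.const_smul hb), fun t ht => ?_⟩
        rw [smul_add, smul_smul, smul_smul]
        exact hadd _ _ (hf.const_smul (by positivity)) (hg.const_smul (by positivity))
          (hPf _ (by positivity)) (hPg _ (by positivity))) (fun f hf => hf.1)
        (fun t ht η => ⟨(isSub_cone (by rw [abs_of_pos hε]; linarith) abs_one.le).const_smul ht,
          fun s hs => by rw [smul_smul]; exact hc ε hε hε' _ (by positivity) η⟩)
      have hsub : IsSub fun x => smooth ε h x + c * ‖x‖ := .of_near fun δ hδ => by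
        obtain ⟨g, hg, hd⟩ := H' δ hδ
        exact ⟨g, hg.1, hd⟩
      have hP1 : P fun x => smooth ε h x + c * ‖x‖ := hlim _ hsub fun δ hδ => by
        obtain ⟨g, hg, hd⟩ := H' δ hδ
        exact ⟨g, hg.1, by simpa using hg.2 1 zero_le_one, hd⟩
      refine hnorm _ hs c hc0 ?_
      have := hadd _ _ hsub (IsSub.norm.const_smul (mul_nonneg hL hε.le)) hP1
        (hN (L * ε) (by positivity))
      convert this using 1
      ext x
      simp only [Pi.add_apply, Pi.smul_apply, smul_eq_mul]; ring
    · have h1 := abs_le.1 (smooth_near hh hL HL hε x)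
      have h2 : 2 * L * ε * ‖x‖ ≤ δ * ‖x‖ := by gcongr
      have h3 : 0 ≤ L * ε * ‖x‖ := by positivity
      exact abs_le.2 ⟨by linarith, by linarith⟩
  obtain ⟨L, hL, HL⟩ := hh.exists_le_norm
  refine hnorm h hh L hL (key _ (hh.add (IsSub.norm.const_smul hL)) fun x => ?_)
  have := (abs_le.1 (HL x)).1
  simp only [Pi.add_apply, Pi.smul_apply, smul_eq_mul]
  linarith

end

section

variable {V : Type*} [NormedAddCommGroup V] [InnerProductSpace ℝ V] [FiniteDimensional ℝ V]
variable {ν : (V → ℝ) → ℂ} {h k f g : V → ℝ} {ε : ℝ}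

omit [FiniteDimensional ℝ V] in
lemma IsVal.tendsto (hν : IsVal ν) (hf : IsSub f) {u : ℕ → V → ℝ} (hu : ∀ n, IsSub (u n))
    (H : ∀ n x, |f x - u n x| ≤ 1 / ((n : ℝ) + 1) * ‖x‖) :
    Filter.Tendsto (fun n => ν (u n)) Filter.atTop (nhds (ν f)) := by
  refine Metric.tendsto_atTop.2 fun ε hε => ?_
  obtain ⟨δ, hδ, hc⟩ := hν.cont f hf ε hε
  obtain ⟨N, hN⟩ := exists_nat_one_div_lt hδ
  refine ⟨N, fun n hn => ?_⟩
  rw [dist_eq_norm]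
  refine hc _ (hu n) fun x => ?_
  rw [abs_sub_comm]
  refine (H n x).trans (mul_le_mul_of_nonneg_right ?_ (norm_nonneg x))
  exact (one_div_le_one_div_of_le (by positivity) (by gcongr)).trans hN.le

omit [FiniteDimensional ℝ V] in
/-- Linear relations between values of a valuation persist under limits. -/
lemma IsVal.eq_of_near (hν : IsVal ν) {k₁ k₂ k₃ k₄ : V → ℝ} (h1 : IsSub k₁) (h2 : IsSub k₂)
    (hf : IsSub f)
    (H : ∀ δ > 0, ∃ g, IsSub g ∧ ν (k₁ + g) + ν k₃ = ν (k₂ + g) + ν k₄ ∧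
      ∀ x, |f x - g x| ≤ δ * ‖x‖) :
    ν (k₁ + f) + ν k₃ = ν (k₂ + f) + ν k₄ := by
  choose u hu hP hd using fun n : ℕ => H (1 / ((n : ℝ) + 1)) (by positivity)
  have t : ∀ k, IsSub k → Filter.Tendsto (fun n => ν (k + u n)) Filter.atTop (nhds (ν (k + f))) :=
    fun k hk => hν.tendsto (hk.add hf) (fun n => hk.add (hu n)) fun n x => by
      simpa only [Pi.add_apply, add_sub_add_left_eq_sub] using hd n x
  refine tendsto_nhds_unique ((t _ h1).add_const _) ?_
  simp_rw [hP]
  exact (t _ h2).add_const _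

omit [FiniteDimensional ℝ V] in
lemma IsVal.eq_zero_of_near (hν : IsVal ν) (hf : IsSub f)
    (H : ∀ δ > 0, ∃ g, IsSub g ∧ ν g = 0 ∧ ∀ x, |f x - g x| ≤ δ * ‖x‖) : ν f = 0 := by
  choose u hu hP hd using fun n : ℕ => H (1 / ((n : ℝ) + 1)) (by positivity)
  have := hν.tendsto hf hu hd
  simp_rw [hP] at this
  exact tendsto_nhds_unique this tendsto_const_nhds

namespace IsFlat

/-- Flat functionals are additive. -/
theorem add_add (hν : IsFlat ν) (hh : IsSub h) (hf : IsSub f) (hg : IsSub g) :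
    ν (h + f + g) + ν h = ν (h + f) + ν (h + g) := by
  have sC : ∀ {ε : ℝ} (η : V) {t : ℝ}, 0 < ε → ε ≤ 1 / 8 → 0 ≤ t → IsSub (t • cone 1 ε η) :=
    fun η t h0 h1 ht =>
      (isSub_cone (by rw [abs_of_pos h0]; linarith) abs_one.le).const_smul ht
  have hnull : ∀ {k} {c : ℝ}, IsSub k → 0 ≤ c → ν (k + c • fun x => ‖x‖) = ν k := fun hk hc =>
    hν.null_norm.eq _ hc _ hk
  have step : ∀ k, IsSub k →
      (∀ ε, 0 < ε → ε ≤ 1 / 8 → ∀ t : ℝ, 0 ≤ t → ∀ η, ∀ h, IsSub h →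
        ν (h + k + t • cone 1 ε η) + ν h = ν (h + t • cone 1 ε η) + ν (h + k)) →
      ∀ f, IsSub f → ∀ h, IsSub h → ν (h + k + f) + ν h = ν (h + f) + ν (h + k) := by
    intro k hk H f hf
    refine dense_induction (P := fun f => ∀ h, IsSub h →
      ν (h + k + f) + ν h = ν (h + f) + ν (h + k)) H (fun f g hf hg Pf Pg h hh => ?_)
      (fun f hf Hf h hh => ?_) (fun f hf c hc Hf h hh => ?_) hf
    · have h1 := Pf h hh
      have h2 := Pg (h + f) (hh.add hf)
      rw [add_right_comm h f k] at h2
      rw [← add_assoc, ← add_assoc]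
      linear_combination h1 + h2
    · exact hν.toIsVal.eq_of_near (hh.add hk) hh hf fun δ hδ => by
        obtain ⟨g, hg, Pg, hd⟩ := Hf δ hδ
        exact ⟨g, hg, Pg h hh, hd⟩
    · have := Hf h hh
      rwa [← add_assoc, ← add_assoc, hnull ((hh.add hk).add hf) hc, hnull (hh.add hf) hc] at this
  rw [step f hf (fun ε h0 h1 t ht η h hh => ?_) g hg h hh, add_comm]
  rw [add_right_comm, step (t • cone 1 ε η) (sC η h0 h1 ht) (fun ε' h0' h1' t' ht' η' h hh => ?_)
    f hf h hh, add_comm]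
  rw [hν.locality h0.le h1 h0'.le h1' η η' ht ht' hh, add_comm]

lemma add_apply (hν : IsFlat ν) (h0 : ν 0 = 0) (hf : IsSub f) (hg : IsSub g) :
    ν (f + g) = ν f + ν g := by
  simpa [h0] using hν.add_add .zero hf hg

/-- A flat functional vanishes if it vanishes on rotation bodies. -/
theorem eq_zero_of_zonal (hν : IsFlat ν) (H : ∀ η f, IsSub f →
    (∀ x y, ‖x‖ = ‖y‖ → inner ℝ η x = inner ℝ η y → f x = f y) → ν f = 0) (hh : IsSub h) :
    ν h = 0 := by
  have h0 : ν 0 = 0 := H 0 0 .zero fun _ _ _ _ => rfl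
  refine dense_induction (P := fun f => ν f = 0) (fun ε he he' t ht η => ?_)
    (fun f g hf hg Pf Pg => ?_) (fun f hf Hf => ?_) (fun f hf c hc Pf => ?_) hh
  · refine H η _ ((isSub_cone (by rw [abs_of_pos he]; linarith) abs_one.le).const_smul ht)
      fun x y e1 e2 => ?_
    simp only [Pi.smul_apply, cone, bump, e1, e2]
  · rw [hν.add_apply h0 hf hg, Pf, Pg, add_zero]
  · exact hν.toIsVal.eq_zero_of_near hf Hf
  · rwa [hν.null_norm.eq c hc f hf] at Pf

/-- A flat functional vanishes if it vanishes on triangles. -/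
theorem eq_zero_of_tri (hν : IsFlat ν) (H : ∀ x y, ν (tri x y) = 0) (hh : IsSub h) :
    ν h = 0 := by
  have h0 : ν 0 = 0 := by simpa [tri] using H 0 0
  have HT : ∀ u w, Null ν (sym 0 (|lin u| ⊔ lin w)) := by
    intro u w
    have e : sym 0 (|lin u| ⊔ lin w) = tri (-(2 : ℝ) • u) (w + u) + lin u := by
      ext x
      simp only [sym_apply, Pi.sup_apply, Pi.abs_apply, Pi.add_apply, tri, Pi.zero_apply,
        lin_apply, inner_add_left, inner_smul_left, conj_trivial]
      grind
    rw [e]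
    refine .add ⟨isSub_tri _ _, fun t ht h hh => ?_⟩ (.lin hν.toIsVal _)
    rw [hν.add_apply h0 hh ((isSub_tri _ _).const_smul ht)]
    have e2 : ∀ x y : V, t • tri x y = tri (t • x) (t • y) := fun x y => by
      ext z
      simp only [Pi.smul_apply, tri, Pi.sup_apply, Pi.zero_apply, lin_apply, smul_eq_mul,
        mul_max_of_nonneg _ _ ht, inner_add_left, inner_smul_left, conj_trivial]
      simp [mul_add]
    rw [e2, H, add_zero]
  refine dense_induction (P := fun f => ν f = 0) (fun ε he he' t ht η => ?_)
    (fun f g hf hg Pf Pg => ?_) (fun f hf Hf => ?_) (fun f hf c hc Pf => ?_) hh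
  · have := hν.null_sym_cone (η := η) le_rfl HT (ε := ε) (by rw [abs_of_pos he]; linarith)
    have e : sym 0 (cone 1 ε η) = cone 1 ε η := by ext x; simp [sym_apply]
    rw [e] at this
    simpa [h0] using this.eq t ht 0 .zero
  · rw [hν.add_apply h0 hf hg, Pf, Pg, add_zero]
  · exact hν.toIsVal.eq_zero_of_near hf Hf
  · rwa [hν.null_norm.eq c hc f hf] at Pf

end IsFlat

end

section

variable {V : Type*} [NormedAddCommGroup V] [InnerProductSpace ℝ V]
variable {ν : (V → ℝ) → ℂ} {h k : V → ℝ} {J : V →ₗ[ℝ] V}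

/-- Odd valuations that change sign under the complex reflections of a complex structure `J`. -/
structure IsSkew (J : V →ₗ[ℝ] V) (ν : (V → ℝ) → ℂ) : Prop extends IsVal ν where
  sq : ∀ x, J (J x) = -x
  isom : ∀ x y, inner ℝ (J x) (J y) = inner ℝ x y
  odd : IsOdd ν
  refl : ∀ u, ‖u‖ = 1 → ∀ h, IsSub h → ν (h ∘ crefl J u) = -ν h

namespace IsSkew

lemma inner_left (hν : IsSkew J ν) (x y : V) : inner ℝ (J x) y = -inner ℝ x (J y) := by
  rw [← hν.isom x (J y), hν.sq, inner_neg_right, neg_neg]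

lemma inner_swap (hν : IsSkew J ν) (x y : V) : inner ℝ (J x) y = -inner ℝ (J y) x := by
  rw [hν.inner_left, real_inner_comm]

lemma inner_self (hν : IsSkew J ν) (x : V) : inner ℝ (J x) x = 0 := by
  have := hν.inner_swap x x; linarith

lemma inner_self' (hν : IsSkew J ν) (x : V) : inner ℝ x (J x) = 0 := by
  rw [real_inner_comm, hν.inner_self]

lemma map_injective (hν : IsSkew J ν) {x : V} (hx : J x = 0) : x = 0 := by
  have := hν.sq x
  rwa [hx, _root_.map_zero, eq_comm, neg_eq_zero] at this

lemma crefl_inner (hν : IsSkew J ν) {u : V} (hu : ‖u‖ = 1) (x y : V) :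
    inner ℝ (crefl J u x) (crefl J u y) = inner ℝ x y := by
  have h1 : inner ℝ u u = (1 : ℝ) := by rw [real_inner_self_eq_norm_sq, hu]; norm_num
  have h2 : inner ℝ (J u) (J u) = (1 : ℝ) := by rw [hν.isom, h1]
  have h3 := hν.inner_self u
  have h4 := hν.inner_self' u
  simp only [crefl_apply, inner_sub_left, inner_sub_right, inner_smul_left, inner_smul_right,
    conj_trivial, real_inner_comm u x, real_inner_comm (J u) x, h1, h2, h3, h4]
  ring

lemma crefl_crefl (hν : IsSkew J ν) {u : V} (hu : ‖u‖ = 1) (x : V) :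
    crefl J u (crefl J u x) = x := by
  refine ext_inner_right ℝ fun y => ?_
  rw [crefl_symm, hν.crefl_inner hu]

lemma norm_crefl (hν : IsSkew J ν) {u : V} (hu : ‖u‖ = 1) (x : V) : ‖crefl J u x‖ = ‖x‖ := by
  rw [norm_eq_sqrt_real_inner, hν.crefl_inner hu, ← norm_eq_sqrt_real_inner]

end IsSkew

lemma crefl_of_orthogonal {u x : V} (h1 : inner ℝ u x = (0 : ℝ)) (h2 : inner ℝ (J u) x = (0 : ℝ)) :
    crefl J u x = x := by
  simp [crefl_apply, h1, h2]

lemma inner_eq_zero_of_mem_lspan {l : List V} {w x : V} (hx : ∀ w ∈ l, inner ℝ w x = (0 : ℝ))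
    (hw : w ∈ lspan l) : inner ℝ w x = (0 : ℝ) := by
  induction hw using Submodule.span_induction with
  | mem w hw => exact hx w hw
  | zero => simp
  | add a b _ _ ha hb => rw [inner_add_left, ha, hb, add_zero]
  | smul t a _ ha => rw [inner_smul_left, ha, mul_zero]

section
variable [FiniteDimensional ℝ V]

/-- The transformation behaviour under an isometric involution passes to iterated differences in
the directions of an invariant subspace. -/
theorem Ds_comp_involution (hν : IsVal ν) {s : V →ₗ[ℝ] V}
    (hs : ∀ x y, inner ℝ (s x) (s y) = inner ℝ x y) (hss : ∀ x, s (s x) = x) {c : ℂ}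
    (hc : c * c = 1) (hsν : ∀ h, IsSub h → ν (h ∘ s) = c * ν h) {l : List V}
    (hl : ∀ w ∈ l, s w ∈ lspan l) (hh : IsSub h) : Ds l ν (h ∘ s) = c * Ds l ν h := by
  obtain ⟨d, hd0, hd⟩ := IsVal.exists_Ds_eq l (l.map s) (by simpa using hl) (by simp)
  have key : ∀ h, IsSub h → Ds l ν (h ∘ s) = c * (d * Ds l ν h) := fun h hh => by
    rw [Ds_comp hs hsν l h hh, hd ν hν h hh]
  have e := key _ (hh.comp s)
  rw [show (h ∘ s) ∘ s = h from funext fun x => congrArg h (hss x), key h hh] at e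
  rw [key h hh]
  have e' : Ds l ν h = (d : ℂ) * d * Ds l ν h := by
    linear_combination e + (d : ℂ) * d * Ds l ν h * hc
  rcases eq_or_ne (Ds l ν h) 0 with h0 | h0
  · simp [h0]
  · have h1 : (d : ℂ) * d = 1 := by
      have := mul_right_cancel₀ h0 ((one_mul _).trans e'); exact this.symm
    have h2 : d * d = 1 := by exact_mod_cast h1
    have h3 : d = 1 := by nlinarith
    simp [h3]

namespace IsSkew

theorem Ds_crefl (hν : IsSkew J ν) {u : V} (hu : ‖u‖ = 1) {l : List V}
    (hl : ∀ w ∈ l, crefl J u w ∈ lspan l) (hh : IsSub h) :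
    Ds l ν (h ∘ crefl J u) = -Ds l ν h := by
  rw [Ds_comp_involution hν.toIsVal (hν.crefl_inner hu) (hν.crefl_crefl hu) (c := -1) (by norm_num)
    (fun h hh => by rw [hν.refl u hu h hh, neg_one_mul]) hl hh, neg_one_mul]

/-- Differences in the directions of a subspace containing a complex line vanish. -/
theorem Ds_eq_zero_of_line (hν : IsSkew J ν) {l : List V} {z : V} (hz : z ≠ 0)
    (h1 : z ∈ lspan l) (h2 : J z ∈ lspan l) (hh : IsSub h) : Ds l ν h = 0 := by
  set u := ‖z‖⁻¹ • z
  have hu : ‖u‖ = 1 := norm_smul_inv_norm (𝕜 := ℝ) hz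
  have hu1 : u ∈ lspan l := Submodule.smul_mem _ _ h1
  have hu2 : J u ∈ lspan l := by rw [map_smul]; exact Submodule.smul_mem _ _ h2
  have e := hν.Ds_crefl hu (l := l) (fun w hw => by
    rw [crefl_apply]
    exact sub_mem (sub_mem (mem_lspan hw) (Submodule.smul_mem _ _ hu1))
        (Submodule.smul_mem _ _ hu2))
    hh
  have e2 : Ds l ν (h ∘ crefl J u) = Ds l ν h := by
    refine hν.Ds_congr l (hh.comp _) hh fun x hx => ?_
    have hx' := fun w hw => inner_eq_zero_of_mem_lspan (w := w) hx hw
    rw [Function.comp, crefl_of_orthogonal (hx' u hu1) (hx' _ hu2)]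
  rw [e2] at e
  exact self_eq_neg.1 e

end IsSkew
end

end

section

variable {V : Type*} [NormedAddCommGroup V] [InnerProductSpace ℝ V] [FiniteDimensional ℝ V]
variable {ν : (V → ℝ) → ℂ} {h k : V → ℝ} {J : V →ₗ[ℝ] V} {l : List V} {n j : ℕ}

/-- Few linear conditions have a common nontrivial solution in a subspace. -/
lemma exists_unit_orthogonal (R : Submodule ℝ V) (l : List V)
    (hl : l.length < Module.finrank ℝ R) :
    ∃ u ∈ R, ‖u‖ = 1 ∧ ∀ w ∈ l, inner ℝ w u = (0 : ℝ) := by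
  have h1 : ¬ Disjoint R (lspan l)ᗮ := fun hd => by
    have h2 := Submodule.finrank_add_finrank_le_of_disjoint hd
    have h3 := (lspan l).finrank_add_finrank_orthogonal
    have h4 := IsVal.finrank_lspan_le l
    lia
  rw [Submodule.disjoint_def] at h1
  push Not at h1
  obtain ⟨x, hx, hx', hx0⟩ := h1
  refine ⟨‖x‖⁻¹ • x, R.smul_mem _ hx, norm_smul_inv_norm (𝕜 := ℝ) hx0, fun w hw => ?_⟩
  rw [inner_smul_right, (Submodule.mem_orthogonal _ _).1 hx' w (mem_lspan hw), mul_zero]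

/-- All iterated differences of order `j` vanish. -/
def Vanish (ν : (V → ℝ) → ℂ) (j : ℕ) : Prop :=
  ∀ l : List V, l.length = j → ∀ h, IsSub h → Ds l ν h = 0

namespace IsSkew

omit [FiniteDimensional ℝ V] in
lemma isFlat_Ds (hν : IsSkew J ν) (hj : Vanish ν (j + 1)) (hl : l.length = j) :
    IsFlat (Ds l ν) :=
  { hν.toIsVal.Ds l with
    D_eq := fun v h hh => hj (v :: l) (by simp [hl]) h hh }

/-- A subspace of more than half the dimension contains a complex line. -/
lemma exists_line (hν : IsSkew J ν) (R : Submodule ℝ V)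
    (hR : Module.finrank ℝ V < 2 * Module.finrank ℝ R) : ∃ z ∈ R, J z ∈ R ∧ z ≠ 0 := by
  have hJ : Function.Injective J := by
    rw [← LinearMap.ker_eq_bot, LinearMap.ker_eq_bot']
    exact fun x hx => hν.map_injective hx
  have h1 : ¬ Disjoint R (R.map J) := fun hd => by
    have h2 := Submodule.finrank_add_finrank_le_of_disjoint hd
    rw [← (R.equivMapOfInjective J hJ).finrank_eq] at h2
    lia
  rw [Submodule.disjoint_def] at h1
  push Not at h1
  obtain ⟨_, hx, ⟨y, hy, rfl⟩, hx0⟩ := h1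
  exact ⟨y, hy, hx, fun h0 => hx0 (by rw [h0, _root_.map_zero])⟩

lemma vanish_of_lt (hν : IsSkew J ν) (hj : Module.finrank ℝ V < 2 * j) : Vanish ν j := by
  intro l hl h hh
  rcases lt_or_ge (Module.finrank ℝ (lspan l)) j with h1 | h1
  · exact hν.Ds_eq_zero_of_finrank le_rfl (hl ▸ h1) hh
  · obtain ⟨z, hz, hz', h0⟩ := hν.exists_line (lspan l) (by lia)
    exact hν.Ds_eq_zero_of_line h0 hz hz' hh

/-- Vanishing of `Ds l ν` by means of zonal functions and reflections fixing the axis. -/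
theorem Ds_eq_zero_of_axis (hν : IsSkew J ν) (hf : IsFlat (Ds l ν))
    (H : ∀ η, ∃ u, ‖u‖ = 1 ∧ (∀ w ∈ l, crefl J u w ∈ lspan l) ∧
      ∀ x, (∀ w ∈ l, inner ℝ w x = (0 : ℝ)) → inner ℝ η (crefl J u x) = (inner ℝ η x : ℝ))
    (hh : IsSub h) : Ds l ν h = 0 := by
  refine hf.eq_zero_of_zonal (fun η f hfs hz => ?_) hh
  obtain ⟨u, hu, h1, h2⟩ := H η
  have e := hν.Ds_crefl hu h1 hfs
  rw [hν.Ds_congr l (hfs.comp _) hfs fun x hx => hz _ _ (hν.norm_crefl hu x) (h2 x hx)] at e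
  exact self_eq_neg.1 e

lemma vanish_of_le (hν : IsSkew J ν) (hj : Vanish ν (j + 1))
    (hV : 2 * j + 2 < Module.finrank ℝ V) : Vanish ν j := by
  intro l hl h hh
  refine hν.Ds_eq_zero_of_axis (hν.isFlat_Ds hj hl) (fun η => ?_) hh
  obtain ⟨u, -, hu, H⟩ := exists_unit_orthogonal ⊤ (η :: J η :: (l ++ l.map J))
    (by simp only [List.length_cons, List.length_append, List.length_map, finrank_top]; lia)
  have hs : ∀ w, inner ℝ w u = (0 : ℝ) → inner ℝ (J w) u = (0 : ℝ) → crefl J u w = w :=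
    fun w h1 h2 => crefl_of_orthogonal (by rw [real_inner_comm, h1])
      (by rw [hν.inner_swap, h2, neg_zero])
  refine ⟨u, hu, fun w hw => ?_, fun x _ => ?_⟩
  · rw [hs w (H w (by simp [hw])) (H (J w) (by simp; grind))]
    exact mem_lspan hw
  · rw [← crefl_symm, hs η (H η (by simp)) (H _ (by simp))]

/-- Vanishing of `Ds l ν` when the Kähler form has a radical of dimension at least two on the span
of `l`. -/
theorem Ds_eq_zero_of_radical (hν : IsSkew J ν) (hf : IsFlat (Ds l ν)) {K : Submodule ℝ V}
    (hK : K ≤ lspan l) (hK2 : 1 < Module.finrank ℝ K)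
    (H : ∀ u ∈ K, ∀ w ∈ l, inner ℝ (J u) w = (0 : ℝ)) (hh : IsSub h) : Ds l ν h = 0 := by
  refine hν.Ds_eq_zero_of_axis hf (fun η => ?_) hh
  obtain ⟨u, huK, hu, h1⟩ := exists_unit_orthogonal K [J η] (by simpa using hK2)
  have h2 : inner ℝ (J u) η = (0 : ℝ) := by
    rw [hν.inner_swap, h1 _ (by simp), neg_zero]
  refine ⟨u, hu, fun w hw => ?_, fun x hx => ?_⟩
  · rw [crefl_apply, H u huK w hw, mul_zero, zero_smul, sub_zero]
    exact sub_mem (mem_lspan hw) (Submodule.smul_mem _ _ (hK huK))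
  · rw [← crefl_symm, crefl_apply, h2, mul_zero, zero_smul, sub_zero, inner_sub_left,
      inner_smul_left, inner_eq_zero_of_mem_lspan hx (hK huK), mul_zero, sub_zero]

end IsSkew

end

section

variable {V : Type*} [NormedAddCommGroup V] [InnerProductSpace ℝ V]
variable {ν : (V → ℝ) → ℂ} {h k : V → ℝ} {J : V →ₗ[ℝ] V} {l m : List V} {n j : ℕ} {a b p : V}

lemma tri_zero (x : V) : tri 0 x = seg x := by
  ext z; simp [tri, max_comm]

namespace IsVal

/-- If all triangles with an edge parallel to `α • a + β • b` are killed by `ν`, then so is the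
triangle with edges `a` and `b`. -/
theorem map_tri_eq_zero (hν : IsVal ν) (ho : IsOdd ν) {α β : ℝ} (hαβ : α ≠ 0 ∨ β ≠ 0)
    (H : ∀ (t : ℝ) (c : V), ν (tri (t • (α • a + β • b)) c) = 0) : ν (tri a b) = 0 := by
  have key : ∀ (a b : V) (α β : ℝ), α * β ≤ 0 → (α ≠ 0 ∨ β ≠ 0) →
      (∀ (t : ℝ) (c : V), ν (tri (t • (α • a + β • b)) c) = 0) → ν (tri a b) = 0 := by
    intro a b α β hm hαβ H
    have h0 : β - α ≠ 0 := by
      intro h0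
      have : β = α := by linarith
      subst this
      have : β = 0 := by nlinarith
      simp_all
    have ht : 0 ≤ β / (β - α) ∧ β / (β - α) ≤ 1 := by
      have h1 : 1 - β / (β - α) = -α / (β - α) := by field_simp; ring
      have : 0 ≤ β / (β - α) ∧ 0 ≤ -α / (β - α) := by
        rcases mul_nonpos_iff.1 hm with ⟨h2, h3⟩ | ⟨h2, h3⟩
        · exact ⟨div_nonneg_of_nonpos h3 (by linarith),
            div_nonneg_of_nonpos (by linarith) (by linarith)⟩
        · exact ⟨div_nonneg h3 (by linarith), div_nonneg (by linarith) (by linarith)⟩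
      exact ⟨this.1, by linarith⟩
    have e : (β / (β - α)) • (a + b) - a = (β - α)⁻¹ • (α • a + β • b) := by
      have h1 : β / (β - α) - 1 = (β - α)⁻¹ * α := by field_simp; ring
      have h2 : β / (β - α) = (β - α)⁻¹ * β := by field_simp
      calc _ = (β / (β - α) - 1) • a + (β / (β - α)) • b := by module
        _ = _ := by rw [h1, h2]; module
    rw [hν.tri_cut ho a b ht.1 ht.2, e, H, hν.tri_swap ho, H, neg_zero, add_zero]
  have hc : α * β ≤ 0 ∨ (β - α) * -α ≤ 0 ∨ -β * (α - β) ≤ 0 := by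
    by_contra! hc
    nlinarith [hc.1, hc.2.1, hc.2.2]
  rcases hc with hc | hc | hc
  · exact key a b α β hc hαβ H
  · rw [hν.tri_rotate]
    refine key _ _ (β - α) (-α) hc ?_ fun t c => ?_
    · by_contra! h0
      have : α = 0 := by linarith [h0.2]
      have : β = 0 := by linarith [h0.1]
      simp_all
    · convert H t c using 4; module
  · rw [hν.tri_rotate, hν.tri_rotate]
    refine key _ _ (-β) (α - β) hc ?_ fun t c => ?_
    · by_contra! h0
      have : β = 0 := by linarith [h0.1]
      have : α = 0 := by linarith [h0.2]
      simp_all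
    · convert H t c using 4; module

variable [FiniteDimensional ℝ V]

lemma Ds_tri_congr (hν : IsVal ν) {a' b' : V} (ha : a - a' ∈ lspan l) (hb : b - b' ∈ lspan l) :
    Sublin.Ds l ν (tri a b) = Sublin.Ds l ν (tri a' b') := by
  refine hν.Ds_congr l (isSub_tri _ _) (isSub_tri _ _) fun x hx => ?_
  have h1 := inner_eq_zero_of_mem_lspan hx ha
  have h2 := inner_eq_zero_of_mem_lspan hx hb
  rw [inner_sub_left, sub_eq_zero] at h1 h2
  simp only [tri, Pi.sup_apply, lin_apply, inner_add_left, h1, h2]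

lemma Ds_tri_of_mem (hν : IsVal ν) (ho : IsOdd ν) (ha : a ∈ lspan l) :
    Sublin.Ds l ν (tri a b) = 0 := by
  rw [hν.Ds_tri_congr (a' := 0) (b' := b) (by simpa using ha) (by simp), tri_zero]
  exact (hν.Ds l).map_seg (ho.Ds hν l) b

lemma Ds_tri_eq_zero (hν : IsVal ν) (ho : IsOdd ν) {α β : ℝ} (hαβ : α ≠ 0 ∨ β ≠ 0)
    (hp : α • a + β • b - p ∈ lspan l)
    (H : ∀ (t : ℝ) (c : V), Sublin.Ds l ν (tri (t • p) c) = 0) : Sublin.Ds l ν (tri a b) = 0 := by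
  refine (hν.Ds l).map_tri_eq_zero (ho.Ds hν l) hαβ fun t c => ?_
  rw [hν.Ds_tri_congr (a' := t • p) (b' := c) _ (by simp), H]
  rw [← smul_sub]
  exact Submodule.smul_mem _ _ hp

/-- Moving directions of differences along the plane of a triangle. -/
theorem Ds_tri_slide (hlm : List.Forall₂ (fun w w' => w' - w ∈ Submodule.span ℝ {a, b}) l m) :
    ∀ ν : (V → ℝ) → ℂ, IsVal ν → IsOdd ν → (∀ r : List V, r.length + 1 = l.length →
      ∀ u ∈ Submodule.span ℝ {a, b}, ∀ x ∈ Submodule.span ℝ {a, b}, ∀ c,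
        Sublin.Ds (u :: r) ν (tri x c) = 0) →
    Sublin.Ds l ν (tri a b) = Sublin.Ds m ν (tri a b) := by
  induction hlm with
  | nil => intros; rfl
  | @cons w w' l m hw _ ih =>
    intro ν hν ho H
    have e : Sublin.Ds (w :: l) ν (tri a b) = Sublin.Ds (w' :: l) ν (tri a b) := by
      have := (hν.Ds l).D_tri_add (ho.Ds hν l) (a := a) (b := b) (W := ⊤) (c := w) trivial trivial
        (fun u hu x hx c _ => H l rfl u hu x hx c) trivial hw
      rw [add_sub_cancel] at this
      exact this.symm
    have e1 : ∀ l : List V, Sublin.Ds (w' :: l) ν = Sublin.Ds l (Sublin.Ds [w'] ν) := fun l => by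
      rw [← Ds_append]; exact Ds_perm (List.perm_append_singleton w' l).symm ν
    rw [e, e1 l, e1 m]
    refine ih _ (hν.Ds _) (ho.Ds hν _) fun r hr u hu x hx c => ?_
    rw [← Ds_append]
    exact H (r ++ [w']) (by simp [← hr]) u hu x hx c

end IsVal

/-- An alternating form on an odd-dimensional space is degenerate. -/
lemma IsSkew.exists_radical (hν : IsSkew J ν) [FiniteDimensional ℝ V] (W : Submodule ℝ V)
    (hW : Odd (Module.finrank ℝ W)) :
    ∃ q ∈ W, q ≠ 0 ∧ ∀ y ∈ W, inner ℝ (J q) y = (0 : ℝ) := by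
  set B := Module.finBasis ℝ W
  set A : Matrix (Fin (Module.finrank ℝ W)) (Fin (Module.finrank ℝ W)) ℝ :=
    fun i k => inner ℝ (J (B i : V)) (B k : V)
  have hA : A.transpose = -A := by ext i k; exact hν.inner_swap _ _
  have hdet : A.det = 0 := by
    have := A.det_transpose
    rw [hA, Matrix.det_neg, Fintype.card_fin, hW.neg_one_pow] at this
    linarith
  obtain ⟨v, hv, hv0⟩ := Matrix.exists_vecMul_eq_zero_iff.2 hdet
  refine ⟨∑ i, v i • (B i : V), W.sum_mem fun i _ => W.smul_mem _ (B i).2, fun h0 => hv ?_, ?_⟩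
  · have h1 : ∑ i, v i • B i = 0 := by
      apply Subtype.ext; push_cast; exact h0
    funext i
    exact Fintype.linearIndependent_iff.1 B.linearIndependent v h1 i
  · intro y hy
    have h1 : y = ∑ k, B.repr ⟨y, hy⟩ k • (B k : V) := by
      have := congrArg Subtype.val (B.sum_repr ⟨y, hy⟩)
      push_cast at this; exact this.symm
    rw [h1, inner_sum]
    refine Finset.sum_eq_zero fun k _ => ?_
    rw [inner_smul_right, map_sum, sum_inner]
    have h2 := congrFun hv0 k
    simp only [Matrix.vecMul, dotProduct, Pi.zero_apply] at h2
    simp only [map_smul, inner_smul_left, conj_trivial]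
    rw [show ∑ i, v i * inner ℝ (J (B i : V)) (B k : V) = 0 from h2, mul_zero]

end

section

variable {V : Type*} [NormedAddCommGroup V] [InnerProductSpace ℝ V]
variable {ν : (V → ℝ) → ℂ} {h k : V → ℝ} {J : V →ₗ[ℝ] V} {l m : List V} {n j : ℕ} {a b p q : V}

lemma mem_lspan_pair {x : V} : x ∈ lspan [p, q] ↔ ∃ s t : ℝ, s • p + t • q = x := by
  rw [← Submodule.mem_span_pair, lspan]
  have : {x | x ∈ [p, q]} = ({p, q} : Set V) := by ext; simp
  rw [this]

lemma finrank_lspan_pair (H : ∀ s t : ℝ, s • p + t • q = 0 → s = 0 ∧ t = 0) :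
    Module.finrank ℝ (lspan [p, q]) = 2 := by
  have h1 : LinearIndependent ℝ ![p, q] := LinearIndependent.pair_iff.2 H
  have h2 := finrank_span_eq_card h1
  have h3 : lspan [p, q] = Submodule.span ℝ (Set.range ![p, q]) := by
    rw [lspan]; congr 1; ext; simp [eq_comm, or_comm]
  rw [h3, h2, Fintype.card_fin]

/-- Completing a list in a subspace by orthogonal vectors. -/
lemma exists_complete [FiniteDimensional ℝ V] {R : Submodule ℝ V} (hl : lspan l ≤ R) :
    ∃ m : List V, (∀ y ∈ m, y ∈ R ∧ ∀ w ∈ l, inner ℝ w y = (0 : ℝ)) ∧ lspan l ⊔ lspan m = R ∧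
      Module.finrank ℝ (lspan l) + m.length = Module.finrank ℝ R := by
  obtain ⟨m, hm, hm'⟩ := IsVal.exists_lspan_eq ((lspan l)ᗮ ⊓ R)
  refine ⟨m, fun y hy => ?_, ?_, ?_⟩
  · have := hm ▸ mem_lspan hy
    exact ⟨this.2, fun w hw => (Submodule.mem_orthogonal _ _).1 this.1 w (mem_lspan hw)⟩
  · rw [hm]; exact Submodule.sup_orthogonal_inf_of_hasOrthogonalProjection hl
  · rw [hm']; exact Submodule.finrank_add_inf_finrank_orthogonal hl

lemma crefl_self {u : V} (hu : ‖u‖ = 1) (h : inner ℝ (J u) u = (0 : ℝ)) : crefl J u u = -u := by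
  rw [crefl_apply, h, real_inner_self_eq_norm_sq, hu]; module

namespace IsSkew

lemma crefl_map (hν : IsSkew J ν) (u x : V) : crefl J u (J x) = J (crefl J u x) := by
  simp only [crefl_apply, map_sub, map_smul, hν.sq, hν.isom]
  rw [show inner ℝ u (J x) = -inner ℝ (J u) x by rw [hν.inner_left, neg_neg]]
  module

/-- The complex reflection `-1` on a complex plane leaves the valuation invariant. -/
lemma exists_neg_on_plane (hν : IsSkew J ν) (hp : p ≠ 0)
    (hq : ∀ s t : ℝ, q ≠ s • p + t • J p) : ∃ g : V →ₗ[ℝ] V,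
      (∀ x y, inner ℝ (g x) (g y) = inner ℝ x y) ∧ (∀ h, IsSub h → ν (h ∘ g) = ν h) ∧
      (∀ x, g (J x) = J (g x)) ∧ g p = -p ∧ g q = -q ∧
      ∀ w, inner ℝ p w = (0 : ℝ) → inner ℝ q w = (0 : ℝ) → inner ℝ (J p) w = (0 : ℝ) →
        inner ℝ (J q) w = (0 : ℝ) → g w = w := by
  obtain ⟨c, u, hu, rfl⟩ : ∃ (c : ℝ) (u : V), ‖u‖ = 1 ∧ p = c • u :=
    ⟨‖p‖, ‖p‖⁻¹ • p, norm_smul_inv_norm (𝕜 := ℝ) hp, by rw [smul_inv_smul₀ (norm_ne_zero_iff.2 hp)]⟩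
  have hc : c ≠ 0 := by rintro rfl; simp at hp
  set q₀ := q - (inner ℝ u q : ℝ) • u - (inner ℝ (J u) q : ℝ) • J u with hq₀
  have hq0 : q₀ ≠ 0 := fun h0 => by
    refine hq (inner ℝ u q * c⁻¹) (inner ℝ (J u) q * c⁻¹) ?_
    rw [map_smul, smul_smul, smul_smul, inv_mul_cancel_right₀ hc, inv_mul_cancel_right₀ hc]
    rw [hq₀] at h0
    rw [← sub_eq_zero, ← h0]; abel
  obtain ⟨d, v, hv, hqv⟩ : ∃ (d : ℝ) (v : V), ‖v‖ = 1 ∧ q₀ = d • v :=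
    ⟨‖q₀‖, ‖q₀‖⁻¹ • q₀, norm_smul_inv_norm (𝕜 := ℝ) hq0,
      by rw [smul_inv_smul₀ (norm_ne_zero_iff.2 hq0)]⟩
  have hd : d ≠ 0 := by rintro rfl; simp [hqv] at hq0
  have uu : inner ℝ u u = (1 : ℝ) := by rw [real_inner_self_eq_norm_sq, hu]; norm_num
  have h1 : inner ℝ u v = (0 : ℝ) := by
    have : inner ℝ u q₀ = (0 : ℝ) := by
      simp [hq₀, inner_sub_right, inner_smul_right, hν.inner_self', hu]
    rw [hqv, inner_smul_right] at this
    exact (mul_eq_zero.1 this).resolve_left hd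
  have h2 : inner ℝ (J u) v = (0 : ℝ) := by
    have : inner ℝ (J u) q₀ = (0 : ℝ) := by
      simp only [hq₀, inner_sub_right, inner_smul_right, hν.inner_self, hν.isom, uu]; ring
    rw [hqv, inner_smul_right] at this
    exact (mul_eq_zero.1 this).resolve_left hd
  have eu : crefl J v u = u :=
    crefl_of_orthogonal (by rw [real_inner_comm, h1]) (by rw [hν.inner_swap, h2, neg_zero])
  have ev : crefl J u v = v := crefl_of_orthogonal h1 h2
  have ruu := crefl_self hu (hν.inner_self u)
  have rvv := crefl_self hv (hν.inner_self v)
  have eq : q = d • v + (inner ℝ u q : ℝ) • u + (inner ℝ (J u) q : ℝ) • J u := by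
    rw [← hqv, hq₀]; abel
  refine ⟨crefl J u ∘ₗ crefl J v, fun x y => ?_, fun h hh => ?_, fun x => ?_, ?_, ?_, ?_⟩
  · simp only [LinearMap.comp_apply, hν.crefl_inner hu, hν.crefl_inner hv]
  · rw [LinearMap.coe_comp, ← Function.comp_assoc, hν.refl v hv _ (hh.comp _), hν.refl u hu h hh,
      neg_neg]
  · simp only [LinearMap.comp_apply, hν.crefl_map]
  · simp only [LinearMap.comp_apply, map_smul, eu, ruu, smul_neg]
  · generalize inner ℝ u q = s at eq
    generalize inner ℝ (J u) q = t at eq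
    subst eq
    simp only [LinearMap.comp_apply, _root_.map_add, map_smul, eu, ruu, rvv, hν.crefl_map, map_neg,
      ev]
    module
  · intro w w1 w2 w3 w4
    have k1 : inner ℝ u w = (0 : ℝ) := by
      rw [inner_smul_left] at w1; exact (mul_eq_zero.1 w1).resolve_left hc
    have k2 : inner ℝ (J u) w = (0 : ℝ) := by
      rw [map_smul, inner_smul_left] at w3; exact (mul_eq_zero.1 w3).resolve_left hc
    have k3 : inner ℝ v w = (0 : ℝ) := by
      rw [eq] at w2
      simp only [inner_add_left, inner_smul_left, k1, k2, mul_zero, add_zero] at w2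
      exact (mul_eq_zero.1 w2).resolve_left hd
    have k4 : inner ℝ (J v) w = (0 : ℝ) := by
      rw [eq] at w4
      simp only [_root_.map_add, map_smul, hν.sq, inner_add_left, inner_smul_left, k1, k2,
        inner_neg_left, neg_zero, mul_zero, add_zero] at w4
      exact (mul_eq_zero.1 w4).resolve_left hd
    rw [LinearMap.comp_apply, crefl_of_orthogonal k3 k4, crefl_of_orthogonal k1 k2]

variable [FiniteDimensional ℝ V]

/-- A totally real subspace of half the dimension spans over the complex numbers. -/
lemma exists_sub_mem (hν : IsSkew J ν) {R : Submodule ℝ V}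
    (hR : Module.finrank ℝ V ≤ 2 * Module.finrank ℝ R) (h0 : ∀ z ∈ R, J z ∈ R → z = 0) (a : V) :
    ∃ p ∈ R, a - J p ∈ R := by
  have hJ : Function.Injective J := by
    rw [← LinearMap.ker_eq_bot, LinearMap.ker_eq_bot']
    exact fun x hx => hν.map_injective hx
  have hd : Disjoint R (R.map J) := by
    rw [Submodule.disjoint_def]
    rintro _ hx ⟨y, hy, rfl⟩
    rw [h0 y hy hx, _root_.map_zero]
  have ht : R ⊔ R.map J = ⊤ := by
    refine Submodule.eq_top_of_disjoint _ _ ?_ hd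
    rw [← (R.equivMapOfInjective J hJ).finrank_eq]
    lia
  obtain ⟨y, hy, _, ⟨p, hp, rfl⟩, e⟩ := Submodule.mem_sup.1 (ht ▸ Submodule.mem_top : a ∈ _)
  exact ⟨p, hp, by rw [← e, add_sub_cancel_right]; exact hy⟩

end IsSkew

end

section

variable {V : Type*} [NormedAddCommGroup V] [InnerProductSpace ℝ V] [FiniteDimensional ℝ V]
variable {ν : (V → ℝ) → ℂ} {h k : V → ℝ} {J : V →ₗ[ℝ] V} {l m : List V} {n j : ℕ} {a b p q : V}

namespace IsSkew

omit [FiniteDimensional ℝ V] in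
/-- Iterated differences of a triangle in a complex plane that contains two of the directions, the
other directions being orthogonal to it. -/
lemma Ds_tri_map_eq_zero (hν : IsSkew J ν) (hp : p ≠ 0) (hq : ∀ s t : ℝ, q ≠ s • p + t • J p)
    (hm : ∀ w ∈ m, inner ℝ p w = (0 : ℝ) ∧ inner ℝ q w = (0 : ℝ) ∧ inner ℝ (J p) w = (0 : ℝ) ∧
      inner ℝ (J q) w = (0 : ℝ)) : Ds (m ++ [p, q]) ν (tri (J p) (J q)) = 0 := by
  obtain ⟨g, hg, hgν, hgJ, hgp, hgq, hgw⟩ := hν.exists_neg_on_plane hp hq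
  set T := tri (J p) (J q) with hT
  have e1 : (m ++ [p, q]).map g = m ++ [-p, -q] := by
    rw [List.map_append]
    congr 1
    · exact (List.map_congr_left fun w hw => by
        obtain ⟨h1, h2, h3, h4⟩ := hm w hw
        exact hgw w h1 h2 h3 h4).trans (List.map_id m)
    · simp [hgp, hgq]
  have e2 : T ∘ g = fun x => T (-x) := by
    have key : ∀ y x : V, g y = -y → inner ℝ y (g x) = (-inner ℝ y x : ℝ) := fun y x hy => by
      rw [← hg y x, hy, inner_neg_left, neg_neg]
    funext x
    have h1 := key (J p) x (by rw [hgJ, hgp, map_neg])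
    have h2 := key (J q) x (by rw [hgJ, hgq, map_neg])
    simp only [hT, Function.comp, tri, Pi.sup_apply, lin_apply, inner_add_left, h1, h2,
      inner_neg_right, Pi.zero_apply, neg_add]
  have e3 := Ds_comp hg (ν := ν) (c := 1) (fun h hh => by rw [hgν h hh, one_mul]) (m ++ [p, q]) T
    (isSub_tri _ _)
  have e4 : ∀ h, IsSub h → Ds (m ++ [-p, -q]) ν h = Ds (m ++ [p, q]) ν h := fun h hh => by
    rw [Ds_append, Ds_append]
    refine Ds_congr_fun (fun h hh => ?_) m h hh
    simp only [Ds_cons, Ds_nil]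
    rw [(hν.D _).D_neg hh, D_congr_fun (fun h hh => hν.D_neg hh q) p hh]
  rw [e1, e2, hν.odd.Ds hν.toIsVal _ _ (isSub_tri _ _), one_mul, e4 _ (isSub_tri _ _)] at e3
  exact neg_eq_self.1 e3

lemma vanish_half (hν : IsSkew J ν) (hd : Module.finrank ℝ V = 2 * n) (hj : Vanish ν (n + 1)) :
    Vanish ν n := by
  intro l hl h hh
  have hf := hν.isFlat_Ds hj hl
  refine hf.eq_zero_of_tri (fun a b => ?_) hh
  rcases lt_or_ge (Module.finrank ℝ (lspan l)) n with h1 | h1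
  · exact hν.Ds_eq_zero_of_finrank le_rfl (hl ▸ h1) (isSub_tri _ _)
  have hR : Module.finrank ℝ (lspan l) = n := le_antisymm (hl ▸ IsVal.finrank_lspan_le l) h1
  by_cases h0 : ∀ z ∈ lspan l, J z ∈ lspan l → z = 0
  swap
  · push Not at h0
    obtain ⟨z, hz, hz', hz0⟩ := h0
    exact hν.Ds_eq_zero_of_line hz0 hz hz' (isSub_tri _ _)
  obtain ⟨p, hp, hap⟩ := hν.exists_sub_mem (by lia) h0 a
  obtain ⟨q, hq, hbq⟩ := hν.exists_sub_mem (by lia) h0 b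
  rw [hν.Ds_tri_congr hap hbq]
  clear hap hbq
  by_cases hpq : ∀ s t : ℝ, s • p + t • q = 0 → s = 0 ∧ t = 0
  swap
  · push Not at hpq
    obtain ⟨s, t, e, hst⟩ := hpq
    refine hν.Ds_tri_eq_zero hν.odd (α := s) (β := t) (p := 0) ?_ ?_ fun r c => ?_
    · by_contra! h2; exact hst h2.1 h2.2
    · rw [← map_smul, ← map_smul, ← _root_.map_add, e]; simp
    · exact hν.Ds_tri_of_mem hν.odd (by simp)
  have hp0 : p ≠ 0 := by
    rintro rfl
    simpa using (hpq 1 0 (by simp)).1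
  have hqp : ∀ s t : ℝ, q ≠ s • p + t • J p := by
    intro s t e
    have h2 : J (t • p) ∈ lspan l := by
      rw [map_smul, show t • J p = q - s • p by rw [e]; abel]
      exact sub_mem hq (Submodule.smul_mem _ _ hp)
    have h3 := h0 _ (Submodule.smul_mem _ _ hp) h2
    have h4 : t = 0 := (smul_eq_zero.1 h3).resolve_right hp0
    have := hpq s (-1) (by rw [e, h4]; module)
    norm_num at this
  obtain ⟨m, hm1, hm2, hm3⟩ := exists_complete (l := [p, q]) (R := lspan l)
    (lspan_le.2 (by simp [hp, hq]))
  rw [finrank_lspan_pair hpq, hR] at hm3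
  have hC : ∀ w : V, ∃ c ∈ lspan [p, q], ∃ d ∈ Submodule.span ℝ {J p, J q},
      ∀ x ∈ [p, q, J p, J q], inner ℝ x (w + c + d) = (0 : ℝ) := by
    intro w
    set C := lspan [p, q, J p, J q] with hC
    have h2 : C.starProjection w ∈ lspan [p, q] ⊔ Submodule.span ℝ {J p, J q} := by
      have : C ≤ lspan [p, q] ⊔ Submodule.span ℝ {J p, J q} := by
        rw [hC, lspan_le]
        intro x hx
        simp only [List.mem_cons, List.not_mem_nil, or_false] at hx
        rcases hx with rfl | rfl | rfl | rfl
        · exact Submodule.mem_sup_left (mem_lspan (by simp))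
        · exact Submodule.mem_sup_left (mem_lspan (by simp))
        · exact Submodule.mem_sup_right (Submodule.subset_span (by simp))
        · exact Submodule.mem_sup_right (Submodule.subset_span (by simp))
      exact this (C.starProjection_apply_mem w)
    obtain ⟨c, hc, d, hd, e⟩ := Submodule.mem_sup.1 h2
    refine ⟨-c, neg_mem hc, -d, neg_mem hd, fun x hx => ?_⟩
    have h3 := (Submodule.mem_orthogonal _ _).1 (C.sub_starProjection_mem_orthogonal w) x
      (mem_lspan hx)
    rwa [← e, show w - (c + d) = w + -c + -d by abel] at h3
  choose c hc d hd hcd using hC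
  have hpq1 : ∀ m : List V, lspan [p, q] ≤ lspan (m ++ [p, q]) := fun m => by
    rw [lspan_le]; intro x hx; exact mem_lspan (List.mem_append_right _ hx)
  refine hν.Ds_eq_zero_of_le (m := m.map (fun w => w + c w) ++ [p, q]) ?_
    (by simp; lia) (isSub_tri _ _) ?_
  · rw [← hm2]
    refine sup_le (hpq1 _) (lspan_le.2 fun w hw => ?_)
    rw [← add_sub_cancel_right w (c w)]
    refine sub_mem (mem_lspan ?_) (hpq1 _ (hc w))
    exact List.mem_append_left _ (List.mem_map.2 ⟨w, hw, rfl⟩)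
  · rw [Ds_append, IsVal.Ds_tri_slide (m := m.map (fun w => w + c w + d w)) ?_ _ (hν.Ds _)
      (hν.odd.Ds hν.toIsVal _) ?_, ← Ds_append]
    · refine hν.Ds_tri_map_eq_zero hp0 hqp fun w hw => ?_
      obtain ⟨w, -, rfl⟩ := List.mem_map.1 hw
      exact ⟨hcd w _ (by simp), hcd w _ (by simp), hcd w _ (by simp), hcd w _ (by simp)⟩
    · rw [List.forall₂_map_right_iff, List.forall₂_map_left_iff, List.forall₂_same]
      intro w _
      simpa using hd w
    · intro r _ u hu x _ y
      obtain ⟨s, t, rfl⟩ := Submodule.mem_span_pair.1 hu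
      rw [← Ds_append]
      rw [← map_smul, ← map_smul, ← _root_.map_add]
      rcases eq_or_ne (s • p + t • q) 0 with e | e
      · rw [e, _root_.map_zero]; exact D_zero _
      · refine hν.Ds_eq_zero_of_line e ?_ (mem_lspan (by simp)) (isSub_tri _ _)
        exact hpq1 (J (s • p + t • q) :: r) (mem_lspan_pair.2 ⟨s, t, rfl⟩)

end IsSkew

end

section

variable {V : Type*} [NormedAddCommGroup V] [InnerProductSpace ℝ V] [FiniteDimensional ℝ V]
variable {ν : (V → ℝ) → ℂ} {h k : V → ℝ} {J : V →ₗ[ℝ] V} {l m : List V} {n j : ℕ} {a b p q z : V}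

namespace IsSkew

/-- On an even-dimensional space a nontrivial radical has dimension at least two. -/
lemma Ds_eq_zero_of_radical_mem (hν : IsSkew J ν) (hj : Vanish ν (j + 1)) (hje : Even j)
    (hl : l.length = j) (hp : p ∈ lspan l) (hp0 : p ≠ 0) (H : ∀ w ∈ l, inner ℝ (J p) w = (0 : ℝ))
    (hh : IsSub h) : Ds l ν h = 0 := by
  rcases lt_or_ge (Module.finrank ℝ (lspan l)) j with h1 | h1
  · exact hν.Ds_eq_zero_of_finrank le_rfl (hl ▸ h1) hh
  have hR : Module.finrank ℝ (lspan l) = j := le_antisymm (hl ▸ IsVal.finrank_lspan_le l) h1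
  obtain ⟨m, hm1, hm2, hm3⟩ := exists_complete (l := [p]) (R := lspan l)
    (lspan_le.2 (by simp [hp]))
  have hp1 : Module.finrank ℝ (lspan [p]) = 1 := by
    have : lspan [p] = Submodule.span ℝ {p} := by rw [lspan]; congr 1; ext; simp
    rw [this, finrank_span_singleton hp0]
  have hmle : lspan m ≤ lspan l := hm2 ▸ le_sup_right
  have hmf : Module.finrank ℝ (lspan m) = m.length := by
    have h2 := Submodule.finrank_add_le_finrank_add_finrank (lspan [p]) (lspan m)
    rw [hm2] at h2
    have := IsVal.finrank_lspan_le m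
    lia
  obtain ⟨q, hq, hq0, hqm⟩ := hν.exists_radical (lspan m) (by
    rw [hmf, Nat.odd_iff]; rw [Nat.even_iff] at hje; lia)
  have hpq : inner ℝ p q = (0 : ℝ) := by
    rw [real_inner_comm]
    exact inner_eq_zero_of_mem_lspan
      (fun w hw => by rw [real_inner_comm]; exact (hm1 w hw).2 p (by simp)) hq
  have hl' : ∀ x, (∀ w ∈ l, inner ℝ x w = (0 : ℝ)) → ∀ w ∈ lspan l, inner ℝ x w = (0 : ℝ) :=
    fun x hx w hw => by
      rw [real_inner_comm]
      exact inner_eq_zero_of_mem_lspan (fun y hy => by rw [real_inner_comm, hx y hy]) hw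
  refine hν.Ds_eq_zero_of_radical (K := lspan [p, q]) (hν.isFlat_Ds hj hl)
    (lspan_le.2 (by simp [hp, hmle hq])) ?_ ?_ hh
  · rw [finrank_lspan_pair fun s t e => ?_]; · norm_num
    have e1 : inner ℝ p (s • p + t • q) = (0 : ℝ) := by rw [e, inner_zero_right]
    have e2 : inner ℝ q (s • p + t • q) = (0 : ℝ) := by rw [e, inner_zero_right]
    rw [inner_add_right, inner_smul_right, inner_smul_right] at e1 e2
    rw [hpq] at e1
    rw [real_inner_comm] at hpq
    rw [hpq] at e2
    have := inner_self_ne_zero (𝕜 := ℝ).2 hp0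
    have := inner_self_ne_zero (𝕜 := ℝ).2 hq0
    constructor <;> simp_all
  · rintro _ hu w hw
    obtain ⟨s, t, rfl⟩ := mem_lspan_pair.1 hu
    have e : inner ℝ (J q) w = (0 : ℝ) := by
      obtain ⟨x, hx, y, hy, rfl⟩ := Submodule.mem_sup.1 (hm2 ▸ mem_lspan hw : w ∈ _)
      rw [inner_add_right, hqm y hy, add_zero, real_inner_comm]
      refine inner_eq_zero_of_mem_lspan (fun x hx => ?_) hx
      rw [List.mem_singleton.1 hx, real_inner_comm, hν.inner_swap, hl' _ H _ (hmle hq), neg_zero]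
    rw [_root_.map_add, map_smul, map_smul, inner_add_left, inner_smul_left, inner_smul_left, e,
      H w hw, mul_zero, mul_zero, add_zero]

/-- Iterated differences vanish on triangles with an edge in the complexification of the
directions. -/
lemma Ds_tri_map (hν : IsSkew J ν) (hj : Vanish ν (j + 1)) (hje : Even j)
    (hl : l.length = j) (hz : z ∈ lspan l) (b : V) : Ds l ν (tri (J z) b) = 0 := by
  rcases eq_or_ne z 0 with rfl | hz0
  · exact hν.Ds_tri_of_mem hν.odd (by simp)
  rcases lt_or_ge (Module.finrank ℝ (lspan l)) j with h1 | h1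
  · exact hν.Ds_eq_zero_of_finrank le_rfl (hl ▸ h1) (isSub_tri _ _)
  have hR : Module.finrank ℝ (lspan l) = j := le_antisymm (hl ▸ IsVal.finrank_lspan_le l) h1
  by_cases H : ∀ w ∈ l, inner ℝ (J z) w = (0 : ℝ)
  · exact hν.Ds_eq_zero_of_radical_mem hj hje hl hz hz0 H (isSub_tri _ _)
  push Not at H
  obtain ⟨w₀, hw₀, hw₀z⟩ := H
  have hzz : (inner ℝ z z : ℝ) ≠ 0 := inner_self_ne_zero.2 hz0
  have i1 := hν.inner_self z
  have i2 := hν.inner_self' z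
  obtain ⟨w, hw, hw1, hw2⟩ : ∃ w ∈ lspan l, inner ℝ z w = (0 : ℝ) ∧
      inner ℝ (J z) w = (inner ℝ z z : ℝ) := by
    refine ⟨((inner ℝ z z : ℝ) / inner ℝ (J z) w₀) •
      (w₀ - ((inner ℝ z w₀ : ℝ) / inner ℝ z z) • z), Submodule.smul_mem _ _
      (sub_mem (mem_lspan hw₀) (Submodule.smul_mem _ _ hz)), ?_, ?_⟩
    · rw [inner_smul_right, inner_sub_right, inner_smul_right]; field_simp; ring
    · rw [inner_smul_right, inner_sub_right, inner_smul_right, i1]; field_simp; ring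
  obtain ⟨m, hm1, hm2, hm3⟩ := exists_complete (l := [z, w]) (R := lspan l)
    (lspan_le.2 (by simp [hz, hw]))
  rw [finrank_lspan_pair fun s t e => ?_, hR] at hm3
  swap
  · have e1 : inner ℝ z (s • z + t • w) = (0 : ℝ) := by rw [e, inner_zero_right]
    have e2 : inner ℝ (J z) (s • z + t • w) = (0 : ℝ) := by rw [e, inner_zero_right]
    rw [inner_add_right, inner_smul_right, inner_smul_right] at e1 e2
    simp_all
  set f : V → V := fun y => y - ((inner ℝ (J z) y : ℝ) / inner ℝ z z) • w
  have hf : ∀ y ∈ m, inner ℝ z (f y) = (0 : ℝ) ∧ inner ℝ (J z) (f y) = (0 : ℝ) := by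
    intro y hy
    constructor
    · rw [inner_sub_right, inner_smul_right, hw1, (hm1 y hy).2 z (by simp)]; simp
    · rw [inner_sub_right, inner_smul_right, hw2]; field_simp; simp
  have hzw : ∀ x, inner ℝ z x = (0 : ℝ) → inner ℝ (J z) x = (0 : ℝ) → ∀ c,
      Ds (x :: z :: m.map f) ν (tri (J z) c) = 0 ∧ ∀ d, Ds (x :: z :: m.map f) ν (tri c d) = 0 := by
    have : ∀ x, inner ℝ z x = (0 : ℝ) → inner ℝ (J z) x = (0 : ℝ) → ∀ h, IsSub h →
        Ds (x :: z :: m.map f) ν h = 0 := fun x _ hx2 h hh => by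
      refine hν.Ds_eq_zero_of_radical_mem hj hje (p := z) (by simp; lia) (mem_lspan (by simp)) hz0
        (fun y hy => ?_) hh
      simp only [List.mem_cons, List.mem_map] at hy
      rcases hy with rfl | rfl | ⟨y, hy, rfl⟩
      · exact hx2
      · exact i1
      · exact (hf y hy).2
    exact fun x h1 h2 c => ⟨this x h1 h2 _ (isSub_tri _ _), fun d => this x h1 h2 _ (isSub_tri _ _)⟩
  refine hν.Ds_eq_zero_of_le (m := w :: z :: m.map f) ?_ (by simp; lia) (isSub_tri _ _) ?_
  · have hw' : w ∈ lspan (w :: z :: m.map f) := mem_lspan (by simp)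
    rw [← hm2]
    refine sup_le (lspan_le.2 ?_) (lspan_le.2 fun y hy => ?_)
    · intro x hx
      exact mem_lspan (by simp only [List.mem_cons, List.not_mem_nil, or_false] at hx ⊢; tauto)
    · rw [← sub_add_cancel y (((inner ℝ (J z) y : ℝ) / inner ℝ z z) • w)]
      exact add_mem (mem_lspan (List.mem_cons_of_mem _ (List.mem_cons_of_mem _
        (List.mem_map.2 ⟨y, hy, rfl⟩)))) (Submodule.smul_mem _ _ hw')
  · set s := (inner ℝ z b : ℝ) / inner ℝ z z
    set t := (inner ℝ (J z) b : ℝ) / inner ℝ z z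
    set b' := b - s • z - t • w
    have hb1 : inner ℝ z b' = (0 : ℝ) := by
      simp only [b', s, inner_sub_right, inner_smul_right, hw1]; field_simp; simp
    have hb2 : inner ℝ (J z) b' = (0 : ℝ) := by
      simp only [b', t, inner_sub_right, inner_smul_right, hw2, i1]; field_simp; simp
    have hc1 : inner ℝ z (w - J z - b') = (0 : ℝ) := by
      rw [inner_sub_right, inner_sub_right, hw1, hb1, i2]; simp
    have hc2 : inner ℝ (J z) (w - J z - b') = (0 : ℝ) := by
      rw [inner_sub_right, inner_sub_right, hw2, hb2, hν.isom]; simp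
    rw [hν.Ds_tri_congr (a' := J z) (b' := b') (by simp) (by
      rw [show b - b' = s • z + t • w by simp only [b']; abel]
      exact add_mem (Submodule.smul_mem _ _ (mem_lspan (by simp)))
        (Submodule.smul_mem _ _ (mem_lspan (by simp))))]
    have e := (hν.Ds (z :: m.map f)).four_term (hν.odd.Ds hν.toIsVal _) (J z) b' (w - J z - b')
    rw [show J z + b' + (w - J z - b') = w by abel] at e
    rw [Ds_cons, ← e, ← Ds_cons, ← Ds_cons, ← Ds_cons, (hzw _ hc1 hc2 b').1, (hzw _ hb1 hb2 _).1,
      hν.Ds_eq_zero_of_line hz0 (mem_lspan (by simp)) (mem_lspan (by simp)) (isSub_tri _ _)]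
    simp

end IsSkew

end

section

variable {V : Type*} [NormedAddCommGroup V] [InnerProductSpace ℝ V] [FiniteDimensional ℝ V]
variable {ν : (V → ℝ) → ℂ} {h k : V → ℝ} {J : V →ₗ[ℝ] V} {l m : List V} {n j : ℕ} {a b e : V}

/-- If `R + ℝ a + ℝ b` has more than half of the dimension, it meets its image under a linear
endomorphism in a nontrivial way. -/
lemma exists_map_eq_add (J : V →ₗ[ℝ] V) {R : Submodule ℝ V}
    (hR : Module.finrank ℝ V < 2 * (Module.finrank ℝ R + 2)) (a b : V) :
    ∃ α β α' β' : ℝ, ∃ r ∈ R, ∃ r' ∈ R, J (α' • a + β' • b + r') = α • a + β • b + r ∧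
      ¬ (α = 0 ∧ β = 0 ∧ r = 0 ∧ α' = 0 ∧ β' = 0 ∧ r' = 0) := by
  let S : (ℝ × ℝ × R) →ₗ[ℝ] V := (LinearMap.toSpanSingleton ℝ V a).coprod
    ((LinearMap.toSpanSingleton ℝ V b).coprod R.subtype)
  have hS : ∀ x, S x = x.1 • a + x.2.1 • b + x.2.2 := fun x => by simp [S, add_assoc]
  let T : ((ℝ × ℝ × R) × (ℝ × ℝ × R)) →ₗ[ℝ] V := S.coprod (-(J ∘ₗ S))
  have hT := LinearMap.ker_ne_bot_of_finrank_lt (f := T) (by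
    simp only [Module.finrank_prod, Module.finrank_self]; lia)
  obtain ⟨⟨x, y⟩, hx, hx0⟩ := (Submodule.ne_bot_iff _).1 hT
  refine ⟨x.1, x.2.1, y.1, y.2.1, x.2.2, x.2.2.2, y.2.2, y.2.2.2, ?_, fun H => hx0 ?_⟩
  · rw [LinearMap.mem_ker, LinearMap.coprod_apply, LinearMap.neg_apply, LinearMap.comp_apply, hS,
      hS] at hx
    exact (add_neg_eq_zero.1 hx).symm
  · obtain ⟨h1, h2, h3, h4, h5, h6⟩ := H
    ext
    · exact h1
    · exact h2
    · exact h3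
    · exact h4
    · exact h5
    · exact h6

namespace IsSkew

/-- Iterated differences vanish on the triangles that span a complex line. -/
lemma Ds_tri_eq_zero_of_complex (hν : IsSkew J ν) (hj : Vanish ν (j + 1)) (hje : Even j)
    (hj0 : j ≠ 0) (hl : l.length = j) (he : e ≠ 0)
    (hs : Submodule.span ℝ {a, b} = Submodule.span ℝ {e, J e}) : Ds l ν (tri a b) = 0 := by
  obtain ⟨w₁, l, rfl⟩ := List.exists_cons_of_ne_nil (l := l) (by rintro rfl; simp at hl; lia)
  have hee : (inner ℝ e e : ℝ) ≠ 0 := inner_self_ne_zero.2 he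
  have i1 := hν.inner_self e
  have i2 := hν.inner_self' e
  have i3 := hν.isom e e
  set y : V → V := fun w => w - ((inner ℝ e w : ℝ) / inner ℝ e e) • e -
    ((inner ℝ (J e) w : ℝ) / inner ℝ e e) • J e with hy
  have hy1 : ∀ w, inner ℝ e (y w) = (0 : ℝ) := fun w => by
    simp only [hy, inner_sub_right, inner_smul_right, i2]; field_simp; simp
  have hy2 : ∀ w, inner ℝ (J e) (y w) = (0 : ℝ) := fun w => by
    simp only [hy, inner_sub_right, inner_smul_right, i1, i3]; field_simp; simp
  set t : V → ℝ := fun w => -(inner ℝ (J (y w₁)) (y w) : ℝ) / inner ℝ e e with ht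
  have hyw : ∀ w, ∀ s r : ℝ, y w + (s • e + r • J e) - w ∈ Submodule.span ℝ {a, b} :=
    fun w s r => by
      rw [hs, Submodule.mem_span_pair]
      refine ⟨s - (inner ℝ e w : ℝ) / inner ℝ e e, r - (inner ℝ (J e) w : ℝ) / inner ℝ e e, ?_⟩
      simp only [hy]; module
  rw [IsVal.Ds_tri_slide (m := (y w₁ + ((1 : ℝ) • e + (0 : ℝ) • J e)) ::
    l.map fun w => y w + ((0 : ℝ) • e + t w • J e)) ?_ ν hν.toIsVal hν.odd ?_]
  · refine hν.Ds_eq_zero_of_radical_mem hj hje (p := y w₁ + ((1 : ℝ) • e + (0 : ℝ) • J e))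
      (by simpa using hl) (mem_lspan (by simp)) ?_ ?_ (isSub_tri _ _)
    · intro h0
      have h1 : inner ℝ e (y w₁ + ((1 : ℝ) • e + (0 : ℝ) • J e)) = (0 : ℝ) := by
        rw [h0, inner_zero_right]
      rw [inner_add_right, hy1] at h1
      simp at h1
      exact he h1
    · intro w hw
      rcases List.mem_cons.1 hw with rfl | hw
      · exact hν.inner_self _
      · obtain ⟨w, -, rfl⟩ := List.mem_map.1 hw
        have h1 : inner ℝ (J (y w₁)) (J e) = (0 : ℝ) := by
          rw [hν.isom, real_inner_comm, hy1]
        simp only [one_smul, zero_smul, add_zero, zero_add, _root_.map_add, inner_add_left,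
          inner_add_right, inner_smul_right, h1, hy2, i3, ht]
        field_simp; simp
  · refine List.Forall₂.cons (hyw _ _ _) ?_
    rw [List.forall₂_map_right_iff, List.forall₂_same]
    exact fun w _ => hyw _ _ _
  · intro r hr u hu x hx c
    rw [hs] at hu hx
    obtain ⟨s, t, rfl⟩ := Submodule.mem_span_pair.1 hu
    obtain ⟨s', t', rfl⟩ := Submodule.mem_span_pair.1 hx
    by_cases h0 : s ^ 2 + t ^ 2 = 0
    · have h1 : s = 0 := by nlinarith [sq_nonneg s, sq_nonneg t]
      have h2 : t = 0 := by nlinarith [sq_nonneg s, sq_nonneg t]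
      rw [h1, h2, zero_smul, zero_smul, add_zero]
      exact D_zero _
    · set u := s • e + t • J e
      have hu' : u ∈ lspan (u :: r) := mem_lspan (by simp)
      have key : s' • e + t' • J e - J (((s * t' - t * s') / (s ^ 2 + t ^ 2)) • u) =
          ((s * s' + t * t') / (s ^ 2 + t ^ 2)) • u := by
        simp only [u, map_smul, _root_.map_add, hν.sq]
        match_scalars <;> field_simp <;> ring
      rw [hν.Ds_tri_congr (b' := c) (key ▸ Submodule.smul_mem _ _ hu') (by simp)]
      exact hν.Ds_tri_map hj hje (by simpa [hr] using hl) (Submodule.smul_mem _ _ hu') c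

lemma vanish_pred (hν : IsSkew J ν) (hd : Module.finrank ℝ V = 2 * (j + 1))
    (hj : Vanish ν (j + 1)) (hje : Even j) (hj0 : j ≠ 0) : Vanish ν j := by
  intro l hl h hh
  refine (hν.isFlat_Ds hj hl).eq_zero_of_tri (fun a b => ?_) hh
  rcases lt_or_ge (Module.finrank ℝ (lspan l)) j with h1 | h1
  · exact hν.Ds_eq_zero_of_finrank le_rfl (hl ▸ h1) (isSub_tri _ _)
  obtain ⟨α, β, α', β', r, hr, r', hr', hJ, h0⟩ := exists_map_eq_add J (R := lspan l)
    (by lia) a b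
  by_cases hdet : α * β' - α' * β = 0
  · by_cases h2 : α = 0 ∧ β = 0 ∧ α' = 0 ∧ β' = 0
    · obtain ⟨rfl, rfl, rfl, rfl⟩ := h2
      simp only [zero_smul, zero_add] at hJ
      refine hν.Ds_eq_zero_of_line (fun h3 => h0 ?_) hr' (hJ ▸ hr) (isSub_tri _ _)
      simp [h3, ← hJ]
    · obtain ⟨s, t, hst, h3, h4⟩ : ∃ s t : ℝ, (s ≠ 0 ∨ t ≠ 0) ∧ s * α + t * α' = 0 ∧
          s * β + t * β' = 0 := by
        by_cases h3 : α = 0 ∧ α' = 0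
        · refine ⟨β', -β, ?_, by rw [h3.1, h3.2]; ring, by ring⟩
          by_contra! h4
          exact h2 ⟨h3.1, neg_eq_zero.1 h4.2, h3.2, h4.1⟩
        · refine ⟨α', -α, ?_, by ring, by linarith⟩
          by_contra! h4
          exact h3 ⟨neg_eq_zero.1 h4.2, h4.1⟩
      set e := α' • a + β' • b + r' with he
      have hz : t • e + s • J e ∈ lspan l := by
        have : t • e + s • J e = (s * α + t * α') • a + (s * β + t * β') • b +
            (t • r' + s • r) := by rw [hJ, he]; module
        rw [this, h3, h4, zero_smul, zero_smul, zero_add, zero_add]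
        exact add_mem (Submodule.smul_mem _ _ hr') (Submodule.smul_mem _ _ hr)
      refine hν.Ds_tri_eq_zero hν.odd (α := t * α - s * α') (β := t * β - s * β')
        (p := J (t • e + s • J e)) ?_ ?_ fun x c => ?_
      · by_contra! h5
        have hst' : s ^ 2 + t ^ 2 ≠ 0 := by
          rcases hst with h6 | h6 <;> positivity
        have f : ∀ x : ℝ, (s ^ 2 + t ^ 2) * x = 0 → x = 0 := fun x hx =>
          (mul_eq_zero.1 hx).resolve_left hst'
        refine h2 ⟨f _ ?_, f _ ?_, f _ ?_, f _ ?_⟩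
        · linear_combination s * h3 + t * h5.1
        · linear_combination s * h4 + t * h5.2
        · linear_combination t * h3 - s * h5.1
        · linear_combination t * h4 - s * h5.2
      · have : (t * α - s * α') • a + (t * β - s * β') • b - J (t • e + s • J e) =
            s • r' - t • r := by
          rw [_root_.map_add, map_smul, map_smul, hν.sq, hJ, he]; module
        rw [this]
        exact sub_mem (Submodule.smul_mem _ _ hr') (Submodule.smul_mem _ _ hr)
      · rw [← map_smul]
        exact hν.Ds_tri_map hj hje hl (Submodule.smul_mem _ _ hz) c
  · set e := α' • a + β' • b + r' with he
    set d := α * β' - α' * β with hd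
    have hA : a - ((β' / d) • J e - (β / d) • e) = (β / d) • r' - (β' / d) • r := by
      rw [hJ, he]
      match_scalars <;> field_simp <;> (try rw [hd]) <;> ring
    have hB : b - ((α / d) • e - (α' / d) • J e) = (α' / d) • r - (α / d) • r' := by
      rw [hJ, he]
      match_scalars <;> field_simp <;> (try rw [hd]) <;> ring
    rw [hν.Ds_tri_congr (hA ▸ sub_mem (Submodule.smul_mem _ _ hr') (Submodule.smul_mem _ _ hr))
      (hB ▸ sub_mem (Submodule.smul_mem _ _ hr) (Submodule.smul_mem _ _ hr'))]
    clear_value e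
    rcases eq_or_ne e 0 with rfl | h3
    · exact hν.Ds_tri_of_mem hν.odd (by simp)
    refine hν.Ds_tri_eq_zero_of_complex hj hje hj0 hl h3 (le_antisymm ?_ ?_)
    · rw [Submodule.span_le, Set.insert_subset_iff, Set.singleton_subset_iff]
      constructor
      · exact Submodule.mem_span_pair.2 ⟨-(β / d), β' / d, by module⟩
      · exact Submodule.mem_span_pair.2 ⟨α / d, -(α' / d), by module⟩
    · rw [Submodule.span_le, Set.insert_subset_iff, Set.singleton_subset_iff]
      constructor
      · refine Submodule.mem_span_pair.2 ⟨α', β', ?_⟩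
        match_scalars <;> field_simp <;> (try rw [hd]) <;> ring
      · refine Submodule.mem_span_pair.2 ⟨α, β, ?_⟩
        match_scalars <;> field_simp <;> (try rw [hd]) <;> ring

theorem eq_zero (hν : IsSkew J ν) (hn : 2 ≤ n) (hodd : Odd n)
    (hd : Module.finrank ℝ V = 2 * n) (hh : IsSub h) : ν h = 0 := by
  have h1 : Vanish ν (n - 1) := by
    have hn1 : n - 1 + 1 = n := by lia
    refine hν.vanish_pred (by rw [hn1, hd]) (by
      rw [hn1]; exact hν.vanish_half hd (hν.vanish_of_lt (by lia)))
      (Nat.Odd.sub_odd hodd odd_one) (by lia)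
  have h2 : ∀ i, i ≤ n - 1 → Vanish ν (n - 1 - i) := by
    intro i
    induction i with
    | zero => exact fun _ => h1
    | succ i ih =>
      intro hi
      refine hν.vanish_of_le ?_ (by lia)
      rw [show n - 1 - (i + 1) + 1 = n - 1 - i by lia]
      exact ih (by lia)
  exact h2 (n - 1) le_rfl [] (by simp) h hh

end IsSkew

end

section

variable {n : ℕ} {μ : ConvexBody (Cn n) → ℂ}
open Classical in
/-- The functional on sublinear functions that corresponds to a functional on convex bodies. -/
def subVal (μ : ConvexBody (Cn n) → ℂ) (h : Cn n → ℝ) : ℂ :=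
  if hh : IsSub h then μ hh.body else 0

lemma subVal_of {h : Cn n → ℝ} (hh : IsSub h) : subVal μ h = μ hh.body := dif_pos hh

lemma isVal_subVal (h1 : IsValuation μ) (h2 : Continuous μ) (h3 : TranslationInvariant μ) :
    IsVal (subVal μ) where
  val h k hh hk hm := by
    rw [subVal_of hh, subVal_of hk, subVal_of hm, subVal_of (hh.sup hk)]
    exact h1 _ _ _ _ (body_sup hh hk hm) (body_inf hh hk hm)
  trans h hh y := by
    rw [subVal_of hh, subVal_of (hh.add_lin y)]
    exact h3 y _ _ (body_add_lin hh y)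
  cont h hh ε hε := by
    obtain ⟨δ, hδ, H⟩ := Metric.continuous_iff.1 h2 hh.body ε hε
    refine ⟨δ / 2, by positivity, fun k hk hkh => ?_⟩
    rw [subVal_of hh, subVal_of hk, ← dist_eq_norm]
    refine H _ (lt_of_le_of_lt ?_ (half_lt_self hδ))
    rw [← ConvexBody.hausdorffDist_coe]
    refine Metric.hausdorffDist_le_of_mem_dist (by positivity) (fun y hy => ?_) fun y hy => ?_
    · exact exists_near hh (by positivity) (fun x => by linarith [(abs_le.1 (hkh x)).2]) hy
    · exact exists_near hk (by positivity) (fun x => by linarith [(abs_le.1 (hkh x)).1]) hy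

lemma subVal_comp (h4 : HasWeight 1 μ) {g : Matrix (Fin n) (Fin n) ℂ}
    (hg : g ∈ Matrix.unitaryGroup (Fin n) ℂ) (s : Cn n →ₗ[ℝ] Cn n)
    (hgs : ∀ x, Matrix.toEuclideanLin g x = s x) (hs : ∀ x, s (s x) = x)
    (hs' : ∀ x y, inner ℝ (s x) y = inner ℝ x (s y)) {h : Cn n → ℝ} (hh : IsSub h) :
    subVal μ (h ∘ s) = g.det * subVal μ h := by
  rw [subVal_of hh, subVal_of (hh.comp s), h4 g hg hh.body, zpow_one]
  rw [body_comp hh s hs hs']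
  exact Set.image_congr fun x _ => (hgs x).symm

/-- Multiplication by the imaginary unit. -/
def mulI (n : ℕ) : Cn n →ₗ[ℝ] Cn n where
  toFun x := Complex.I • x
  map_add' := by simp
  map_smul' t x := by ext; simp; ring

lemma real_inner_eq (x y : Cn n) : inner ℝ x y = (inner ℂ x y).re := by
  simp only [PiLp.inner_apply]
  rw [Complex.re_sum]
  rfl

/-- Multiplication by the imaginary unit is a complex structure that makes a continuous,
translation invariant valuation of weight one on `ℂⁿ` skew, for odd `n`. -/
theorem isSkew_subVal (hodd : Odd n) (h1 : IsValuation μ) (h2 : Continuous μ)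
    (h3 : TranslationInvariant μ) (h4 : HasWeight 1 μ) : IsSkew (mulI n) (subVal μ) := by
  refine ⟨isVal_subVal h1 h2 h3, fun x => by ext i; simp [mulI, ← mul_assoc], fun x y => by
    rw [real_inner_eq, real_inner_eq]; simp [mulI, ← mul_assoc],
    fun h hh => ?_, fun u hu h hh => ?_⟩
  · have := subVal_comp h4 (g := -1) (by
      rw [Matrix.mem_unitaryGroup_iff]; simp) (-LinearMap.id)
      (fun x => by simp) (fun x => by simp) (fun x y => by simp) hh
    rw [Matrix.det_neg, Matrix.det_one, Fintype.card_fin, hodd.neg_one_pow, mul_one, neg_one_mul]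
      at this
    exact this
  · have huu : ∑ i, u i * (starRingEnd ℂ) (u i) = 1 := by
      have : inner ℂ u u = (1 : ℂ) := by rw [inner_self_eq_norm_sq_to_K, hu]; simp
      rw [PiLp.inner_apply] at this
      simpa only [RCLike.inner_apply] using this
    set v : Matrix (Fin n) (Fin 1) ℂ := Matrix.of fun i _ => u i
    set w : Matrix (Fin 1) (Fin n) ℂ := Matrix.of fun _ i => (starRingEnd ℂ) (u i)
    have hwv : w * v = 1 := by
      ext i j; fin_cases i; fin_cases j
      simp [Matrix.mul_apply, v, w, mul_comm, huu]
    have hvs : v.conjTranspose = w := rfl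
    have hws : w.conjTranspose = v := by rw [← hvs, Matrix.conjTranspose_conjTranspose]
    have hsq : (1 - (2 : ℂ) • (v * w)) * (1 - (2 : ℂ) • (v * w)) = 1 := by
      have : v * w * (v * w) = v * w := by
        rw [Matrix.mul_assoc, ← Matrix.mul_assoc w, hwv, Matrix.one_mul]
      simp only [mul_sub, sub_mul, Matrix.smul_mul, Matrix.mul_smul, this, mul_one,
        one_mul, smul_smul]
      module
    have happ : ∀ x, Matrix.toEuclideanLin (1 - (2 : ℂ) • (v * w)) x = crefl (mulI n) u x := by
      intro x
      have e1 : (inner ℝ u x : ℝ) = (inner ℂ u x).re := real_inner_eq u x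
      have e2 : (inner ℝ (mulI n u) x : ℝ) = (inner ℂ u x).im := by
        rw [real_inner_eq]; simp [mulI]
      have e3 : w.mulVec x = fun _ => inner ℂ u x := by
        ext i; simp [Matrix.mulVec, dotProduct, w, PiLp.inner_apply, mul_comm]
      rw [crefl_apply, e1, e2]
      ext i
      simp only [Matrix.toLpLin_apply, Matrix.sub_mulVec, Matrix.smul_mulVec, Matrix.one_mulVec,
        ← Matrix.mulVec_mulVec, e3]
      apply Complex.ext <;> simp [mulI, Matrix.mulVec, dotProduct, v] <;> ring
    have := subVal_comp h4 (g := 1 - (2 : ℂ) • (v * w)) (by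
      rw [Matrix.mem_unitaryGroup_iff]
      rw [Matrix.star_eq_conjTranspose]
      simp only [Matrix.conjTranspose_sub, Matrix.conjTranspose_smul, Matrix.conjTranspose_mul,
        Matrix.conjTranspose_one, hvs, hws]
      simpa using hsq) (crefl (mulI n) u) happ
      (fun x => by
        rw [← happ, ← happ, Matrix.toLpLin_apply, Matrix.toLpLin_apply, Matrix.mulVec_mulVec, hsq]
        simp) (crefl_symm _ _) hh
    rw [this]
    have hdet : (1 - (2 : ℂ) • (v * w)).det = -1 := by
      have := Matrix.det_one_sub_mul_comm ((2 : ℂ) • v) w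
      rw [Matrix.smul_mul] at this
      rw [this, Matrix.mul_smul, hwv, Matrix.det_fin_one]
      simp; norm_num
    rw [hdet, neg_one_mul]

end

end Sublin

/-- For odd `n ≥ 2`, every continuous, translation invariant valuation on `ℂⁿ` of weight
`1` is identically zero. -/
theorem weight_one_valuation_zero_odd (n : ℕ) (hn : 2 ≤ n) (hodd : Odd n)
    (μ : ConvexBody (Cn n) → ℂ)
    (h1 : IsValuation μ) (h2 : Continuous μ) (h3 : TranslationInvariant μ)
    (h4 : HasWeight 1 μ) :
    ∀ K : ConvexBody (Cn n), μ K = 0 := by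
  intro K
  have key := (Sublin.isSkew_subVal hodd h1 h2 h3 h4).eq_zero hn hodd (by
    rw [← Module.finrank_mul_finrank ℝ ℂ, Complex.finrank_real_complex,
      finrank_euclideanSpace_fin]) (Sublin.isSub_supp K)
  rwa [Sublin.subVal_of (Sublin.isSub_supp K), Sublin.body_supp] at key

end
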